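/- For every integer r ≥ 1 and every σ ≥ 1 there is a constant C > 0 depending only on r and σ such that: for every σ-quasi-uniform rectangular partition P of Ω with mesh size h, every α : Ω → ℝ piecewise constant with respect to P with 0 < α_0 ≤ α ≤ α_1, every u : Ω → ℝ that is continuous, vanishes on ∂Ω, is C^{r+2} on each closed cell, and whose cellwise flux functions α·∂u/∂x and α·∂u/∂y extend continuously to Ω, and every finite volume solution u_P ∈ U_P^r, the superconvergence estimate |u_I − u_P|_1 ≤ C · (α_1 / α_0) · h^{r+1} · |u|_{r+2,P} holds, where u_I is the Lobatto interpolant of u. -/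

import Mathlib

open Polynomial MeasureTheory

noncomputable section

/-- `Leg r` is the `r`-th (formal) derivative of `(X² − 1)^r`, a nonzero scalar
multiple of the degree-`r` Legendre polynomial. -/
def Leg (r : ℕ) : Polynomial ℝ :=
  (fun p => Polynomial.derivative p)^[r] ((Polynomial.X ^ 2 - 1) ^ r)

/-- `G 1 < … < G r` are the Gauss points: the roots of `Leg r`, all in `(-1,1)`. -/
def IsGaussPoints (r : ℕ) (G : ℕ → ℝ) : Prop :=
  (∀ k, 1 ≤ k → k < r → G k < G (k + 1)) ∧
  ∀ k, 1 ≤ k → k ≤ r → G k ∈ Set.Ioo (-1 : ℝ) 1 ∧ (Leg r).IsRoot (G k)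

/-- `A k = ∫_{-1}^{1} ℓ_k` where `ℓ_k` is the Lagrange basis polynomial of degree
`≤ r - 1` at the Gauss points, i.e. `ℓ_k (G j) = δ_{jk}`. -/
def IsGaussWeights (r : ℕ) (G A : ℕ → ℝ) : Prop :=
  ∀ k, 1 ≤ k → k ≤ r → ∃ ℓ : Polynomial ℝ,
    ℓ.natDegree ≤ r - 1 ∧
    (∀ j, 1 ≤ j → j ≤ r → ℓ.eval (G j) = if j = k then 1 else 0) ∧
    A k = ∫ x in (-1 : ℝ)..1, ℓ.eval x

/-- `Lob 0 = −1 < Lob 1 < … < Lob (r−1) < Lob r = 1` are the Lobatto points: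
`±1` together with the roots of the derivative of `Leg r`. -/
def IsLobattoPoints (r : ℕ) (L : ℕ → ℝ) : Prop :=
  L 0 = -1 ∧ L r = 1 ∧ (∀ k < r, L k < L (k + 1)) ∧
  ∀ k, 1 ≤ k → k + 1 ≤ r → L k ∈ Set.Ioo (-1 : ℝ) 1 ∧
    (Polynomial.derivative (Leg r)).IsRoot (L k)

/-- Cellwise partial derivative in the first (`x`) coordinate. -/
def pdx (f : ℝ × ℝ → ℝ) (z : ℝ × ℝ) : ℝ := fderiv ℝ f z (1, 0)

/-- Cellwise partial derivative in the second (`y`) coordinate. -/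
def pdy (f : ℝ × ℝ → ℝ) (z : ℝ × ℝ) : ℝ := fderiv ℝ f z (0, 1)

/-- A rectangular partition of `Ω = [a,b] × [c,d]`:
`a = x₀ < x₁ < … < x_m = b`, `c = y₀ < y₁ < … < y_n = d`. -/
structure RectPartition (a b c d : ℝ) where
  m : ℕ
  n : ℕ
  hm : 0 < m
  hn : 0 < n
  x : ℕ → ℝ
  y : ℕ → ℝ
  hxa : x 0 = a
  hxb : x m = b
  hyc : y 0 = c
  hyd : y n = d
  hxlt : ∀ i < m, x i < x (i + 1)
  hylt : ∀ j < n, y j < y (j + 1)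

namespace RectPartition

variable {a b c d : ℝ}

/-- The domain `Ω = [a,b] × [c,d]`. -/
def dom (_P : RectPartition a b c d) : Set (ℝ × ℝ) := Set.Icc a b ×ˢ Set.Icc c d

/-- The boundary `∂Ω`. -/
def bdry (P : RectPartition a b c d) : Set (ℝ × ℝ) :=
  P.dom \ (Set.Ioo a b ×ˢ Set.Ioo c d)

variable (P : RectPartition a b c d)

/-- Side length `h_i^x = x_i − x_{i−1}`. -/
def hx (i : ℕ) : ℝ := P.x i - P.x (i - 1)

/-- Side length `h_j^y = y_j − y_{j−1}`. -/
def hy (j : ℕ) : ℝ := P.y j - P.y (j - 1)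

/-- The closed cell `τ_{i,j} = [x_{i−1}, x_i] × [y_{j−1}, y_j]`. -/
def cell (i j : ℕ) : Set (ℝ × ℝ) :=
  Set.Icc (P.x (i - 1)) (P.x i) ×ˢ Set.Icc (P.y (j - 1)) (P.y j)

/-- The open cell `(x_{i−1}, x_i) × (y_{j−1}, y_j)`. -/
def openCell (i j : ℕ) : Set (ℝ × ℝ) :=
  Set.Ioo (P.x (i - 1)) (P.x i) ×ˢ Set.Ioo (P.y (j - 1)) (P.y j)

/-- The finite set of all side lengths of the partition. -/
def sides : Finset ℝ := ((Finset.Icc 1 P.m).image P.hx) ∪ ((Finset.Icc 1 P.n).image P.hy)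

lemma sides_nonempty : P.sides.Nonempty :=
  ⟨P.hx 1, Finset.mem_union_left _
    (Finset.mem_image_of_mem _ (Finset.mem_Icc.mpr ⟨le_rfl, P.hm⟩))⟩

/-- The mesh size `h`: the largest side length. -/
def meshSize : ℝ := P.sides.max' P.sides_nonempty

/-- `σ`-quasi-uniformity: every side length is at most `σ` times any other,
i.e. `h ≤ σ · min side`. -/
def QuasiUniform (σ : ℝ) : Prop := ∀ s ∈ P.sides, ∀ t ∈ P.sides, s ≤ σ * t

variable (r : ℕ) (G : ℕ → ℝ)

/-- The Gauss point `g^x_{i,k} = (x_i + x_{i−1} + h_i^x G_k)/2` for `1 ≤ k ≤ r`,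
with the conventions `g^x_{i,r+1} = g^x_{i+1,1}` (for `i < m`) and `g^x_{m,r+1} = b`. -/
def gx (i k : ℕ) : ℝ :=
  if k = r + 1 then
    (if i = P.m then P.x P.m
     else (P.x (i + 1) + P.x i + P.hx (i + 1) * G 1) / 2)
  else (P.x i + P.x (i - 1) + P.hx i * G k) / 2

/-- The Gauss point `g^y_{j,l}`, with the analogous conventions. -/
def gy (j l : ℕ) : ℝ :=
  if l = r + 1 then
    (if j = P.n then P.y P.n
     else (P.y (j + 1) + P.y j + P.hy (j + 1) * G 1) / 2)
  else (P.y j + P.y (j - 1) + P.hy j * G l) / 2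

end RectPartition

/-- A function on `Ω` which is piecewise smooth with respect to the partition:
a global function together with, for each cell, a (smooth) extension of its
restriction to the closed cell; cellwise derivatives are derivatives of the
cell functions. -/
structure PiecewiseFun {a b c d : ℝ} (P : RectPartition a b c d) where
  toFun : ℝ × ℝ → ℝ
  cellFun : ℕ → ℕ → ℝ × ℝ → ℝ
  agree : ∀ i ∈ Finset.Icc 1 P.m, ∀ j ∈ Finset.Icc 1 P.n, ∀ z ∈ P.cell i j,
    cellFun i j z = toFun z

namespace PiecewiseFun

variable {a b c d : ℝ} {P : RectPartition a b c d}

/-- Difference of two piecewise functions. -/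
def sub (u v : PiecewiseFun P) : PiecewiseFun P where
  toFun := fun z => u.toFun z - v.toFun z
  cellFun := fun i j z => u.cellFun i j z - v.cellFun i j z
  agree := fun i hi j hj z hz => by
    simp only [u.agree i hi j hj z hz, v.agree i hi j hj z hz]

end PiecewiseFun

/-- Cellwise `∂/∂x` of a piecewise function. -/
def cellDx {a b c d : ℝ} {P : RectPartition a b c d} (v : PiecewiseFun P) :
    ℕ → ℕ → ℝ × ℝ → ℝ := fun i j => pdx (v.cellFun i j)

/-- Cellwise `∂/∂y` of a piecewise function. -/
def cellDy {a b c d : ℝ} {P : RectPartition a b c d} (v : PiecewiseFun P) :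
    ℕ → ℕ → ℝ × ℝ → ℝ := fun i j => pdy (v.cellFun i j)

/-- `v` is `C^s` on each closed cell. -/
def CellSmooth {a b c d : ℝ} (P : RectPartition a b c d) (s : ℕ)
    (u : PiecewiseFun P) : Prop :=
  ∀ i ∈ Finset.Icc 1 P.m, ∀ j ∈ Finset.Icc 1 P.n, ContDiff ℝ s (u.cellFun i j)

/-- Evaluation of a bivariate polynomial (outer variable ↦ `x`, coefficients are
polynomials in `y`). -/
def evalXY (p : Polynomial (Polynomial ℝ)) (x y : ℝ) : ℝ :=
  (p.map (Polynomial.evalRingHom y)).eval x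

/-- `f` is (globally) a polynomial of degree `≤ r` in each of the two variables. -/
def IsBiPoly (r : ℕ) (f : ℝ × ℝ → ℝ) : Prop :=
  ∃ p : Polynomial (Polynomial ℝ), p.natDegree ≤ r ∧ (∀ k, (p.coeff k).natDegree ≤ r) ∧
    ∀ x y : ℝ, f (x, y) = evalXY p x y

/-- Membership in the trial space `U_P^r`: continuous on `Ω`, vanishing on `∂Ω`,
and a bi-degree `≤ r` polynomial on each cell. -/
def IsTrialFun {a b c d : ℝ} (r : ℕ) (P : RectPartition a b c d)
    (v : PiecewiseFun P) : Prop :=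
  ContinuousOn v.toFun P.dom ∧ (∀ z ∈ P.bdry, v.toFun z = 0) ∧
  ∀ i ∈ Finset.Icc 1 P.m, ∀ j ∈ Finset.Icc 1 P.n, IsBiPoly r (v.cellFun i j)

/-- The coefficients of a test function extended by the conventions
`w_{i,0;j,l} = w_{i−1,r;j,l}` (`0` if `i = 1`) and
`w_{i,k;j,0} = w_{i,k;j−1,r}` (`0` if `j = 1`). -/
def wE (r : ℕ) (w : ℕ → ℕ → ℕ → ℕ → ℝ) (i k j l : ℕ) : ℝ :=
  if (k = 0 ∧ i = 1) ∨ (l = 0 ∧ j = 1) then 0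
  else
    w (if k = 0 then i - 1 else i) (if k = 0 then r else k)
      (if l = 0 then j - 1 else j) (if l = 0 then r else l)

/-- The jump `[w]^x_{i,k;j,l} = w_{i,k;j,l} − w_{i,k−1;j,l}`. -/
def jumpX (r : ℕ) (w : ℕ → ℕ → ℕ → ℕ → ℝ) (i k j l : ℕ) : ℝ :=
  wE r w i k j l - wE r w i (k - 1) j l

/-- The jump `[w]^y_{i,k;j,l} = w_{i,k;j,l} − w_{i,k;j,l−1}`. -/
def jumpY (r : ℕ) (w : ℕ → ℕ → ℕ → ℕ → ℝ) (i k j l : ℕ) : ℝ :=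
  wE r w i k j l - wE r w i k j (l - 1)

/-- The double jump `⌊w⌋_{i,k;j,l}`. -/
def jumpXY (r : ℕ) (w : ℕ → ℕ → ℕ → ℕ → ℝ) (i k j l : ℕ) : ℝ :=
  wE r w i k j l - wE r w i (k - 1) j l - wE r w i k j (l - 1) + wE r w i (k - 1) j (l - 1)

/-- A test function: coefficients `w_{i,k;j,l}`, `1 ≤ i ≤ m`, `1 ≤ k ≤ r`,
`1 ≤ j ≤ n`, `1 ≤ l ≤ r`, vanishing for `(i,k) = (m,r)` or `(j,l) = (n,r)`. -/
def IsTestFun {a b c d : ℝ} (r : ℕ) (P : RectPartition a b c d)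
    (w : ℕ → ℕ → ℕ → ℕ → ℝ) : Prop :=
  (∀ j ∈ Finset.Icc 1 P.n, ∀ l ∈ Finset.Icc 1 r, w P.m r j l = 0) ∧
  (∀ i ∈ Finset.Icc 1 P.m, ∀ k ∈ Finset.Icc 1 r, w i k P.n r = 0)

/-- The index set `X`: quadruples `(i,k,j,l)` with `(j,l) ≠ (n,r)`. -/
def idxX {a b c d : ℝ} (r : ℕ) (P : RectPartition a b c d) : Finset (ℕ × ℕ × ℕ × ℕ) :=
  (Finset.Icc 1 P.m ×ˢ Finset.Icc 1 r ×ˢ Finset.Icc 1 P.n ×ˢ Finset.Icc 1 r).filter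
    fun q => ¬(q.2.2.1 = P.n ∧ q.2.2.2 = r)

/-- The index set `Y`: quadruples `(i,k,j,l)` with `(i,k) ≠ (m,r)`. -/
def idxY {a b c d : ℝ} (r : ℕ) (P : RectPartition a b c d) : Finset (ℕ × ℕ × ℕ × ℕ) :=
  (Finset.Icc 1 P.m ×ˢ Finset.Icc 1 r ×ˢ Finset.Icc 1 P.n ×ˢ Finset.Icc 1 r).filter
    fun q => ¬(q.1 = P.m ∧ q.2.1 = r)

/-- The index set of interior dual volumes: `(i,k) ≠ (m,r)` and `(j,l) ≠ (n,r)`. -/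
def idxZ {a b c d : ℝ} (r : ℕ) (P : RectPartition a b c d) : Finset (ℕ × ℕ × ℕ × ℕ) :=
  (Finset.Icc 1 P.m ×ˢ Finset.Icc 1 r ×ˢ Finset.Icc 1 P.n ×ˢ Finset.Icc 1 r).filter
    fun q => ¬(q.1 = P.m ∧ q.2.1 = r) ∧ ¬(q.2.2.1 = P.n ∧ q.2.2.2 = r)

/-- The dual-mesh seminorm `|w|_{P'}`. -/
def dualSemi {a b c d : ℝ} (r : ℕ) (P : RectPartition a b c d)
    (w : ℕ → ℕ → ℕ → ℕ → ℝ) : ℝ :=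
  Real.sqrt
    ((∑ q ∈ idxX r P, (jumpX r w q.1 q.2.1 q.2.2.1 q.2.2.2) ^ 2) +
     (∑ q ∈ idxY r P, (jumpY r w q.1 q.2.1 q.2.2.1 q.2.2.2) ^ 2))

/-- The FVM bilinear form `a_P(v, w)`, with the cellwise derivatives of `v`
given by `Dxv i j` and `Dyv i j` on cell `(i,j)`.  The integrals along Gauss
lines are split at the cell interfaces `y = y_j` (resp. `x = x_i`), which only
matters for the last Gauss subinterval `l = r` (resp. `k = r`). -/
def aP {a b c d : ℝ} (r : ℕ) (G : ℕ → ℝ) (P : RectPartition a b c d)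
    (α : ℝ × ℝ → ℝ) (Dxv Dyv : ℕ → ℕ → ℝ × ℝ → ℝ) (w : ℕ → ℕ → ℕ → ℕ → ℝ) : ℝ :=
  (∑ q ∈ idxX r P,
    jumpX r w q.1 q.2.1 q.2.2.1 q.2.2.2 *
      ((∫ t in (P.gy r G q.2.2.1 q.2.2.2)..(min (P.gy r G q.2.2.1 (q.2.2.2 + 1)) (P.y q.2.2.1)),
          α (P.gx r G q.1 q.2.1, t) * Dxv q.1 q.2.2.1 (P.gx r G q.1 q.2.1, t)) +
       (∫ t in (P.y q.2.2.1)..(max (P.gy r G q.2.2.1 (q.2.2.2 + 1)) (P.y q.2.2.1)),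
          α (P.gx r G q.1 q.2.1, t) * Dxv q.1 (q.2.2.1 + 1) (P.gx r G q.1 q.2.1, t)))) +
  (∑ q ∈ idxY r P,
    jumpY r w q.1 q.2.1 q.2.2.1 q.2.2.2 *
      ((∫ t in (P.gx r G q.1 q.2.1)..(min (P.gx r G q.1 (q.2.1 + 1)) (P.x q.1)),
          α (t, P.gy r G q.2.2.1 q.2.2.2) * Dyv q.1 q.2.2.1 (t, P.gy r G q.2.2.1 q.2.2.2)) +
       (∫ t in (P.x q.1)..(max (P.gx r G q.1 (q.2.1 + 1)) (P.x q.1)),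
          α (t, P.gy r G q.2.2.1 q.2.2.2) * Dyv (q.1 + 1) q.2.2.1 (t, P.gy r G q.2.2.1 q.2.2.2))))

/-- The broken `H¹` seminorm `|v|₁` computed cellwise. -/
def semiH1 {a b c d : ℝ} (P : RectPartition a b c d) (v : PiecewiseFun P) : ℝ :=
  Real.sqrt (∑ i ∈ Finset.Icc 1 P.m, ∑ j ∈ Finset.Icc 1 P.n,
    ∫ z in P.cell i j, ((cellDx v i j z) ^ 2 + (cellDy v i j z) ^ 2))

/-- The mesh-dependent seminorm `|v|_P` (broken `H²`-type seminorm). -/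
def semiP {a b c d : ℝ} (P : RectPartition a b c d) (v : PiecewiseFun P) : ℝ :=
  Real.sqrt (∑ i ∈ Finset.Icc 1 P.m, ∑ j ∈ Finset.Icc 1 P.n,
    ((∫ z in P.cell i j, ((cellDx v i j z) ^ 2 + (cellDy v i j z) ^ 2)) +
      (P.hx i ^ 2 + P.hy j ^ 2) *
        ∫ z in P.cell i j,
          ((pdx (pdx (v.cellFun i j)) z) ^ 2 + 2 * (pdy (pdx (v.cellFun i j)) z) ^ 2 +
            (pdy (pdy (v.cellFun i j)) z) ^ 2)))

/-- The broken seminorm `|u|_{s,P}`. -/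
def brokenSemi {a b c d : ℝ} (P : RectPartition a b c d) (u : PiecewiseFun P) (s : ℕ) : ℝ :=
  Real.sqrt (∑ i ∈ Finset.Icc 1 P.m, ∑ j ∈ Finset.Icc 1 P.n, ∑ t ∈ Finset.range (s + 1),
    ∫ z in P.cell i j, (pdx^[t] (pdy^[s - t] (u.cellFun i j)) z) ^ 2)

/-- The broken norm `‖u‖_{s,P} = (Σ_{t=0}^{s} |u|_{t,P}²)^{1/2}`. -/
def brokenNorm {a b c d : ℝ} (P : RectPartition a b c d) (u : PiecewiseFun P) (s : ℕ) : ℝ :=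
  Real.sqrt (∑ t ∈ Finset.range (s + 1), (brokenSemi P u t) ^ 2)

/-- `w = Πv`: the test function determined by the double-jump constraints
`⌊Πv⌋_{i,k;j,l} = A^x_{i,k} A^y_{j,l} ∂²v/∂x∂y(g^x_{i,k}, g^y_{j,l})`. -/
def IsPiOf {a b c d : ℝ} (r : ℕ) (G A : ℕ → ℝ) (P : RectPartition a b c d)
    (v : PiecewiseFun P) (w : ℕ → ℕ → ℕ → ℕ → ℝ) : Prop :=
  IsTestFun r P w ∧
  ∀ i ∈ Finset.Icc 1 P.m, ∀ k ∈ Finset.Icc 1 r, ∀ j ∈ Finset.Icc 1 P.n, ∀ l ∈ Finset.Icc 1 r,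
    ¬(i = P.m ∧ k = r) → ¬(j = P.n ∧ l = r) →
    jumpXY r w i k j l =
      (P.hx i * A k / 2) * (P.hy j * A l / 2) *
        pdy (pdx (v.cellFun i j)) (P.gx r G i k, P.gy r G j l)

/-- `α` is piecewise constant with respect to `P`. -/
def PiecewiseConstant {a b c d : ℝ} (P : RectPartition a b c d) (α : ℝ × ℝ → ℝ) : Prop :=
  ∀ i ∈ Finset.Icc 1 P.m, ∀ j ∈ Finset.Icc 1 P.n, ∃ cst : ℝ, ∀ z ∈ P.openCell i j, α z = cst

/-- The cellwise fluxes `α ∂u/∂x`, `α ∂u/∂y` extend continuously to `Ω`. -/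
def FluxContinuous {a b c d : ℝ} (P : RectPartition a b c d) (α : ℝ × ℝ → ℝ)
    (u : PiecewiseFun P) : Prop :=
  ∃ Fx Fy : ℝ × ℝ → ℝ, ContinuousOn Fx P.dom ∧ ContinuousOn Fy P.dom ∧
    ∀ i ∈ Finset.Icc 1 P.m, ∀ j ∈ Finset.Icc 1 P.n, ∀ z ∈ P.openCell i j,
      Fx z = α z * cellDx u i j z ∧ Fy z = α z * cellDy u i j z

/-- The iterated integral of `f` over the rectangle `[x₁,x₂] × [y₁,y₂]`. -/
def rectInt (f : ℝ × ℝ → ℝ) (x₁ x₂ y₁ y₂ : ℝ) : ℝ :=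
  ∫ s in x₁..x₂, ∫ t in y₁..y₂, f (s, t)

/-- The integral over the dual volume `τ'_{i,k;j,l} = [g^x_{i,k}, g^x_{i,k+1}] ×
[g^y_{j,l}, g^y_{j,l+1}]` of a cellwise-defined integrand `F i j`, split along
the cell interfaces `x = x_i` and `y = y_j`. -/
def dualCellInt {a b c d : ℝ} (r : ℕ) (G : ℕ → ℝ) (P : RectPartition a b c d)
    (F : ℕ → ℕ → ℝ × ℝ → ℝ) (i k j l : ℕ) : ℝ :=
  rectInt (F i j) (P.gx r G i k) (min (P.gx r G i (k + 1)) (P.x i))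
    (P.gy r G j l) (min (P.gy r G j (l + 1)) (P.y j)) +
  rectInt (F (i + 1) j) (P.x i) (max (P.gx r G i (k + 1)) (P.x i))
    (P.gy r G j l) (min (P.gy r G j (l + 1)) (P.y j)) +
  rectInt (F i (j + 1)) (P.gx r G i k) (min (P.gx r G i (k + 1)) (P.x i))
    (P.y j) (max (P.gy r G j (l + 1)) (P.y j)) +
  rectInt (F (i + 1) (j + 1)) (P.x i) (max (P.gx r G i (k + 1)) (P.x i))
    (P.y j) (max (P.gy r G j (l + 1)) (P.y j))

/-- The cellwise source term `f = −α (∂²u/∂x² + ∂²u/∂y²)` (for piecewise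
constant `α`). -/
def cellSource {a b c d : ℝ} {P : RectPartition a b c d} (α : ℝ × ℝ → ℝ)
    (u : PiecewiseFun P) (i j : ℕ) (z : ℝ × ℝ) : ℝ :=
  -(α z * (pdx (pdx (u.cellFun i j)) z + pdy (pdy (u.cellFun i j)) z))

/-- The right-hand side `Σ w_{i,k;j,l} ∫_{τ'_{i,k;j,l}} f` of the FV scheme. -/
def fvRHS {a b c d : ℝ} (r : ℕ) (G : ℕ → ℝ) (P : RectPartition a b c d)
    (α : ℝ × ℝ → ℝ) (u : PiecewiseFun P) (w : ℕ → ℕ → ℕ → ℕ → ℝ) : ℝ :=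
  ∑ q ∈ idxZ r P, w q.1 q.2.1 q.2.2.1 q.2.2.2 *
    dualCellInt r G P (cellSource α u) q.1 q.2.1 q.2.2.1 q.2.2.2

/-- `uP` is a finite volume solution for the exact solution `u`. -/
def IsFVSolution {a b c d : ℝ} (r : ℕ) (G : ℕ → ℝ) (P : RectPartition a b c d)
    (α : ℝ × ℝ → ℝ) (u uP : PiecewiseFun P) : Prop :=
  IsTrialFun r P uP ∧
  ∀ w, IsTestFun r P w → aP r G P α (cellDx uP) (cellDy uP) w = fvRHS r G P α u w

/-- The Lobatto node in cell `(i,j)` with 0-based indices `0 ≤ k, l ≤ r`. -/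
def lobattoNode {a b c d : ℝ} (P : RectPartition a b c d) (L : ℕ → ℝ)
    (i j k l : ℕ) : ℝ × ℝ :=
  ((P.x (i - 1) + P.x i + P.hx i * L k) / 2, (P.y (j - 1) + P.y j + P.hy j * L l) / 2)

/-- `uI` is the Lobatto interpolant of `u` in the trial space `U_P^r`. -/
def IsLobattoInterp {a b c d : ℝ} (r : ℕ) (L : ℕ → ℝ) (P : RectPartition a b c d)
    (u : ℝ × ℝ → ℝ) (uI : PiecewiseFun P) : Prop :=
  IsTrialFun r P uI ∧
  ∀ i ∈ Finset.Icc 1 P.m, ∀ j ∈ Finset.Icc 1 P.n,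
    ∀ k ∈ Finset.Icc 0 r, ∀ l ∈ Finset.Icc 0 r,
      uI.toFun (lobattoNode P L i j k l) = u (lobattoNode P L i j k l)

/-- The piecewise oscillation `osc_P(α)`: the maximum over all cells of
`ess sup α − ess inf α`. -/
def oscP {a b c d : ℝ} (P : RectPartition a b c d) (α : ℝ × ℝ → ℝ) : ℝ :=
  (Finset.Icc 1 P.m ×ˢ Finset.Icc 1 P.n).sup'
    (Finset.Nonempty.product (Finset.nonempty_Icc.mpr P.hm) (Finset.nonempty_Icc.mpr P.hn))
    fun p => essSup α (volume.restrict (P.cell p.1 p.2)) -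
      essInf α (volume.restrict (P.cell p.1 p.2))

end

/-- Integration over `[-1, 1]`, as a linear functional on polynomials. -/
noncomputable def polyIntegral : ℝ[X] →ₗ[ℝ] ℝ where
  toFun p := ∫ x in (-1 : ℝ)..1, p.eval x
  map_add' p q := by
    simp only [eval_add]
    exact intervalIntegral.integral_add (p.continuous.intervalIntegrable _ _)
      (q.continuous.intervalIntegrable _ _)
  map_smul' c p := by
    simp only [eval_smul, smul_eq_mul, RingHom.id_apply]
    exact intervalIntegral.integral_const_mul c _

lemma polyIntegral_apply (p : ℝ[X]) : polyIntegral p = ∫ x in (-1 : ℝ)..1, p.eval x := rfl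

lemma polyIntegral_derivative (p : ℝ[X]) :
    polyIntegral (derivative p) = p.eval 1 - p.eval (-1) :=
  intervalIntegral.integral_eq_sub_of_hasDerivAt (fun x _ => p.hasDerivAt x)
    ((derivative p).continuous.intervalIntegrable _ _)

lemma polyIntegral_derivative_mul (p q : ℝ[X]) :
    polyIntegral (derivative p * q) =
      p.eval 1 * q.eval 1 - p.eval (-1) * q.eval (-1) - polyIntegral (p * derivative q) := by
  have h := polyIntegral_derivative (p * q)
  rw [derivative_mul, map_add, eval_mul, eval_mul] at h
  linarith

lemma polyIntegral_mul_self_nonneg (p : ℝ[X]) : 0 ≤ polyIntegral (p * p) := by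
  rw [polyIntegral_apply]
  refine intervalIntegral.integral_nonneg (by norm_num) fun x _ => ?_
  rw [eval_mul]
  exact mul_self_nonneg _

lemma polyIntegral_mul_self_pos {p : ℝ[X]} (hp : p ≠ 0) : 0 < polyIntegral (p * p) := by
  rw [polyIntegral_apply]
  refine intervalIntegral.integral_pos (by norm_num) (p * p).continuous.continuousOn
    (fun x _ => by rw [eval_mul]; exact mul_self_nonneg _) ?_
  by_contra! hcon
  refine hp (Polynomial.eq_zero_of_infinite_isRoot p ?_)
  refine (Set.Icc_infinite (show (-1 : ℝ) < 1 by norm_num)).mono fun x hx => ?_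
  have := hcon x hx
  rw [eval_mul] at this
  exact mul_self_eq_zero.mp (le_antisymm this (mul_self_nonneg _))

/-! ### Legendre polynomials and Gauss quadrature -/

lemma Leg_eq (r : ℕ) : Leg r = derivative^[r] ((X ^ 2 - 1 : ℝ[X]) ^ r) := rfl

lemma natDegree_X_sq_sub_one_pow (r : ℕ) : ((X ^ 2 - 1 : ℝ[X]) ^ r).natDegree = 2 * r := by
  have : (X ^ 2 - 1 : ℝ[X]).natDegree = 2 := by
    simpa using natDegree_X_pow_sub_C (n := 2) (r := (1 : ℝ))
  rw [natDegree_pow, this, mul_comm]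

lemma Leg_coeff_pos (r : ℕ) : 0 < (Leg r).coeff r := by
  have hm : ((X ^ 2 - 1 : ℝ[X]) ^ r).Monic := by
    refine Monic.pow ?_ r
    simpa using monic_X_pow_sub_C (1 : ℝ) two_ne_zero
  have hc : ((X ^ 2 - 1 : ℝ[X]) ^ r).coeff (r + r) = 1 := by
    have := hm.coeff_natDegree
    rwa [natDegree_X_sq_sub_one_pow, two_mul] at this
  rw [Leg_eq, coeff_iterate_derivative, hc, nsmul_eq_mul, mul_one]
  exact_mod_cast Nat.descFactorial_pos.mpr (by omega)

lemma Leg_natDegree (r : ℕ) : (Leg r).natDegree = r := by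
  refine le_antisymm ?_ (le_natDegree_of_ne_zero (Leg_coeff_pos r).ne')
  have := natDegree_iterate_derivative ((X ^ 2 - 1 : ℝ[X]) ^ r) r
  rw [natDegree_X_sq_sub_one_pow] at this
  rw [Leg_eq]
  omega

lemma Leg_ne_zero (r : ℕ) : Leg r ≠ 0 := fun h => by
  have := Leg_coeff_pos r
  simp [h] at this

lemma polyIntegral_iterate_derivative_mul (r k : ℕ) (hk : k ≤ r) (q : ℝ[X])
    (hq : derivative^[k] q = 0) :
    polyIntegral (derivative^[k] ((X ^ 2 - 1 : ℝ[X]) ^ r) * q) = 0 := by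
  induction k generalizing q with
  | zero => simp_all
  | succ k ih =>
    have hdvd : (X ^ 2 - 1 : ℝ[X]) ∣ derivative^[k] ((X ^ 2 - 1 : ℝ[X]) ^ r) :=
      (dvd_pow_self _ (by omega)).trans (pow_sub_dvd_iterate_derivative_pow _ r k)
    obtain ⟨g, hg⟩ := hdvd
    rw [Function.iterate_succ_apply', polyIntegral_derivative_mul,
      ih (by omega) (derivative q) (by rwa [← Function.iterate_succ_apply]), hg]
    simp

/-- The Legendre polynomial is orthogonal to polynomials of smaller degree. -/
lemma polyIntegral_Leg_mul {r : ℕ} {q : ℝ[X]} (hq : q.natDegree < r) :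
    polyIntegral (Leg r * q) = 0 :=
  polyIntegral_iterate_derivative_mul r r le_rfl q (iterate_derivative_eq_zero hq)

/-- The Gauss weights. -/
noncomputable def gaussW (r : ℕ) (G : ℕ → ℝ) (k : ℕ) : ℝ :=
  polyIntegral (Lagrange.basis (Finset.Icc 1 r) G k)

lemma IsGaussPoints.strictMonoOn {r : ℕ} {G : ℕ → ℝ} (hG : IsGaussPoints r G) :
    StrictMonoOn G (Set.Icc 1 r) := by
  intro i hi j hj hij
  have key : ∀ n, i + n + 1 ≤ r → G i < G (i + n + 1) := by
    intro n
    induction n with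
    | zero => intro h; exact hG.1 i hi.1 (by omega)
    | succ n ih => intro h; exact (ih (by omega)).trans (hG.1 _ (by omega) (by omega))
  obtain ⟨n, rfl⟩ := Nat.exists_eq_add_of_lt hij
  exact key n hj.2

lemma IsGaussPoints.injOn {r : ℕ} {G : ℕ → ℝ} (hG : IsGaussPoints r G) :
    Set.InjOn G (Finset.Icc 1 r : Finset ℕ) := by
  rw [Finset.coe_Icc]
  exact hG.strictMonoOn.injOn

lemma IsGaussPoints.eval_Leg {r : ℕ} {G : ℕ → ℝ} (hG : IsGaussPoints r G) {k : ℕ}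
    (hk : k ∈ Finset.Icc 1 r) : (Leg r).eval (G k) = 0 := by
  rw [Finset.mem_Icc] at hk
  exact (hG.2 k hk.1 hk.2).2

lemma degree_lt_of_natDegree_lt {p : ℝ[X]} {n : ℕ} (h : p.natDegree < n) : p.degree < n :=
  (degree_le_natDegree).trans_lt (by exact_mod_cast h)

/-- Gauss quadrature is exact in degree `< 2 r`. -/
lemma gauss_exact {r : ℕ} {G : ℕ → ℝ} (hr : 1 ≤ r) (hG : IsGaussPoints r G) {f : ℝ[X]}
    (hf : f.natDegree < 2 * r) :
    polyIntegral f = ∑ k ∈ Finset.Icc 1 r, gaussW r G k * f.eval (G k) := by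
  have hdm := EuclideanDomain.div_add_mod f (Leg r)
  have hmod : (f % Leg r).natDegree < r := by
    have := natDegree_mod_lt f (q := Leg r) (by rw [Leg_natDegree]; omega)
    rwa [Leg_natDegree] at this
  have hdiv : (f / Leg r).natDegree < r := by
    by_cases h0 : f / Leg r = 0
    · rw [h0, natDegree_zero]; omega
    · by_contra! hcon
      have hm : (Leg r * (f / Leg r)).natDegree = r + (f / Leg r).natDegree := by
        rw [natDegree_mul (Leg_ne_zero r) h0, Leg_natDegree]
      have hle : (Leg r * (f / Leg r)).natDegree ≤ max f.natDegree (f % Leg r).natDegree := by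
        have : Leg r * (f / Leg r) = f - f % Leg r := eq_sub_of_add_eq hdm
        rw [this]
        exact natDegree_sub_le _ _
      rcases le_max_iff.mp hle with h | h <;> omega
  have heval : ∀ k ∈ Finset.Icc 1 r, f.eval (G k) = (f % Leg r).eval (G k) := by
    intro k hk
    conv_lhs => rw [← hdm]
    rw [eval_add, eval_mul, hG.eval_Leg hk]
    ring
  have hintegral := Lagrange.eq_interpolate (f := f % Leg r) hG.injOn
    (degree_lt_of_natDegree_lt (by simpa using hmod))
  conv_lhs => rw [← hdm, map_add, polyIntegral_Leg_mul hdiv, zero_add, hintegral,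
    Lagrange.interpolate_apply, map_sum]
  refine Finset.sum_congr rfl fun k hk => ?_
  rw [heval k hk, ← smul_eq_C_mul, map_smul, smul_eq_mul, mul_comm, gaussW]

lemma natDegree_gaussBasis {r : ℕ} {G : ℕ → ℝ} (hG : IsGaussPoints r G) {k : ℕ}
    (hk : k ∈ Finset.Icc 1 r) : (Lagrange.basis (Finset.Icc 1 r) G k).natDegree = r - 1 := by
  rw [Lagrange.natDegree_basis hG.injOn hk]; simp

lemma polyIntegral_mul_gaussBasis {r : ℕ} {G : ℕ → ℝ} (hr : 1 ≤ r) (hG : IsGaussPoints r G)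
    {k : ℕ} (hk : k ∈ Finset.Icc 1 r) {p : ℝ[X]} (hp : p.natDegree ≤ r) :
    polyIntegral (p * Lagrange.basis (Finset.Icc 1 r) G k) = gaussW r G k * p.eval (G k) := by
  have hd : (p * Lagrange.basis (Finset.Icc 1 r) G k).natDegree < 2 * r := by
    refine natDegree_mul_le.trans_lt ?_
    rw [natDegree_gaussBasis hG hk]
    omega
  rw [gauss_exact hr hG hd, Finset.sum_eq_single_of_mem k hk]
  · rw [eval_mul, Lagrange.eval_basis_self hG.injOn hk, mul_one]
  · intro j hj hjk
    rw [eval_mul, Lagrange.eval_basis_of_ne (Ne.symm hjk) hj]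
    ring

lemma gaussW_pos {r : ℕ} {G : ℕ → ℝ} (hr : 1 ≤ r) (hG : IsGaussPoints r G)
    {k : ℕ} (hk : k ∈ Finset.Icc 1 r) : 0 < gaussW r G k := by
  have h := polyIntegral_mul_gaussBasis hr hG hk
    (p := Lagrange.basis (Finset.Icc 1 r) G k) (by rw [natDegree_gaussBasis hG hk]; omega)
  rw [Lagrange.eval_basis_self hG.injOn hk, mul_one] at h
  rw [← h]
  exact polyIntegral_mul_self_pos (Lagrange.basis_ne_zero hG.injOn hk)

lemma natDegree_lt_of_le_of_coeff_eq_zero {p : ℝ[X]} {n : ℕ} (hn : 0 < n) (hp : p.natDegree ≤ n)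
    (hc : p.coeff n = 0) : p.natDegree < n := by
  refine lt_of_le_of_ne hp fun h => ?_
  have h0 : p = 0 := by
    rw [← leadingCoeff_eq_zero, leadingCoeff, h, hc]
  rw [h0, natDegree_zero] at h
  omega

/-- In degree `2 r`, Gauss quadrature underestimates the integral of a polynomial with
nonnegative top coefficient. -/
lemma gauss_le {r : ℕ} {G : ℕ → ℝ} (hr : 1 ≤ r) (hG : IsGaussPoints r G) {f : ℝ[X]}
    (hf : f.natDegree ≤ 2 * r) (hc : 0 ≤ f.coeff (2 * r)) :
    ∑ k ∈ Finset.Icc 1 r, gaussW r G k * f.eval (G k) ≤ polyIntegral f := by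
  set s : ℝ := f.coeff (2 * r) / ((Leg r).coeff r * (Leg r).coeff r) with hs
  have hs0 : 0 ≤ s := div_nonneg hc (mul_self_nonneg _)
  have hL := Leg_coeff_pos r
  set g : ℝ[X] := f - s • (Leg r * Leg r) with hg
  have hgd : g.natDegree < 2 * r := by
    refine natDegree_lt_of_le_of_coeff_eq_zero (by omega) ?_ ?_
    · refine (natDegree_sub_le _ _).trans (max_le hf ?_)
      refine (natDegree_smul_le _ _).trans (natDegree_mul_le.trans ?_)
      rw [Leg_natDegree]
      omega
    · have h2 : (Leg r * Leg r).coeff (2 * r) = (Leg r).coeff r * (Leg r).coeff r := by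
        rw [two_mul]
        exact coeff_mul_add_eq_of_natDegree_le (Leg_natDegree r).le (Leg_natDegree r).le
      rw [hg, coeff_sub, coeff_smul, smul_eq_mul, h2, hs]
      field_simp
      ring
  have h := gauss_exact hr hG hgd
  have heval : ∀ k ∈ Finset.Icc 1 r, g.eval (G k) = f.eval (G k) := by
    intro k hk
    simp [hg, hG.eval_Leg hk]
  rw [Finset.sum_congr rfl fun k hk => by rw [heval k hk]] at h
  rw [← h, hg, map_sub, map_smul, smul_eq_mul]
  have := mul_nonneg hs0 (polyIntegral_mul_self_nonneg (Leg r))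
  linarith

/-- The functional `f ↦ f(-1) + ∑_{l' ≤ l} A_{l'} f'(G_{l'})`, the value on the `l`-th dual
subinterval of the test function associated with `f`. -/
noncomputable def dualVal (r : ℕ) (G : ℕ → ℝ) (l : ℕ) : ℝ[X] →ₗ[ℝ] ℝ where
  toFun p := p.eval (-1) + ∑ k ∈ Finset.Icc 1 l, gaussW r G k * (derivative p).eval (G k)
  map_add' p q := by
    simp only [eval_add, derivative_add, mul_add, Finset.sum_add_distrib]
    ring
  map_smul' c p := by
    simp only [eval_smul, derivative_smul, smul_eq_mul, RingHom.id_apply, mul_add, Finset.mul_sum]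
    congr 1
    exact Finset.sum_congr rfl fun k _ => by ring

lemma dualVal_apply (r : ℕ) (G : ℕ → ℝ) (l : ℕ) (p : ℝ[X]) : dualVal r G l p =
    p.eval (-1) + ∑ k ∈ Finset.Icc 1 l, gaussW r G k * (derivative p).eval (G k) := rfl

lemma dualVal_zero (r : ℕ) (G : ℕ → ℝ) (p : ℝ[X]) : dualVal r G 0 p = p.eval (-1) := by
  simp [dualVal_apply]

lemma dualVal_succ (r : ℕ) (G : ℕ → ℝ) (l : ℕ) (p : ℝ[X]) : dualVal r G (l + 1) p =
    dualVal r G l p + gaussW r G (l + 1) * (derivative p).eval (G (l + 1)) := by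
  rw [dualVal_apply, dualVal_apply, Finset.sum_Icc_succ_top (by omega)]
  ring

lemma dualVal_self {r : ℕ} {G : ℕ → ℝ} (hr : 1 ≤ r) (hG : IsGaussPoints r G) {p : ℝ[X]}
    (hp : p.natDegree ≤ r) : dualVal r G r p = p.eval 1 := by
  have h := gauss_exact hr hG (f := derivative p)
    ((natDegree_derivative_le p).trans_lt (by omega))
  rw [dualVal_apply, ← h, polyIntegral_derivative]
  ring

/-- The points `-1, G_1, …, G_r, 1`. -/
noncomputable def gaussExt (r : ℕ) (G : ℕ → ℝ) (l : ℕ) : ℝ :=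
  if l = 0 then -1 else if l = r + 1 then 1 else G l

lemma gaussExt_zero (r : ℕ) (G : ℕ → ℝ) : gaussExt r G 0 = -1 := if_pos rfl

lemma gaussExt_last (r : ℕ) (G : ℕ → ℝ) : gaussExt r G (r + 1) = 1 := by simp [gaussExt]

lemma gaussExt_of_mem {r : ℕ} {G : ℕ → ℝ} {l : ℕ} (hl : l ∈ Finset.Icc 1 r) :
    gaussExt r G l = G l := by
  rw [Finset.mem_Icc] at hl
  rw [gaussExt, if_neg (by omega), if_neg (by omega)]

lemma gaussExt_lt_succ {r : ℕ} {G : ℕ → ℝ} (hr : 1 ≤ r) (hG : IsGaussPoints r G) {l : ℕ}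
    (hl : l ≤ r) : gaussExt r G l < gaussExt r G (l + 1) := by
  rcases Nat.eq_zero_or_pos l with rfl | h0
  · rw [gaussExt_zero, gaussExt_of_mem (Finset.mem_Icc.mpr ⟨le_rfl, by omega⟩)]
    exact (hG.2 1 le_rfl hr).1.1
  · rw [gaussExt_of_mem (Finset.mem_Icc.mpr ⟨h0, hl⟩)]
    rcases hl.eq_or_lt with rfl | hlt
    · rw [gaussExt_last]
      exact (hG.2 l h0 le_rfl).1.2
    · rw [gaussExt_of_mem (Finset.mem_Icc.mpr ⟨by omega, by omega⟩)]
      exact hG.1 l h0 hlt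

lemma gaussExt_mem {r : ℕ} {G : ℕ → ℝ} (hG : IsGaussPoints r G) {l : ℕ}
    (hl : l ≤ r + 1) : gaussExt r G l ∈ Set.Icc (-1 : ℝ) 1 := by
  rw [gaussExt]
  split_ifs with h0 h1
  · norm_num
  · norm_num
  · exact Set.Ioo_subset_Icc_self (hG.2 l (by omega) (by omega)).1

/-- Summation by parts. -/
lemma sum_range_mul_sub (r : ℕ) (Q T : ℕ → ℝ) :
    ∑ l ∈ Finset.range (r + 1), Q l * (T (l + 1) - T l) =
      Q r * T (r + 1) - Q 0 * T 0 - ∑ l ∈ Finset.Icc 1 r, (Q l - Q (l - 1)) * T l := by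
  induction r with
  | zero => simp; ring
  | succ r ih =>
    rw [Finset.sum_range_succ, ih, Finset.sum_Icc_succ_top (by omega), Nat.add_sub_cancel]
    ring

lemma exists_antiderivative {r : ℕ} {p : ℝ[X]} (hp : p.natDegree ≤ r) :
    ∃ q : ℝ[X], derivative q = p ∧ q.natDegree ≤ r + 1 ∧ q.coeff (r + 1) = p.coeff r / (r + 1) := by
  have hd : derivative (∑ i ∈ Finset.range (r + 1), monomial (i + 1) (p.coeff i / (i + 1))) = p := by
    conv_rhs => rw [p.as_sum_range' (r + 1) (by omega)]
    rw [derivative_sum]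
    refine Finset.sum_congr rfl fun i _ => ?_
    rw [derivative_monomial]
    congr 1
    push_cast
    field_simp
  refine ⟨_, hd, ?_, ?_⟩
  · refine natDegree_sum_le_of_forall_le _ _ fun i hi => ?_
    refine (natDegree_monomial_le _).trans ?_
    have := Finset.mem_range.mp hi
    omega
  · have := coeff_derivative (∑ i ∈ Finset.range (r + 1), monomial (i + 1) (p.coeff i / (i + 1))) r
    rw [hd] at this
    rw [this]
    field_simp

/-- One-dimensional coercivity on the reference interval. -/
lemma polyIntegral_mul_self_le {r : ℕ} {G : ℕ → ℝ} (hr : 1 ≤ r) (hG : IsGaussPoints r G) {p : ℝ[X]}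
    (hp : p.natDegree ≤ r) :
    polyIntegral (p * p) ≤ ∑ l ∈ Finset.range (r + 1),
      dualVal r G l p * ∫ x in gaussExt r G l..gaussExt r G (l + 1), p.eval x := by
  obtain ⟨q, hqd, hqn, hqc⟩ := exists_antiderivative hp
  have hintegral : ∀ s t : ℝ, ∫ x in s..t, p.eval x = q.eval t - q.eval s := fun s t => by
    rw [← hqd]
    exact intervalIntegral.integral_eq_sub_of_hasDerivAt (fun x _ => q.hasDerivAt x)
      ((derivative q).continuous.intervalIntegrable _ _)
  simp only [hintegral]
  rw [sum_range_mul_sub r (fun l => dualVal r G l p) (fun l => q.eval (gaussExt r G l))]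
  have hsum : ∑ l ∈ Finset.Icc 1 r, (dualVal r G l p - dualVal r G (l - 1) p) *
      q.eval (gaussExt r G l) =
      ∑ l ∈ Finset.Icc 1 r, gaussW r G l * (derivative p * q).eval (G l) := by
    refine Finset.sum_congr rfl fun l hl => ?_
    rw [gaussExt_of_mem hl]
    obtain ⟨l, rfl⟩ : ∃ l', l = l' + 1 := ⟨l - 1, by have := Finset.mem_Icc.mp hl; omega⟩
    rw [Nat.add_sub_cancel, dualVal_succ, eval_mul]
    ring
  have hpd : (derivative p).natDegree ≤ r - 1 := (natDegree_derivative_le p).trans (by omega)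
  have hle : ∑ l ∈ Finset.Icc 1 r, gaussW r G l * (derivative p * q).eval (G l) ≤
      polyIntegral (derivative p * q) := by
    refine gauss_le hr hG (natDegree_mul_le.trans (by omega)) ?_
    have h2 : 2 * r = (r - 1) + (r + 1) := by omega
    rw [h2, coeff_mul_add_eq_of_natDegree_le hpd hqn, hqc, coeff_derivative, Nat.sub_add_cancel hr]
    have h3 : (0 : ℝ) ≤ ((r - 1 : ℕ) : ℝ) + 1 := by positivity
    calc (0 : ℝ) ≤ (p.coeff r * p.coeff r) * (((r - 1 : ℕ) : ℝ) + 1) / (r + 1) :=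
          div_nonneg (mul_nonneg (mul_self_nonneg _) h3) (by positivity)
      _ = _ := by ring
  have hparts := polyIntegral_derivative_mul p q
  rw [hqd] at hparts
  rw [hsum, dualVal_self hr hG hp, dualVal_zero, gaussExt_zero, gaussExt_last]
  linarith

lemma exists_sq_le_polyIntegral (φ : ℝ[X] →ₗ[ℝ] ℝ) (n : ℕ) :
    ∃ C : ℝ, 0 ≤ C ∧ ∀ p : ℝ[X], p.degree < n → (φ p) ^ 2 ≤ C * polyIntegral (p * p) := by
  induction n with
  | zero =>
    refine ⟨0, le_rfl, fun p hp => ?_⟩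
    have : p = 0 := by simpa using hp
    simp [this]
  | succ n ih =>
    obtain ⟨C, hC, h⟩ := ih
    set N := polyIntegral (Leg n * Leg n) with hN
    have hNpos : 0 < N := polyIntegral_mul_self_pos (Leg_ne_zero n)
    have hL := Leg_coeff_pos n
    refine ⟨2 * (φ (Leg n)) ^ 2 / N + 2 * C, by positivity, fun p hp => ?_⟩
    set s : ℝ := p.coeff n / (Leg n).coeff n with hs
    set q : ℝ[X] := p - s • Leg n with hq
    have hqd : q.degree < n := by
      rw [degree_lt_iff_coeff_zero]
      intro m hm
      rcases hm.eq_or_lt with rfl | hlt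
      · rw [hq, coeff_sub, coeff_smul, smul_eq_mul, hs]
        field_simp
        ring
      · rw [hq, coeff_sub, coeff_smul, (degree_lt_iff_coeff_zero p _).mp hp m hlt,
          coeff_eq_zero_of_natDegree_lt (by rwa [Leg_natDegree])]
        simp
    have horth : polyIntegral (Leg n * q) = 0 :=
      polyIntegral_iterate_derivative_mul n n le_rfl q (iterate_derivative_eq_zero_of_degree_lt hqd)
    have hp' : p = s • Leg n + q := by rw [hq]; ring
    have hpp : polyIntegral (p * p) = s ^ 2 * N + polyIntegral (q * q) := by
      have : p * p = (s ^ 2) • (Leg n * Leg n) + (2 * s) • (Leg n * q) + q * q := by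
        rw [hp']
        simp only [smul_eq_C_mul, C_mul, C_pow]
        simp only [map_ofNat]
        ring
      rw [this]
      simp only [map_add, map_smul, smul_eq_mul, horth, hN]
      ring
    have hφ : φ p = s * φ (Leg n) + φ q := by rw [hp', map_add, map_smul, smul_eq_mul]
    have hq2 := h q hqd
    have hqq := polyIntegral_mul_self_nonneg q
    rw [hφ, hpp]
    calc (s * φ (Leg n) + φ q) ^ 2 ≤ 2 * (s * φ (Leg n)) ^ 2 + 2 * (φ q) ^ 2 := by
          nlinarith [sq_nonneg (s * φ (Leg n) - φ q)]
      _ ≤ 2 * (s * φ (Leg n)) ^ 2 + 2 * (C * polyIntegral (q * q)) := by linarith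
      _ ≤ 2 * (s * φ (Leg n)) ^ 2 + 2 * (C * polyIntegral (q * q)) +
          (2 * (φ (Leg n)) ^ 2 / N * polyIntegral (q * q) + 2 * C * (s ^ 2 * N)) := by
          have : 0 ≤ 2 * (φ (Leg n)) ^ 2 / N * polyIntegral (q * q) + 2 * C * (s ^ 2 * N) := by
            positivity
          linarith
      _ = _ := by field_simp; ring

/-! ### Lobatto interpolation -/

/-- The Lagrange basis at the Lobatto points. -/
noncomputable def lobB (r : ℕ) (L : ℕ → ℝ) (a : ℕ) : ℝ[X] :=
  Lagrange.basis (Finset.range (r + 1)) L a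

lemma IsLobattoPoints.strictMonoOn {r : ℕ} {L : ℕ → ℝ} (hL : IsLobattoPoints r L) :
    StrictMonoOn L (Set.Iic r) := by
  intro i _ j hj hij
  have key : ∀ n, i + n + 1 ≤ r → L i < L (i + n + 1) := by
    intro n
    induction n with
    | zero => intro h; exact hL.2.2.1 i (by omega)
    | succ n ih => intro h; exact (ih (by omega)).trans (hL.2.2.1 _ (by omega))
  obtain ⟨n, rfl⟩ := Nat.exists_eq_add_of_lt hij
  exact key n hj

lemma IsLobattoPoints.injOn {r : ℕ} {L : ℕ → ℝ} (hL : IsLobattoPoints r L) :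
    Set.InjOn L (Finset.range (r + 1) : Finset ℕ) := by
  refine hL.strictMonoOn.injOn.mono fun x hx => ?_
  have := Finset.mem_range.mp hx
  exact Set.mem_Iic.mpr (by omega)

lemma IsLobattoPoints.mem {r : ℕ} {L : ℕ → ℝ} (hL : IsLobattoPoints r L) {a : ℕ}
    (ha : a ∈ Finset.range (r + 1)) : L a ∈ Set.Icc (-1 : ℝ) 1 := by
  have ha' := Finset.mem_range.mp ha
  rcases Nat.eq_zero_or_pos a with rfl | h0
  · rw [hL.1]; norm_num
  · rcases (show a ≤ r by omega).eq_or_lt with rfl | hlt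
    · rw [hL.2.1]; norm_num
    · exact Set.Ioo_subset_Icc_self (hL.2.2.2 a h0 hlt).1

lemma natDegree_lobB {r : ℕ} {L : ℕ → ℝ} (hL : IsLobattoPoints r L) {a : ℕ}
    (ha : a ∈ Finset.range (r + 1)) : (lobB r L a).natDegree = r := by
  rw [lobB, Lagrange.natDegree_basis hL.injOn ha]; simp

lemma eval_lobB {r : ℕ} {L : ℕ → ℝ} (hL : IsLobattoPoints r L) {a b : ℕ}
    (ha : a ∈ Finset.range (r + 1)) (hb : b ∈ Finset.range (r + 1)) :
    (lobB r L a).eval (L b) = if a = b then 1 else 0 := by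
  split_ifs with h
  · rw [← h]
    exact Lagrange.eval_basis_self hL.injOn ha
  · exact Lagrange.eval_basis_of_ne h hb

lemma eq_sum_lobB {r : ℕ} {L : ℕ → ℝ} (hL : IsLobattoPoints r L) {p : ℝ[X]}
    (hp : p.natDegree ≤ r) :
    p = ∑ a ∈ Finset.range (r + 1), C (p.eval (L a)) * lobB r L a :=
  (Lagrange.eq_interpolate hL.injOn (degree_lt_of_natDegree_lt (by simpa using by omega))).trans
    (Lagrange.interpolate_apply _ _ _)

lemma polyIntegral_derivative_lobatto_mul {r : ℕ} {q : ℝ[X]} (hq : q.natDegree < r) :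
    polyIntegral (derivative ((X ^ 2 - 1) * derivative (Leg r)) * q) = 0 := by
  rw [polyIntegral_derivative_mul]
  by_cases h0 : derivative q = 0
  · simp [h0]
  have hq1 : q.natDegree ≠ 0 := fun h => h0 (by
    rw [eq_C_of_natDegree_eq_zero h, derivative_C])
  have h2 : (X ^ 2 - 1 : ℝ[X]).natDegree = 2 := by
    simpa using natDegree_X_pow_sub_C (n := 2) (r := (1 : ℝ))
  have hd : (derivative ((X ^ 2 - 1) * derivative q)).natDegree < r := by
    have h3 := natDegree_derivative_le q
    have h4 := natDegree_mul_le (p := (X ^ 2 - 1 : ℝ[X])) (q := derivative q)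
    have h5 := natDegree_derivative_le ((X ^ 2 - 1) * derivative q)
    omega
  have h6 : (X ^ 2 - 1) * derivative (Leg r) * derivative q =
      derivative (Leg r) * ((X ^ 2 - 1) * derivative q) := by ring
  rw [h6, polyIntegral_derivative_mul, polyIntegral_Leg_mul hd]
  simp

/-- A polynomial of degree at most `r + 1` vanishing at the Lobatto points has a derivative
vanishing at the Gauss points. -/
lemma eval_derivative_gauss_eq_zero {r : ℕ} {G L : ℕ → ℝ} (hr : 1 ≤ r) (hG : IsGaussPoints r G)
    (hL : IsLobattoPoints r L) {p : ℝ[X]} (hp : p.natDegree ≤ r + 1)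
    (h0 : ∀ a ∈ Finset.range (r + 1), p.eval (L a) = 0) {k : ℕ} (hk : k ∈ Finset.Icc 1 r) :
    (derivative p).eval (G k) = 0 := by
  set M : ℝ[X] := (X ^ 2 - 1) * derivative (Leg r) with hM
  have h2 : (X ^ 2 - 1 : ℝ[X]).natDegree = 2 := by
    simpa using natDegree_X_pow_sub_C (n := 2) (r := (1 : ℝ))
  have hLd : (derivative (Leg r)).natDegree ≤ r - 1 :=
    (natDegree_derivative_le _).trans (by rw [Leg_natDegree])
  have hMd : M.natDegree ≤ r + 1 := natDegree_mul_le.trans (by omega)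
  have hMc : M.coeff (r + 1) = (Leg r).coeff r * r := by
    have : r + 1 = 2 + (r - 1) := by omega
    rw [this, hM, coeff_mul_add_eq_of_natDegree_le h2.le hLd, coeff_derivative,
      Nat.sub_add_cancel hr]
    have h1 : (X ^ 2 - 1 : ℝ[X]).coeff 2 = 1 := by
      simp [coeff_one]
    rw [h1, one_mul, Nat.cast_sub hr]
    push_cast
    ring
  have hMc0 : M.coeff (r + 1) ≠ 0 := by
    rw [hMc]
    exact mul_ne_zero (Leg_coeff_pos r).ne' (by exact_mod_cast (by omega : r ≠ 0))
  have hM0 : ∀ a ∈ Finset.range (r + 1), M.eval (L a) = 0 := by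
    intro a ha
    have ha' := Finset.mem_range.mp ha
    rcases Nat.eq_zero_or_pos a with rfl | h0
    · simp [hM, hL.1]
    · rcases (show a ≤ r by omega).eq_or_lt with rfl | hlt
      · simp [hM, hL.2.1]
      · rw [hM, eval_mul, (hL.2.2.2 a h0 hlt).2.eq_zero, mul_zero]
  set s : ℝ := p.coeff (r + 1) / M.coeff (r + 1) with hs
  have hpM : p = s • M := by
    rw [← sub_eq_zero]
    refine eq_zero_of_degree_lt_of_eval_index_eq_zero (Finset.range (r + 1)) hL.injOn ?_ ?_
    · refine degree_lt_of_natDegree_lt ?_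
      rw [Finset.card_range]
      refine natDegree_lt_of_le_of_coeff_eq_zero (by omega) ?_ ?_
      · exact (natDegree_sub_le _ _).trans (max_le hp ((natDegree_smul_le _ _).trans hMd))
      · rw [coeff_sub, coeff_smul, smul_eq_mul, hs]
        field_simp
        ring
    · intro a ha
      simp [h0 a ha, hM0 a ha]
  have hpd : (derivative p).natDegree ≤ r := (natDegree_derivative_le p).trans (by omega)
  have h := polyIntegral_mul_gaussBasis hr hG hk hpd
  rw [hpM, derivative_smul, smul_mul_assoc, map_smul, hM,
    polyIntegral_derivative_lobatto_mul (by rw [natDegree_gaussBasis hG hk]; omega), smul_zero] at h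
  rw [hpM, derivative_smul, hM]
  exact (mul_eq_zero.mp h.symm).resolve_left (ne_of_gt (gaussW_pos hr hG hk))

/-- Superconvergence of the derivative of Lobatto interpolation at the Gauss points. -/
lemma eval_derivative_gauss_eq_sum {r : ℕ} {G L : ℕ → ℝ} (hr : 1 ≤ r) (hG : IsGaussPoints r G)
    (hL : IsLobattoPoints r L) {p : ℝ[X]} (hp : p.natDegree ≤ r + 1) {k : ℕ}
    (hk : k ∈ Finset.Icc 1 r) :
    (derivative p).eval (G k) =
      ∑ a ∈ Finset.range (r + 1), p.eval (L a) * (derivative (lobB r L a)).eval (G k) := by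
  have hd : (∑ a ∈ Finset.range (r + 1), C (p.eval (L a)) * lobB r L a).natDegree ≤ r + 1 := by
    refine natDegree_sum_le_of_forall_le _ _ fun a ha => ?_
    refine (natDegree_C_mul_le _ _).trans ?_
    rw [natDegree_lobB hL ha]
    omega
  have h := eval_derivative_gauss_eq_zero hr hG hL
    (p := p - ∑ a ∈ Finset.range (r + 1), C (p.eval (L a)) * lobB r L a)
    ((natDegree_sub_le _ _).trans (max_le hp hd)) (fun b hb => by
      rw [eval_sub, eval_finsetSum, Finset.sum_eq_single_of_mem b hb]
      · rw [eval_mul, eval_lobB hL hb hb]; simp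
      · intro a ha hab
        rw [eval_mul, eval_lobB hL ha hb]; simp [hab]) hk
  rw [derivative_sub, eval_sub, sub_eq_zero] at h
  rw [h, derivative_sum, eval_finsetSum]
  exact Finset.sum_congr rfl fun a _ => by simp

/-- The affine map from `[-1, 1]` onto `[lo, hi]`. -/
noncomputable def aff (lo hi ξ : ℝ) : ℝ := (lo + hi) / 2 + (hi - lo) / 2 * ξ

lemma aff_mem {lo hi ξ : ℝ} (h : lo ≤ hi) (hξ : ξ ∈ Set.Icc (-1 : ℝ) 1) :
    aff lo hi ξ ∈ Set.Icc lo hi := by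
  obtain ⟨h1, h2⟩ := hξ
  constructor <;> unfold aff <;> nlinarith

lemma aff_neg_one (lo hi : ℝ) : aff lo hi (-1) = lo := by unfold aff; ring

lemma aff_one (lo hi : ℝ) : aff lo hi 1 = hi := by unfold aff; ring

lemma aff_lt_aff {lo hi s t : ℝ} (h : lo < hi) (hst : s < t) : aff lo hi s < aff lo hi t := by
  unfold aff
  have := mul_lt_mul_of_pos_left hst (show 0 < (hi - lo) / 2 by linarith)
  linarith

lemma integral_aff {lo hi : ℝ} (h : lo < hi) (f : ℝ → ℝ) (s t : ℝ) :
    ∫ x in aff lo hi s..aff lo hi t, f x = (hi - lo) / 2 * ∫ ξ in s..t, f (aff lo hi ξ) := by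
  have hc : (hi - lo) / 2 ≠ 0 := by linarith
  have := intervalIntegral.integral_comp_add_mul (a := s) (b := t) f hc ((lo + hi) / 2)
  unfold aff
  rw [this, smul_eq_mul, mul_inv_cancel_left₀ hc]

lemma exists_polynomial_aff (lo hi : ℝ) (p : ℝ[X]) :
    ∃ q : ℝ[X], q.natDegree ≤ p.natDegree ∧ (∀ ξ, q.eval ξ = p.eval (aff lo hi ξ)) ∧
      ∀ ξ, (derivative q).eval ξ = (hi - lo) / 2 * (derivative p).eval (aff lo hi ξ) := by
  refine ⟨p.comp (C ((lo + hi) / 2) + C ((hi - lo) / 2) * X), ?_, fun ξ => ?_, fun ξ => ?_⟩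
  · refine natDegree_comp_le.trans ?_
    have : (C ((lo + hi) / 2) + C ((hi - lo) / 2) * X : ℝ[X]).natDegree ≤ 1 := by
      compute_degree
    nlinarith
  · rw [eval_comp]
    simp [aff]
  · rw [derivative_comp, eval_mul, eval_comp]
    simp [aff]

lemma exists_polynomial_approx_step {n : ℕ} {f f' : ℝ → ℝ} (hf : ∀ s, HasDerivAt f (f' s) s)
    {lo hi ε : ℝ} {q : ℝ[X]} (hq : q.natDegree ≤ n)
    (h : ∀ s ∈ Set.Icc lo hi, |f' s - q.eval s| ≤ ε) (hε : 0 ≤ ε) :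
    ∃ p : ℝ[X], p.natDegree ≤ n + 1 ∧ derivative p = q ∧
      ∀ s ∈ Set.Icc lo hi, |f s - p.eval s| ≤ (hi - lo) * ε := by
  obtain ⟨g, hg, hgn, -⟩ := exists_antiderivative hq
  refine ⟨g + C (f lo - g.eval lo), ?_, by simp [hg], fun s hs => ?_⟩
  · rw [natDegree_add_C]; exact hgn
  have hder : ∀ x ∈ Set.Icc lo hi, HasDerivWithinAt (fun x => f x - (g + C (f lo - g.eval lo)).eval x)
      (f' x - q.eval x) (Set.Icc lo hi) x := fun x _ => by
    have h1 := (g + C (f lo - g.eval lo)).hasDerivAt x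
    have h2 : derivative (g + C (f lo - g.eval lo)) = q := by simp [hg]
    rw [h2] at h1
    exact ((hf x).sub h1).hasDerivWithinAt
  have := norm_image_sub_le_of_norm_deriv_le_segment' hder
    (fun x hx => h x ⟨hx.1, hx.2.le⟩) s hs
  have h0 : f lo - (g + C (f lo - g.eval lo)).eval lo = 0 := by simp
  rw [h0, sub_zero, Real.norm_eq_abs] at this
  refine this.trans ?_
  rw [mul_comm]
  exact mul_le_mul_of_nonneg_right (by linarith [hs.2]) hε

lemma integral_abs_nonneg {lo hi : ℝ} (h : lo ≤ hi) (f : ℝ → ℝ) : 0 ≤ ∫ x in lo..hi, |f x| :=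
  intervalIntegral.integral_nonneg h fun _ _ => abs_nonneg _

lemma abs_sub_le_integral_abs {f f' : ℝ → ℝ} (hf : ∀ s, HasDerivAt f (f' s) s)
    (hc : Continuous f') {lo hi s : ℝ} (hs : s ∈ Set.Icc lo hi) :
    |f s - f lo| ≤ ∫ x in lo..hi, |f' x| := by
  rw [← intervalIntegral.integral_eq_sub_of_hasDerivAt (fun x _ => hf x)
    (hc.intervalIntegrable lo s)]
  refine (intervalIntegral.abs_integral_le_integral_abs hs.1).trans ?_
  rw [← intervalIntegral.integral_add_adjacent_intervals (hc.abs.intervalIntegrable lo s)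
    (hc.abs.intervalIntegrable s hi)]
  have htail := integral_abs_nonneg hs.2 f'
  linarith [htail]

/-- Polynomial approximation with an `L¹` bound on the derivative of order `n + 1`. -/
lemma exists_polynomial_approx (n : ℕ) (F : ℕ → ℝ → ℝ)
    (hF : ∀ i ≤ n, ∀ s, HasDerivAt (F i) (F (i + 1) s) s) (hc : Continuous (F (n + 1)))
    {lo hi : ℝ} (hlo : lo < hi) :
    ∃ p : ℝ[X], p.natDegree ≤ n ∧ ∀ s ∈ Set.Icc lo hi,
      |F 0 s - p.eval s| ≤ (hi - lo) ^ n * ∫ x in lo..hi, |F (n + 1) x| := by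
  induction n generalizing F with
  | zero =>
    refine ⟨C (F 0 lo), by simp, fun s hs => ?_⟩
    simpa using abs_sub_le_integral_abs (hF 0 le_rfl) hc hs
  | succ n ih =>
    obtain ⟨q, hqn, hq⟩ := ih (fun i => F (i + 1)) (fun i hi => hF (i + 1) (by omega)) hc
    obtain ⟨p, hpn, -, hp⟩ := exists_polynomial_approx_step (hF 0 (by omega)) hqn hq
      (mul_nonneg (pow_nonneg (by linarith) _) (integral_abs_nonneg hlo.le _))
    refine ⟨p, hpn, fun s hs => (hp s hs).trans (le_of_eq ?_)⟩
    ring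

lemma exists_polynomial_approx_deriv (n : ℕ) (F : ℕ → ℝ → ℝ)
    (hF : ∀ i ≤ n + 1, ∀ s, HasDerivAt (F i) (F (i + 1) s) s) (hc : Continuous (F (n + 2)))
    {lo hi : ℝ} (hlo : lo < hi) :
    ∃ p : ℝ[X], p.natDegree ≤ n + 1 ∧ ∀ s ∈ Set.Icc lo hi,
      |F 0 s - p.eval s| ≤ (hi - lo) ^ (n + 1) * ∫ x in lo..hi, |F (n + 2) x| ∧
      |F 1 s - (derivative p).eval s| ≤ (hi - lo) ^ n * ∫ x in lo..hi, |F (n + 2) x| := by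
  obtain ⟨q, hqn, hq⟩ := exists_polynomial_approx n (fun i => F (i + 1))
    (fun i hi => hF (i + 1) (by omega)) hc hlo
  obtain ⟨p, hpn, hpd, hp⟩ := exists_polynomial_approx_step (hF 0 (by omega)) hqn hq
    (mul_nonneg (pow_nonneg (by linarith) _) (integral_abs_nonneg hlo.le _))
  refine ⟨p, hpn, fun s hs => ⟨(hp s hs).trans (le_of_eq (by ring)), ?_⟩⟩
  rw [hpd]
  exact hq s hs

/-- The sum of the absolute values of all `ℓ_a'(G_k)`. -/
noncomputable def gradSum (r : ℕ) (G L : ℕ → ℝ) : ℝ :=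
  ∑ k ∈ Finset.Icc 1 r, ∑ a ∈ Finset.range (r + 1), |(derivative (lobB r L a)).eval (G k)|

lemma gradSum_nonneg (r : ℕ) (G L : ℕ → ℝ) : 0 ≤ gradSum r G L :=
  Finset.sum_nonneg fun _ _ => Finset.sum_nonneg fun _ _ => abs_nonneg _

lemma abs_sum_mul_le_gradSum {r : ℕ} {G L : ℕ → ℝ} {k : ℕ} (hk : k ∈ Finset.Icc 1 r)
    {f : ℕ → ℝ} {ε : ℝ} (hε : 0 ≤ ε) (hf : ∀ a ∈ Finset.range (r + 1), |f a| ≤ ε) :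
    |∑ a ∈ Finset.range (r + 1), f a * (derivative (lobB r L a)).eval (G k)| ≤
      gradSum r G L * ε := by
  calc _ ≤ ∑ a ∈ Finset.range (r + 1), |f a * (derivative (lobB r L a)).eval (G k)| :=
        Finset.abs_sum_le_sum_abs _ _
    _ ≤ ∑ a ∈ Finset.range (r + 1), |(derivative (lobB r L a)).eval (G k)| * ε := by
        refine Finset.sum_le_sum fun a ha => ?_
        rw [abs_mul, mul_comm]
        exact mul_le_mul_of_nonneg_left (hf a ha) (abs_nonneg _)
    _ = (∑ a ∈ Finset.range (r + 1), |(derivative (lobB r L a)).eval (G k)|) * ε :=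
        (Finset.sum_mul _ _ _).symm
    _ ≤ _ := by
        refine mul_le_mul_of_nonneg_right ?_ hε
        exact Finset.single_le_sum
          (f := fun k => ∑ a ∈ Finset.range (r + 1), |(derivative (lobB r L a)).eval (G k)|)
          (fun _ _ => Finset.sum_nonneg fun _ _ => abs_nonneg _) hk

/-- Error of the derivative of Lobatto interpolation at the Gauss points. -/
lemma abs_deriv_sub_interp_gauss_le {r : ℕ} {G L : ℕ → ℝ} (hr : 1 ≤ r) (hG : IsGaussPoints r G)
    (hL : IsLobattoPoints r L) {k : ℕ} (hk : k ∈ Finset.Icc 1 r) (F : ℕ → ℝ → ℝ)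
    (hF : ∀ i ≤ r + 1, ∀ s, HasDerivAt (F i) (F (i + 1) s) s) (hc : Continuous (F (r + 2)))
    {lo hi : ℝ} (hlo : lo < hi) :
    |(hi - lo) / 2 * F 1 (aff lo hi (G k)) - ∑ a ∈ Finset.range (r + 1),
        F 0 (aff lo hi (L a)) * (derivative (lobB r L a)).eval (G k)| ≤
      (1 + gradSum r G L) * ((hi - lo) ^ (r + 1) * ∫ x in lo..hi, |F (r + 2) x|) := by
  obtain ⟨p, hpn, hp⟩ := exists_polynomial_approx_deriv r F hF hc hlo
  obtain ⟨q, hqn, hq, hq'⟩ := exists_polynomial_aff lo hi p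
  set I := ∫ x in lo..hi, |F (r + 2) x| with hI
  have hI0 : 0 ≤ I := integral_abs_nonneg hlo.le _
  have hε : 0 ≤ (hi - lo) ^ (r + 1) * I := mul_nonneg (pow_nonneg (by linarith) _) hI0
  have hGk : G k ∈ Set.Icc (-1 : ℝ) 1 := by
    rw [Finset.mem_Icc] at hk
    exact Set.Ioo_subset_Icc_self (hG.2 k hk.1 hk.2).1
  have hexact := eval_derivative_gauss_eq_sum hr hG hL (hqn.trans hpn) hk
  rw [hq'] at hexact
  simp only [hq] at hexact
  have hb := abs_sum_mul_le_gradSum (G := G) (L := L) hk hε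
    (f := fun a => F 0 (aff lo hi (L a)) - p.eval (aff lo hi (L a)))
    (fun a ha => (hp _ (aff_mem hlo.le (hL.mem ha))).1)
  simp only [sub_mul, Finset.sum_sub_distrib] at hb
  have hd := (hp _ (aff_mem hlo.le hGk)).2
  have hd' : |(hi - lo) / 2 * (F 1 (aff lo hi (G k)) - (derivative p).eval (aff lo hi (G k)))| ≤
      (hi - lo) ^ (r + 1) * I := by
    rw [abs_mul, abs_of_pos (show 0 < (hi - lo) / 2 by linarith)]
    calc _ ≤ (hi - lo) / 2 * ((hi - lo) ^ r * I) := mul_le_mul_of_nonneg_left hd (by linarith)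
      _ ≤ (hi - lo) * ((hi - lo) ^ r * I) := by
          refine mul_le_mul_of_nonneg_right (by linarith) (mul_nonneg (pow_nonneg (by linarith) _) hI0)
      _ = _ := by ring
  rw [← hexact] at hb
  rw [add_mul, one_mul]
  refine le_trans (le_of_eq ?_) ((abs_sub _ _).trans (add_le_add hd' hb))
  congr 1
  ring

lemma abs_interp_deriv_gauss_le {r : ℕ} {G L : ℕ → ℝ}
    (hL : IsLobattoPoints r L) {k : ℕ} (hk : k ∈ Finset.Icc 1 r) {f f' : ℝ → ℝ}
    (hf : ∀ s, HasDerivAt f (f' s) s) (hc : Continuous f') {lo hi : ℝ} (hlo : lo < hi) :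
    |∑ a ∈ Finset.range (r + 1), f (aff lo hi (L a)) * (derivative (lobB r L a)).eval (G k)| ≤
      gradSum r G L * ∫ x in lo..hi, |f' x| := by
  have hb := abs_sum_mul_le_gradSum (G := G) (L := L) hk (integral_abs_nonneg hlo.le f')
    (f := fun a => f (aff lo hi (L a)) - f lo)
    (fun a ha => abs_sub_le_integral_abs hf hc (aff_mem hlo.le (hL.mem ha)))
  have h0 : ∑ a ∈ Finset.range (r + 1), (derivative (lobB r L a)).eval (G k) = 0 := by
    have h1 : ∑ a ∈ Finset.range (r + 1), lobB r L a = 1 :=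
      Lagrange.sum_basis hL.injOn ⟨0, by simp⟩
    rw [← eval_finsetSum, ← derivative_sum, h1]
    simp
  simp only [sub_mul, Finset.sum_sub_distrib, ← Finset.mul_sum] at hb
  rwa [h0, mul_zero, sub_zero] at hb

/-- Error of Lobatto interpolation. -/
lemma exists_abs_sub_interp_le {r : ℕ} {L : ℕ → ℝ} (hL : IsLobattoPoints r L) :
    ∃ C : ℝ, 0 ≤ C ∧ ∀ (F : ℕ → ℝ → ℝ) (_ : ∀ i ≤ r, ∀ s, HasDerivAt (F i) (F (i + 1) s) s)
      (_ : Continuous (F (r + 1))) (lo hi : ℝ) (_ : lo < hi) (η : ℝ) (_ : η ∈ Set.Icc (-1 : ℝ) 1),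
      |F 0 (aff lo hi η) - ∑ b ∈ Finset.range (r + 1), F 0 (aff lo hi (L b)) * (lobB r L b).eval η| ≤
        C * ((hi - lo) ^ r * ∫ x in lo..hi, |F (r + 1) x|) := by
  have hcont : Continuous fun η : ℝ => ∑ b ∈ Finset.range (r + 1), |(lobB r L b).eval η| :=
    continuous_finsetSum _ fun b _ => (lobB r L b).continuous.abs
  obtain ⟨S, hS⟩ := (isCompact_Icc (a := (-1 : ℝ)) (b := 1)).bddAbove_image hcont.continuousOn
  have hS' : ∀ η ∈ Set.Icc (-1 : ℝ) 1, ∑ b ∈ Finset.range (r + 1), |(lobB r L b).eval η| ≤ S :=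
    fun η hη => hS ⟨η, hη, rfl⟩
  have hS0 : 0 ≤ S := (Finset.sum_nonneg fun _ _ => abs_nonneg _).trans (hS' 0 (by norm_num))
  refine ⟨1 + S, by linarith, fun F hF hc lo hi hlo η hη => ?_⟩
  obtain ⟨p, hpn, hp⟩ := exists_polynomial_approx r F hF hc hlo
  obtain ⟨q, hqn, hq, -⟩ := exists_polynomial_aff lo hi p
  set ε := (hi - lo) ^ r * ∫ x in lo..hi, |F (r + 1) x| with hε
  have hε0 : 0 ≤ ε := mul_nonneg (pow_nonneg (by linarith) _) (integral_abs_nonneg hlo.le _)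
  have hexact : p.eval (aff lo hi η) =
      ∑ b ∈ Finset.range (r + 1), p.eval (aff lo hi (L b)) * (lobB r L b).eval η := by
    have := congrArg (eval η) (eq_sum_lobB hL (hqn.trans hpn))
    rw [eval_finsetSum] at this
    simpa [hq] using this
  have hsum : |∑ b ∈ Finset.range (r + 1),
      (F 0 (aff lo hi (L b)) - p.eval (aff lo hi (L b))) * (lobB r L b).eval η| ≤ S * ε := by
    calc _ ≤ ∑ b ∈ Finset.range (r + 1),
          |(F 0 (aff lo hi (L b)) - p.eval (aff lo hi (L b))) * (lobB r L b).eval η| :=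
          Finset.abs_sum_le_sum_abs _ _
      _ ≤ ∑ b ∈ Finset.range (r + 1), |(lobB r L b).eval η| * ε := by
          refine Finset.sum_le_sum fun b hb => ?_
          rw [abs_mul, mul_comm]
          exact mul_le_mul_of_nonneg_left (hp _ (aff_mem hlo.le (hL.mem hb))) (abs_nonneg _)
      _ ≤ S * ε := by
          rw [← Finset.sum_mul]
          exact mul_le_mul_of_nonneg_right (hS' η hη) hε0
  simp only [sub_mul, Finset.sum_sub_distrib] at hsum
  rw [← hexact] at hsum
  rw [add_mul, one_mul]
  refine le_trans (le_of_eq ?_)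
    ((abs_sub _ _).trans (add_le_add (hp _ (aff_mem hlo.le hη)) hsum))
  congr 1
  ring

/-- The polynomial of degree at most `r` with value `c a` at the Lobatto point `L a`. -/
noncomputable def lobComb (r : ℕ) (L : ℕ → ℝ) (c : ℕ → ℝ) : ℝ[X] :=
  ∑ a ∈ Finset.range (r + 1), C (c a) * lobB r L a

lemma natDegree_lobComb {r : ℕ} {L : ℕ → ℝ} (hL : IsLobattoPoints r L) (c : ℕ → ℝ) :
    (lobComb r L c).natDegree ≤ r :=
  natDegree_sum_le_of_forall_le _ _ fun _ ha =>
    (natDegree_C_mul_le _ _).trans (natDegree_lobB hL ha).le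

/-- The first partial derivative, on the reference cell, of the tensor-product polynomial with
nodal values `V`. -/
noncomputable def interpDx (r : ℕ) (L : ℕ → ℝ) (V : ℕ → ℕ → ℝ) (ξ η : ℝ) : ℝ :=
  ∑ a ∈ Finset.range (r + 1), ∑ b ∈ Finset.range (r + 1),
    V a b * (derivative (lobB r L a)).eval ξ * (lobB r L b).eval η

/-- The jump across the Gauss line `G k` of the dual function with nodal values `V`. -/
noncomputable def dualJump (r : ℕ) (G L : ℕ → ℝ) (V : ℕ → ℕ → ℝ) (k l : ℕ) : ℝ :=
  gaussW r G k * ∑ a ∈ Finset.range (r + 1), ∑ b ∈ Finset.range (r + 1),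
    V a b * (derivative (lobB r L a)).eval (G k) * dualVal r G l (lobB r L b)

/-- The restriction of `interpDx` to a vertical line. -/
noncomputable def sliceY (r : ℕ) (L : ℕ → ℝ) (V : ℕ → ℕ → ℝ) (ξ : ℝ) : ℝ[X] :=
  lobComb r L fun b => ∑ a ∈ Finset.range (r + 1), V a b * (derivative (lobB r L a)).eval ξ

lemma interpDx_eq_sliceY (r : ℕ) (L : ℕ → ℝ) (V : ℕ → ℕ → ℝ) (ξ η : ℝ) :
    interpDx r L V ξ η = (sliceY r L V ξ).eval η := by
  rw [interpDx, sliceY, lobComb, eval_finsetSum, Finset.sum_comm]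
  refine Finset.sum_congr rfl fun b _ => ?_
  rw [eval_mul, eval_C, Finset.sum_mul]

lemma interpDx_eq_derivative (r : ℕ) (L : ℕ → ℝ) (V : ℕ → ℕ → ℝ) (ξ η : ℝ) :
    interpDx r L V ξ η = (derivative (lobComb r L fun a =>
      ∑ b ∈ Finset.range (r + 1), V a b * (lobB r L b).eval η)).eval ξ := by
  rw [interpDx, lobComb, derivative_sum, eval_finsetSum]
  refine Finset.sum_congr rfl fun a _ => ?_
  rw [derivative_C_mul, eval_mul, eval_C, Finset.sum_mul]
  exact Finset.sum_congr rfl fun b _ => by ring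

lemma dualJump_eq (r : ℕ) (G L : ℕ → ℝ) (V : ℕ → ℕ → ℝ) (k l : ℕ) :
    dualJump r G L V k l = gaussW r G k * dualVal r G l (sliceY r L V (G k)) := by
  rw [dualJump, sliceY, lobComb, map_sum, Finset.sum_comm]
  congr 1
  refine Finset.sum_congr rfl fun b _ => ?_
  rw [← smul_eq_C_mul, map_smul, smul_eq_mul, Finset.sum_mul]

lemma integral_interpDx_sq {r : ℕ} {G L : ℕ → ℝ} (hr : 1 ≤ r) (hG : IsGaussPoints r G)
    (hL : IsLobattoPoints r L) (V : ℕ → ℕ → ℝ) :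
    ∫ η in (-1 : ℝ)..1, ∫ ξ in (-1 : ℝ)..1, interpDx r L V ξ η ^ 2 =
      ∑ k ∈ Finset.Icc 1 r,
        gaussW r G k * polyIntegral (sliceY r L V (G k) * sliceY r L V (G k)) := by
  have h1 : ∀ η : ℝ, ∫ ξ in (-1 : ℝ)..1, interpDx r L V ξ η ^ 2 =
      ∑ k ∈ Finset.Icc 1 r, gaussW r G k * (sliceY r L V (G k) * sliceY r L V (G k)).eval η := by
    intro η
    set p := derivative (lobComb r L fun a =>
      ∑ b ∈ Finset.range (r + 1), V a b * (lobB r L b).eval η) with hp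
    have hpd : p.natDegree ≤ r - 1 :=
      (natDegree_derivative_le _).trans (Nat.sub_le_sub_right (natDegree_lobComb hL _) 1)
    have := gauss_exact hr hG (f := p * p) (natDegree_mul_le.trans_lt (by omega))
    rw [polyIntegral_apply] at this
    simp only [eval_mul, hp, ← interpDx_eq_derivative] at this
    simp only [eval_mul, ← interpDx_eq_sliceY, ← this, pow_two]
  simp only [h1]
  rw [intervalIntegral.integral_finsetSum]
  · refine Finset.sum_congr rfl fun k _ => ?_
    rw [intervalIntegral.integral_const_mul, polyIntegral_apply]
  · intro k _
    exact (((sliceY r L V (G k) * sliceY r L V (G k)).continuous.const_mul _).intervalIntegrable _ _)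

lemma integral_interpDx_sq_le {r : ℕ} {G L : ℕ → ℝ} (hr : 1 ≤ r) (hG : IsGaussPoints r G)
    (hL : IsLobattoPoints r L) (V : ℕ → ℕ → ℝ) :
    ∫ η in (-1 : ℝ)..1, ∫ ξ in (-1 : ℝ)..1, interpDx r L V ξ η ^ 2 ≤
      ∑ k ∈ Finset.Icc 1 r, ∑ l ∈ Finset.range (r + 1), dualJump r G L V k l *
        ∫ η in gaussExt r G l..gaussExt r G (l + 1), interpDx r L V (G k) η := by
  rw [integral_interpDx_sq hr hG hL]
  refine Finset.sum_le_sum fun k hk => ?_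
  refine (mul_le_mul_of_nonneg_left (polyIntegral_mul_self_le hr hG (natDegree_lobComb hL _))
    (gaussW_pos hr hG hk).le).trans (le_of_eq ?_)
  rw [Finset.mul_sum]
  refine Finset.sum_congr rfl fun l _ => ?_
  simp only [dualJump_eq, interpDx_eq_sliceY]
  exact (mul_assoc _ _ _).symm

lemma exists_dualJump_sq_le {r : ℕ} {G L : ℕ → ℝ} (hr : 1 ≤ r) (hG : IsGaussPoints r G)
    (hL : IsLobattoPoints r L) :
    ∃ C : ℝ, 0 ≤ C ∧ ∀ (V : ℕ → ℕ → ℝ), ∀ k ∈ Finset.Icc 1 r, ∀ l ∈ Finset.range (r + 1),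
      dualJump r G L V k l ^ 2 ≤
        C * ∫ η in (-1 : ℝ)..1, ∫ ξ in (-1 : ℝ)..1, interpDx r L V ξ η ^ 2 := by
  choose K hK0 hK using fun l => exists_sq_le_polyIntegral (dualVal r G l) (r + 1)
  refine ⟨∑ k ∈ Finset.Icc 1 r, ∑ l ∈ Finset.range (r + 1), gaussW r G k * K l, ?_, ?_⟩
  · exact Finset.sum_nonneg fun k hk => Finset.sum_nonneg fun l _ =>
      mul_nonneg (gaussW_pos hr hG hk).le (hK0 l)
  intro V k hk l hl
  have hA := gaussW_pos hr hG hk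
  have hJ : dualJump r G L V k l ^ 2 ≤ (gaussW r G k * K l) *
      (gaussW r G k * polyIntegral (sliceY r L V (G k) * sliceY r L V (G k))) := by
    rw [dualJump_eq, mul_pow]
    have := hK l (sliceY r L V (G k))
      (degree_lt_of_natDegree_lt (Nat.lt_succ_of_le (natDegree_lobComb hL _)))
    nlinarith [mul_le_mul_of_nonneg_left this (sq_nonneg (gaussW r G k))]
  have h1 : gaussW r G k * polyIntegral (sliceY r L V (G k) * sliceY r L V (G k)) ≤
      ∫ η in (-1 : ℝ)..1, ∫ ξ in (-1 : ℝ)..1, interpDx r L V ξ η ^ 2 := by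
    rw [integral_interpDx_sq hr hG hL]
    exact Finset.single_le_sum (f := fun k => gaussW r G k *
      polyIntegral (sliceY r L V (G k) * sliceY r L V (G k)))
      (fun k hk => mul_nonneg (gaussW_pos hr hG hk).le (polyIntegral_mul_self_nonneg _)) hk
  have h2 : gaussW r G k * K l ≤
      ∑ k ∈ Finset.Icc 1 r, ∑ l ∈ Finset.range (r + 1), gaussW r G k * K l :=
    (Finset.single_le_sum (f := fun l => gaussW r G k * K l)
      (fun l _ => mul_nonneg hA.le (hK0 l)) hl).trans
    (Finset.single_le_sum (f := fun k => ∑ l ∈ Finset.range (r + 1), gaussW r G k * K l)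
      (fun k hk => Finset.sum_nonneg fun l _ => mul_nonneg (gaussW_pos hr hG hk).le (hK0 l)) hk)
  have h3 : 0 ≤ gaussW r G k * polyIntegral (sliceY r L V (G k) * sliceY r L V (G k)) :=
    mul_nonneg hA.le (polyIntegral_mul_self_nonneg _)
  exact hJ.trans (mul_le_mul h2 h1 h3 ((mul_nonneg hA.le (hK0 l)).trans h2))

/-- Scaling of the square integral from the reference cell to a cell. -/
lemma integral_sq_of_interpDx {r : ℕ} {L : ℕ → ℝ} {V : ℕ → ℕ → ℝ} {D : ℝ → ℝ → ℝ}
    {x₀ x₁ y₀ y₁ : ℝ} (hx : x₀ < x₁) (hy : y₀ < y₁)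
    (hD : ∀ ξ η, (x₁ - x₀) / 2 * D (aff x₀ x₁ ξ) (aff y₀ y₁ η) = interpDx r L V ξ η) :
    (x₁ - x₀) * ∫ t in y₀..y₁, ∫ s in x₀..x₁, D s t ^ 2 =
      (y₁ - y₀) * ∫ η in (-1 : ℝ)..1, ∫ ξ in (-1 : ℝ)..1, interpDx r L V ξ η ^ 2 := by
  have h1 : ∫ t in y₀..y₁, ∫ s in x₀..x₁, D s t ^ 2 = (y₁ - y₀) / 2 * ((x₁ - x₀) / 2 *
      ∫ η in (-1 : ℝ)..1, ∫ ξ in (-1 : ℝ)..1, D (aff x₀ x₁ ξ) (aff y₀ y₁ η) ^ 2) := by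
    have e1 := integral_aff hy (fun t => ∫ s in x₀..x₁, D s t ^ 2) (-1) 1
    rw [aff_neg_one, aff_one] at e1
    have e2 : ∀ η, ∫ s in x₀..x₁, D s (aff y₀ y₁ η) ^ 2 =
        (x₁ - x₀) / 2 * ∫ ξ in (-1 : ℝ)..1, D (aff x₀ x₁ ξ) (aff y₀ y₁ η) ^ 2 := fun η => by
      have e3 := integral_aff hx (fun s => D s (aff y₀ y₁ η) ^ 2) (-1) 1
      rwa [aff_neg_one, aff_one] at e3
    rw [e1]
    simp only [e2, intervalIntegral.integral_const_mul]
  rw [h1]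
  simp only [← hD, mul_pow, intervalIntegral.integral_const_mul]
  ring

/-- Coercivity on one cell. -/
lemma integral_sq_le_sum_dualJump {r : ℕ} {G L : ℕ → ℝ} (hr : 1 ≤ r) (hG : IsGaussPoints r G)
    (hL : IsLobattoPoints r L) {V : ℕ → ℕ → ℝ} {D : ℝ → ℝ → ℝ}
    {x₀ x₁ y₀ y₁ : ℝ} (hx : x₀ < x₁) (hy : y₀ < y₁)
    (hD : ∀ ξ η, (x₁ - x₀) / 2 * D (aff x₀ x₁ ξ) (aff y₀ y₁ η) = interpDx r L V ξ η) :
    ∫ t in y₀..y₁, ∫ s in x₀..x₁, D s t ^ 2 ≤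
      ∑ k ∈ Finset.Icc 1 r, ∑ l ∈ Finset.range (r + 1), dualJump r G L V k l *
        ∫ t in aff y₀ y₁ (gaussExt r G l)..aff y₀ y₁ (gaussExt r G (l + 1)),
          D (aff x₀ x₁ (G k)) t := by
  have hx' : 0 < x₁ - x₀ := sub_pos.mpr hx
  refine le_of_mul_le_mul_left ?_ hx'
  rw [integral_sq_of_interpDx hx hy hD]
  refine (mul_le_mul_of_nonneg_left (integral_interpDx_sq_le hr hG hL V)
    (sub_pos.mpr hy).le).trans (le_of_eq ?_)
  rw [Finset.mul_sum, Finset.mul_sum]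
  refine Finset.sum_congr rfl fun k _ => ?_
  rw [Finset.mul_sum, Finset.mul_sum]
  refine Finset.sum_congr rfl fun l _ => ?_
  rw [integral_aff hy]
  simp only [← hD, intervalIntegral.integral_const_mul]
  ring

lemma exists_dualJump_sq_mul_le {r : ℕ} {G L : ℕ → ℝ} (hr : 1 ≤ r) (hG : IsGaussPoints r G)
    (hL : IsLobattoPoints r L) :
    ∃ C : ℝ, 0 ≤ C ∧ ∀ (V : ℕ → ℕ → ℝ) (D : ℝ → ℝ → ℝ) (x₀ x₁ y₀ y₁ : ℝ), x₀ < x₁ → y₀ < y₁ →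
      (∀ ξ η, (x₁ - x₀) / 2 * D (aff x₀ x₁ ξ) (aff y₀ y₁ η) = interpDx r L V ξ η) →
      ∀ k ∈ Finset.Icc 1 r, ∀ l ∈ Finset.range (r + 1),
        (y₁ - y₀) * dualJump r G L V k l ^ 2 ≤
          C * (x₁ - x₀) * ∫ t in y₀..y₁, ∫ s in x₀..x₁, D s t ^ 2 := by
  obtain ⟨K, hK0, hK⟩ := exists_dualJump_sq_le hr hG hL
  refine ⟨K, hK0, fun V D x₀ x₁ y₀ y₁ hx hy hD k hk l hl => ?_⟩
  rw [mul_assoc, integral_sq_of_interpDx hx hy hD]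
  have := mul_le_mul_of_nonneg_left (hK V k hk l hl) (sub_pos.mpr hy).le
  linarith

lemma integral_swap_of_continuous {f : ℝ → ℝ → ℝ} (hf : Continuous f.uncurry) (x₀ x₁ y₀ y₁ : ℝ) :
    ∫ s in x₀..x₁, ∫ t in y₀..y₁, f s t = ∫ t in y₀..y₁, ∫ s in x₀..x₁, f s t := by
  refine intervalIntegral_intervalIntegral_swap ?_
  refine (hf.continuousOn.integrableOn_compact
    (isCompact_uIcc (a := x₀) (b := x₁) |>.prod (isCompact_uIcc (a := y₀) (b := y₁)))).mono_set ?_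
  exact Set.prod_mono Set.uIoc_subset_uIcc Set.uIoc_subset_uIcc

lemma setIntegral_prod_eq {f : ℝ × ℝ → ℝ} (hf : Continuous f) {x₀ x₁ y₀ y₁ : ℝ} (hx : x₀ ≤ x₁)
    (hy : y₀ ≤ y₁) : ∫ z in Set.Icc x₀ x₁ ×ˢ Set.Icc y₀ y₁, f z =
      ∫ s in x₀..x₁, ∫ t in y₀..y₁, f (s, t) := by
  rw [Measure.volume_eq_prod, setIntegral_prod]
  · simp only [intervalIntegral.integral_of_le hx, intervalIntegral.integral_of_le hy,
      integral_Icc_eq_integral_Ioc]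
  · exact hf.continuousOn.integrableOn_compact (isCompact_Icc.prod isCompact_Icc)

lemma sq_integral_le {f : ℝ → ℝ} (hf : Continuous f) {lo hi : ℝ} (h : lo < hi) :
    (∫ x in lo..hi, f x) ^ 2 ≤ (hi - lo) * ∫ x in lo..hi, f x ^ 2 := by
  set I := ∫ x in lo..hi, f x with hI
  have h0 : 0 ≤ ∫ x in lo..hi, ((hi - lo) * f x - I) ^ 2 :=
    intervalIntegral.integral_nonneg h.le fun _ _ => sq_nonneg _
  have h1 : ∫ x in lo..hi, ((hi - lo) * f x - I) ^ 2 =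
      (hi - lo) * ((hi - lo) * (∫ x in lo..hi, f x ^ 2) - I ^ 2) := by
    have e : ∀ x, ((hi - lo) * f x - I) ^ 2 =
        (hi - lo) ^ 2 * f x ^ 2 - 2 * (hi - lo) * I * f x + I ^ 2 := fun x => by ring
    simp only [e]
    rw [intervalIntegral.integral_add, intervalIntegral.integral_sub,
      intervalIntegral.integral_const_mul, intervalIntegral.integral_const_mul,
      intervalIntegral.integral_const, ← hI, smul_eq_mul]
    · ring
    all_goals exact Continuous.intervalIntegrable (by fun_prop) _ _
  rw [h1] at h0
  linarith [nonneg_of_mul_nonneg_right h0 (sub_pos.mpr h)]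

lemma sq_integral_integral_abs_le {f : ℝ → ℝ → ℝ} (hf : Continuous f.uncurry) {x₀ x₁ y₀ y₁ : ℝ}
    (hx : x₀ < x₁) (hy : y₀ < y₁) :
    (∫ t in y₀..y₁, ∫ s in x₀..x₁, |f s t|) ^ 2 ≤
      (y₁ - y₀) * ((x₁ - x₀) * ∫ t in y₀..y₁, ∫ s in x₀..x₁, f s t ^ 2) := by
  have hc : ∀ t, Continuous fun s => f s t := fun t =>
    hf.comp (continuous_id.prodMk continuous_const)
  have hs : Continuous (Function.uncurry fun t s => f s t) := hf.comp continuous_swap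
  have ha : Continuous (Function.uncurry fun t s => |f s t|) := hs.abs
  have hq : Continuous (Function.uncurry fun t s => f s t ^ 2) := hs.pow 2
  have hA : Continuous fun t => ∫ s in x₀..x₁, |f s t| :=
    intervalIntegral.continuous_parametric_intervalIntegral_of_continuous' ha _ _
  have hQ : Continuous fun t => ∫ s in x₀..x₁, f s t ^ 2 :=
    intervalIntegral.continuous_parametric_intervalIntegral_of_continuous' hq _ _
  refine (sq_integral_le hA hy).trans (mul_le_mul_of_nonneg_left ?_ (sub_pos.mpr hy).le)
  rw [← intervalIntegral.integral_const_mul]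
  refine intervalIntegral.integral_mono_on hy.le ((hA.pow 2).intervalIntegrable _ _)
    ((hQ.const_mul _).intervalIntegrable _ _) fun t _ => ?_
  have := sq_integral_le (hc t).abs hx
  simpa only [sq_abs] using this

/-- Pointwise error of the `x`-derivative of Lobatto interpolation on a Gauss line. -/
lemma exists_abs_deriv_sub_interpDx_le {r : ℕ} {G L : ℕ → ℝ} (hr : 1 ≤ r)
    (hG : IsGaussPoints r G) (hL : IsLobattoPoints r L) :
    ∃ C : ℝ, 0 ≤ C ∧ ∀ (F H : ℕ → ℝ → ℝ → ℝ),
      (∀ i ≤ r + 1, ∀ s t, HasDerivAt (fun s => F i s t) (F (i + 1) s t) s) →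
      (∀ i ≤ r, ∀ s t, HasDerivAt (fun t => H i s t) (H (i + 1) s t) t) →
      H 0 = F 1 → Continuous (F 1).uncurry →
      Continuous (F (r + 2)).uncurry → Continuous (H (r + 1)).uncurry →
      ∀ x₀ x₁ y₀ y₁ : ℝ, x₀ < x₁ → y₀ < y₁ → ∀ k ∈ Finset.Icc 1 r, ∀ η ∈ Set.Icc (-1 : ℝ) 1,
      |(x₁ - x₀) / 2 * F 1 (aff x₀ x₁ (G k)) (aff y₀ y₁ η) -
          interpDx r L (fun a b => F 0 (aff x₀ x₁ (L a)) (aff y₀ y₁ (L b))) (G k) η| ≤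
        C * ((x₁ - x₀) ^ (r + 1) * (∫ s in x₀..x₁, |F (r + 2) s (aff y₀ y₁ η)|) +
          (y₁ - y₀) ^ r * ∫ t in y₀..y₁, ∫ s in x₀..x₁, |H (r + 1) s t|) := by
  obtain ⟨K, hK0, hK⟩ := exists_abs_sub_interp_le hL
  have hg := gradSum_nonneg r G L
  refine ⟨(1 + gradSum r G L) * (1 + K), by positivity, ?_⟩
  intro F H hF hH hHF hF1 hFc hHc x₀ x₁ y₀ y₁ hx hy k hk η hη
  set y := aff y₀ y₁ η with hyd
  have hline : ∀ {f : ℝ → ℝ → ℝ}, Continuous f.uncurry → ∀ t, Continuous fun s => f s t :=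
    fun hf t => hf.comp (continuous_id.prodMk continuous_const)
  have hlineY : ∀ {f : ℝ → ℝ → ℝ}, Continuous f.uncurry → ∀ s, Continuous fun t => f s t :=
    fun hf s => hf.comp (continuous_const.prodMk continuous_id)
  have h1 := abs_deriv_sub_interp_gauss_le hr hG hL hk (fun i s => F i s y)
    (fun i hi s => hF i hi s y) (hline hFc y) hx
  set f' : ℝ → ℝ := fun s => F 1 s y - ∑ b ∈ Finset.range (r + 1),
    F 1 s (aff y₀ y₁ (L b)) * (lobB r L b).eval η with hf'
  have hf'c : Continuous f' := (hline hF1 y).sub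
    (continuous_finsetSum _ fun b _ => (hline hF1 _).mul continuous_const)
  have h2 := abs_interp_deriv_gauss_le (G := G) hL hk
    (f := fun s => F 0 s y - ∑ b ∈ Finset.range (r + 1),
      F 0 s (aff y₀ y₁ (L b)) * (lobB r L b).eval η) (f' := f')
    (fun s => (hF 0 (by omega) s y).sub
      (HasDerivAt.fun_sum fun b _ => (hF 0 (by omega) s _).mul_const _)) hf'c hx
  have hHa : Continuous (Function.uncurry fun s t => |H (r + 1) s t|) := hHc.abs
  have hf'b : ∀ s, |f' s| ≤ K * ((y₁ - y₀) ^ r * ∫ t in y₀..y₁, |H (r + 1) s t|) := fun s => by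
    have := hK (fun i t => H i s t) (fun i hi t => hH i hi s t) (hlineY hHc s) y₀ y₁ hy η hη
    simpa only [hHF] using this
  have h3 : ∫ s in x₀..x₁, |f' s| ≤
      K * ((y₁ - y₀) ^ r * ∫ t in y₀..y₁, ∫ s in x₀..x₁, |H (r + 1) s t|) := by
    rw [← integral_swap_of_continuous hHa, ← intervalIntegral.integral_const_mul,
      ← intervalIntegral.integral_const_mul]
    refine intervalIntegral.integral_mono_on hx.le (hf'c.abs.intervalIntegrable _ _) ?_
      fun s _ => hf'b s
    have : Continuous fun s => ∫ t in y₀..y₁, |H (r + 1) s t| :=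
      intervalIntegral.continuous_parametric_intervalIntegral_of_continuous' hHa _ _
    exact ((this.const_mul _).const_mul _).intervalIntegrable _ _
  have heq : (x₁ - x₀) / 2 * F 1 (aff x₀ x₁ (G k)) y -
      interpDx r L (fun a b => F 0 (aff x₀ x₁ (L a)) (aff y₀ y₁ (L b))) (G k) η =
      ((x₁ - x₀) / 2 * F 1 (aff x₀ x₁ (G k)) y - ∑ a ∈ Finset.range (r + 1),
        F 0 (aff x₀ x₁ (L a)) y * (derivative (lobB r L a)).eval (G k)) +
      ∑ a ∈ Finset.range (r + 1), (F 0 (aff x₀ x₁ (L a)) y - ∑ b ∈ Finset.range (r + 1),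
        F 0 (aff x₀ x₁ (L a)) (aff y₀ y₁ (L b)) * (lobB r L b).eval η) *
          (derivative (lobB r L a)).eval (G k) := by
    have : interpDx r L (fun a b => F 0 (aff x₀ x₁ (L a)) (aff y₀ y₁ (L b))) (G k) η =
        ∑ a ∈ Finset.range (r + 1), (∑ b ∈ Finset.range (r + 1),
          F 0 (aff x₀ x₁ (L a)) (aff y₀ y₁ (L b)) * (lobB r L b).eval η) *
          (derivative (lobB r L a)).eval (G k) := by
      rw [interpDx]
      refine Finset.sum_congr rfl fun a _ => ?_
      rw [Finset.sum_mul]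
      exact Finset.sum_congr rfl fun b _ => by ring
    rw [this]
    simp only [sub_mul, Finset.sum_sub_distrib]
    ring
  rw [heq]
  refine (abs_add_le _ _).trans ?_
  have hI1 : 0 ≤ (x₁ - x₀) ^ (r + 1) * ∫ s in x₀..x₁, |F (r + 2) s y| :=
    mul_nonneg (pow_nonneg (sub_pos.mpr hx).le _) (integral_abs_nonneg hx.le _)
  have hI2 : 0 ≤ (y₁ - y₀) ^ r * ∫ t in y₀..y₁, ∫ s in x₀..x₁, |H (r + 1) s t| :=
    mul_nonneg (pow_nonneg (sub_pos.mpr hy).le _)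
      (intervalIntegral.integral_nonneg hy.le fun _ _ => integral_abs_nonneg hx.le _)
  have h4 := h2.trans (mul_le_mul_of_nonneg_left h3 hg)
  refine (add_le_add h1 h4).trans ?_
  have e1 := mul_nonneg hK0 hI1
  have e2 := mul_nonneg hg e1
  have e3 := mul_nonneg hg hI2
  have e4 := mul_nonneg hK0 hI2
  nlinarith

lemma abs_integral_sub_interval_le {f g : ℝ → ℝ} (hf : Continuous f) (hg : Continuous g)
    {lo hi p q : ℝ} (h1 : lo ≤ p) (h2 : p ≤ q) (h3 : q ≤ hi)
    (hfg : ∀ t ∈ Set.Icc lo hi, |f t| ≤ g t) :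
    |∫ t in p..q, f t| ≤ ∫ t in lo..hi, g t := by
  refine (intervalIntegral.abs_integral_le_integral_abs h2).trans ?_
  refine (intervalIntegral.integral_mono_interval h1 h2 h3
    (Filter.Eventually.of_forall fun _ => abs_nonneg _) (hf.abs.intervalIntegrable _ _)).trans ?_
  exact intervalIntegral.integral_mono_on (h1.trans (h2.trans h3)) (hf.abs.intervalIntegrable _ _)
    (hg.intervalIntegrable _ _) hfg

/-- Error, integrated over a piece of a Gauss line, of the `x`-derivative of Lobatto
interpolation. -/
lemma exists_mul_sq_integral_sub_le {r : ℕ} {G L : ℕ → ℝ} (hr : 1 ≤ r)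
    (hG : IsGaussPoints r G) (hL : IsLobattoPoints r L) :
    ∃ C : ℝ, 0 ≤ C ∧ ∀ (F H : ℕ → ℝ → ℝ → ℝ) (D : ℝ → ℝ → ℝ),
      (∀ i ≤ r + 1, ∀ s t, HasDerivAt (fun s => F i s t) (F (i + 1) s t) s) →
      (∀ i ≤ r, ∀ s t, HasDerivAt (fun t => H i s t) (H (i + 1) s t) t) →
      H 0 = F 1 → Continuous (F 1).uncurry →
      Continuous (F (r + 2)).uncurry → Continuous (H (r + 1)).uncurry → Continuous D.uncurry →
      ∀ x₀ x₁ y₀ y₁ h : ℝ, x₀ < x₁ → y₀ < y₁ → x₁ - x₀ ≤ h → y₁ - y₀ ≤ h →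
      (∀ ξ η, (x₁ - x₀) / 2 * D (aff x₀ x₁ ξ) (aff y₀ y₁ η) =
        interpDx r L (fun a b => F 0 (aff x₀ x₁ (L a)) (aff y₀ y₁ (L b))) ξ η) →
      ∀ k ∈ Finset.Icc 1 r, ∀ p q : ℝ, y₀ ≤ p → p ≤ q → q ≤ y₁ →
      (x₁ - x₀) * (∫ t in p..q, (D (aff x₀ x₁ (G k)) t - F 1 (aff x₀ x₁ (G k)) t)) ^ 2 ≤
        C * (h ^ (r + 1)) ^ 2 * (y₁ - y₀) * ((∫ t in y₀..y₁, ∫ s in x₀..x₁, F (r + 2) s t ^ 2) +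
          ∫ t in y₀..y₁, ∫ s in x₀..x₁, H (r + 1) s t ^ 2) := by
  obtain ⟨K, hK0, hK⟩ := exists_abs_deriv_sub_interpDx_le hr hG hL
  refine ⟨8 * K ^ 2, by positivity, ?_⟩
  intro F H D hF hH hHF hF1 hFc hHc hDc x₀ x₁ y₀ y₁ h hx hy hxh hyh hD k hk p q hp hpq hq
  have hx' : 0 < x₁ - x₀ := sub_pos.mpr hx
  have hy' : 0 < y₁ - y₀ := sub_pos.mpr hy
  set I₁ := ∫ t in y₀..y₁, ∫ s in x₀..x₁, |F (r + 2) s t| with hI₁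
  set I₂ := ∫ t in y₀..y₁, ∫ s in x₀..x₁, |H (r + 1) s t| with hI₂
  set e := ∫ t in p..q, (D (aff x₀ x₁ (G k)) t - F 1 (aff x₀ x₁ (G k)) t) with he
  have hFa : Continuous (Function.uncurry fun t s => |F (r + 2) s t|) :=
    (hFc.comp continuous_swap).abs
  have hFi : Continuous fun t => ∫ s in x₀..x₁, |F (r + 2) s t| :=
    intervalIntegral.continuous_parametric_intervalIntegral_of_continuous' hFa _ _
  have hDl : Continuous fun t => D (aff x₀ x₁ (G k)) t :=
    hDc.comp (continuous_const.prodMk continuous_id)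
  have hFl : Continuous fun t => F 1 (aff x₀ x₁ (G k)) t :=
    hF1.comp (continuous_const.prodMk continuous_id)
  have hI₁0 : 0 ≤ I₁ :=
    intervalIntegral.integral_nonneg hy.le fun _ _ => integral_abs_nonneg hx.le _
  have hI₂0 : 0 ≤ I₂ :=
    intervalIntegral.integral_nonneg hy.le fun _ _ => integral_abs_nonneg hx.le _
  have hbound : |(x₁ - x₀) / 2 * e| ≤
      K * ((x₁ - x₀) ^ (r + 1) * I₁ + (y₁ - y₀) ^ (r + 1) * I₂) := by
    have hcont : Continuous fun t => K * ((x₁ - x₀) ^ (r + 1) * (∫ s in x₀..x₁, |F (r + 2) s t|) +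
        (y₁ - y₀) ^ r * I₂) := ((hFi.const_mul _).add continuous_const).const_mul _
    have hintegral : ∫ t in y₀..y₁, K * ((x₁ - x₀) ^ (r + 1) * (∫ s in x₀..x₁, |F (r + 2) s t|) +
        (y₁ - y₀) ^ r * I₂) = K * ((x₁ - x₀) ^ (r + 1) * I₁ + (y₁ - y₀) ^ (r + 1) * I₂) := by
      rw [intervalIntegral.integral_const_mul, intervalIntegral.integral_add
        ((hFi.const_mul _).intervalIntegrable _ _) (continuous_const.intervalIntegrable _ _),
        intervalIntegral.integral_const_mul, intervalIntegral.integral_const, smul_eq_mul]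
      ring
    rw [← hintegral, he, ← intervalIntegral.integral_const_mul]
    refine abs_integral_sub_interval_le ((hDl.sub hFl).const_mul _) hcont hp hpq hq fun t ht => ?_
    obtain ⟨η, hη, rfl⟩ : ∃ η ∈ Set.Icc (-1 : ℝ) 1, aff y₀ y₁ η = t := by
      refine ⟨(2 * t - (y₀ + y₁)) / (y₁ - y₀), ⟨?_, ?_⟩, ?_⟩
      · rw [le_div_iff₀ hy']; linarith [ht.1]
      · rw [div_le_iff₀ hy']; linarith [ht.2]
      · unfold aff; field_simp; ring
    have := hK F H hF hH hHF hF1 hFc hHc x₀ x₁ y₀ y₁ hx hy k hk η hη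
    rw [← hD, abs_sub_comm, ← mul_sub] at this
    exact this
  have hh : 0 ≤ h := hx'.le.trans hxh
  have hb2 : |(x₁ - x₀) / 2 * e| ≤ K * (h ^ (r + 1) * (I₁ + I₂)) := by
    refine hbound.trans (mul_le_mul_of_nonneg_left ?_ hK0)
    rw [mul_add]
    gcongr
  have hsq : ((x₁ - x₀) / 2 * e) ^ 2 ≤ (K * (h ^ (r + 1) * (I₁ + I₂))) ^ 2 := by
    rw [← sq_abs]
    exact pow_le_pow_left₀ (abs_nonneg _) hb2 2
  have hc1 := sq_integral_integral_abs_le hFc hx hy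
  have hc2 := sq_integral_integral_abs_le hHc hx hy
  set S := ∫ t in y₀..y₁, ∫ s in x₀..x₁, F (r + 2) s t ^ 2
  set T := ∫ t in y₀..y₁, ∫ s in x₀..x₁, H (r + 1) s t ^ 2
  have hsum : (I₁ + I₂) ^ 2 ≤ 2 * ((y₁ - y₀) * ((x₁ - x₀) * (S + T))) := by
    nlinarith [sq_nonneg (I₁ - I₂)]
  have hfin : (x₁ - x₀) * ((x₁ - x₀) * e ^ 2) ≤
      (x₁ - x₀) * (8 * K ^ 2 * (h ^ (r + 1)) ^ 2 * (y₁ - y₀) * (S + T)) := by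
    have := mul_le_mul_of_nonneg_left hsum
      (show 0 ≤ 4 * (K ^ 2 * (h ^ (r + 1)) ^ 2) by positivity)
    nlinarith
  exact (le_of_mul_le_mul_left hfin hx')

/-- Consistency error on one cell. -/
lemma exists_abs_sum_dualJump_sub_le {r : ℕ} {G L : ℕ → ℝ} (hr : 1 ≤ r)
    (hG : IsGaussPoints r G) (hL : IsLobattoPoints r L) :
    ∃ C : ℝ, 0 ≤ C ∧ ∀ (F H : ℕ → ℝ → ℝ → ℝ) (D D' : ℝ → ℝ → ℝ) (V : ℕ → ℕ → ℝ),
      (∀ i ≤ r + 1, ∀ s t, HasDerivAt (fun s => F i s t) (F (i + 1) s t) s) →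
      (∀ i ≤ r, ∀ s t, HasDerivAt (fun t => H i s t) (H (i + 1) s t) t) →
      H 0 = F 1 → Continuous (F 1).uncurry →
      Continuous (F (r + 2)).uncurry → Continuous (H (r + 1)).uncurry → Continuous D.uncurry →
      ∀ x₀ x₁ y₀ y₁ h : ℝ, x₀ < x₁ → y₀ < y₁ → x₁ - x₀ ≤ h → y₁ - y₀ ≤ h →
      (∀ ξ η, (x₁ - x₀) / 2 * D (aff x₀ x₁ ξ) (aff y₀ y₁ η) =
        interpDx r L (fun a b => F 0 (aff x₀ x₁ (L a)) (aff y₀ y₁ (L b))) ξ η) →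
      (∀ ξ η, (x₁ - x₀) / 2 * D' (aff x₀ x₁ ξ) (aff y₀ y₁ η) = interpDx r L V ξ η) →
      |∑ k ∈ Finset.Icc 1 r, ∑ l ∈ Finset.range (r + 1), dualJump r G L V k l *
        ∫ t in aff y₀ y₁ (gaussExt r G l)..aff y₀ y₁ (gaussExt r G (l + 1)),
          (D (aff x₀ x₁ (G k)) t - F 1 (aff x₀ x₁ (G k)) t)| ≤
        C * h ^ (r + 1) * (Real.sqrt ((∫ t in y₀..y₁, ∫ s in x₀..x₁, F (r + 2) s t ^ 2) +
          ∫ t in y₀..y₁, ∫ s in x₀..x₁, H (r + 1) s t ^ 2) *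
          Real.sqrt (∫ t in y₀..y₁, ∫ s in x₀..x₁, D' s t ^ 2)) := by
  obtain ⟨K, hK0, hK⟩ := exists_mul_sq_integral_sub_le hr hG hL
  obtain ⟨M, hM0, hM⟩ := exists_dualJump_sq_mul_le hr hG hL
  refine ⟨∑ _k ∈ Finset.Icc 1 r, ∑ _l ∈ Finset.range (r + 1), Real.sqrt (M * K),
    by positivity, ?_⟩
  intro F H D D' V hF hH hHF hF1 hFc hHc hDc x₀ x₁ y₀ y₁ h hx hy hxh hyh hD hD'
  have hx' : 0 < x₁ - x₀ := sub_pos.mpr hx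
  have hy' : 0 < y₁ - y₀ := sub_pos.mpr hy
  have hh : 0 ≤ h := hx'.le.trans hxh
  set S := (∫ t in y₀..y₁, ∫ s in x₀..x₁, F (r + 2) s t ^ 2) +
          ∫ t in y₀..y₁, ∫ s in x₀..x₁, H (r + 1) s t ^ 2
  set E := ∫ t in y₀..y₁, ∫ s in x₀..x₁, D' s t ^ 2
  have hS : 0 ≤ S := add_nonneg
    (intervalIntegral.integral_nonneg hy.le fun _ _ =>
      intervalIntegral.integral_nonneg hx.le fun _ _ => sq_nonneg _)
    (intervalIntegral.integral_nonneg hy.le fun _ _ =>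
      intervalIntegral.integral_nonneg hx.le fun _ _ => sq_nonneg _)
  have hE : 0 ≤ E := intervalIntegral.integral_nonneg hy.le fun _ _ =>
      intervalIntegral.integral_nonneg hx.le fun _ _ => sq_nonneg _
  rw [Finset.sum_mul, Finset.sum_mul]
  refine (Finset.abs_sum_le_sum_abs _ _).trans (Finset.sum_le_sum fun k hk => ?_)
  rw [Finset.sum_mul, Finset.sum_mul]
  refine (Finset.abs_sum_le_sum_abs _ _).trans (Finset.sum_le_sum fun l hl => ?_)
  have hl' : l ≤ r := Nat.lt_succ_iff.mp (Finset.mem_range.mp hl)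
  have hJ := hM V D' x₀ x₁ y₀ y₁ hx hy hD' k hk l hl
  have he := hK F H D hF hH hHF hF1 hFc hHc hDc x₀ x₁ y₀ y₁ h hx hy hxh hyh hD k hk
    (aff y₀ y₁ (gaussExt r G l)) (aff y₀ y₁ (gaussExt r G (l + 1)))
    (aff_mem hy.le (gaussExt_mem hG (by omega))).1 (aff_lt_aff hy (gaussExt_lt_succ hr hG hl')).le
    (aff_mem hy.le (gaussExt_mem hG (by omega))).2
  set J := dualJump r G L V k l
  set e := ∫ t in aff y₀ y₁ (gaussExt r G l)..aff y₀ y₁ (gaussExt r G (l + 1)),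
          (D (aff x₀ x₁ (G k)) t - F 1 (aff x₀ x₁ (G k)) t)
  have hprod : (J * e) ^ 2 ≤ M * K * (h ^ (r + 1)) ^ 2 * (S * E) := by
    refine le_of_mul_le_mul_left ?_ (mul_pos hx' hy')
    have := mul_le_mul hJ he (mul_nonneg hx'.le (sq_nonneg _)) (by positivity)
    nlinarith
  rw [← Real.sqrt_sq_eq_abs]
  refine (Real.sqrt_le_sqrt hprod).trans (le_of_eq ?_)
  rw [Real.sqrt_mul (by positivity), Real.sqrt_mul (by positivity), Real.sqrt_sq (by positivity),
    Real.sqrt_mul hS]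

lemma hasDerivAt_pdx {f : ℝ × ℝ → ℝ} (hf : Differentiable ℝ f) (s t : ℝ) :
    HasDerivAt (fun s => f (s, t)) (pdx f (s, t)) s :=
  (hf (s, t)).hasFDerivAt.comp_hasDerivAt s ((hasDerivAt_id s).prodMk (hasDerivAt_const s t))

lemma hasDerivAt_pdy {f : ℝ × ℝ → ℝ} (hf : Differentiable ℝ f) (s t : ℝ) :
    HasDerivAt (fun t => f (s, t)) (pdy f (s, t)) t :=
  (hf (s, t)).hasFDerivAt.comp_hasDerivAt t ((hasDerivAt_const t s).prodMk (hasDerivAt_id t))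

lemma contDiff_pdx {f : ℝ × ℝ → ℝ} {n : ℕ} (hf : ContDiff ℝ (n + 1 : ℕ) f) :
    ContDiff ℝ n (pdx f) := by
  have := hf.fderiv_right (m := (n : WithTop ℕ∞)) (by norm_cast)
  exact this.clm_apply contDiff_const

lemma contDiff_pdy {f : ℝ × ℝ → ℝ} {n : ℕ} (hf : ContDiff ℝ (n + 1 : ℕ) f) :
    ContDiff ℝ n (pdy f) := by
  have := hf.fderiv_right (m := (n : WithTop ℕ∞)) (by norm_cast)
  exact this.clm_apply contDiff_const

lemma contDiff_pdx_iterate {f : ℝ × ℝ → ℝ} {n : ℕ} (i : ℕ) (hf : ContDiff ℝ (n + i : ℕ) f) :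
    ContDiff ℝ n (pdx^[i] f) := by
  induction i generalizing f with
  | zero => exact hf
  | succ i ih => exact ih (contDiff_pdx hf)

lemma contDiff_pdy_iterate {f : ℝ × ℝ → ℝ} {n : ℕ} (i : ℕ) (hf : ContDiff ℝ (n + i : ℕ) f) :
    ContDiff ℝ n (pdy^[i] f) := by
  induction i generalizing f with
  | zero => exact hf
  | succ i ih => exact ih (contDiff_pdy hf)

lemma pdy_pdx_comm {f : ℝ × ℝ → ℝ} (hf : ContDiff ℝ 2 f) : pdy (pdx f) = pdx (pdy f) := by
  funext z
  have hd : DifferentiableAt ℝ (fderiv ℝ f) z :=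
    (hf.fderiv_right (m := 1) (by norm_cast)).differentiable (by simp) z
  have h : ∀ v w : ℝ × ℝ, fderiv ℝ (fun z => fderiv ℝ f z v) z w =
      fderiv ℝ (fderiv ℝ f) z w v := fun v w => by
    rw [fderiv_clm_apply hd (differentiableAt_const v)]
    simp
  have hsymm : IsSymmSndFDerivAt ℝ f z :=
    hf.contDiffAt.isSymmSndFDerivAt (by simp)
  have := hsymm.eq (0, 1) (1, 0)
  change fderiv ℝ (fun z => fderiv ℝ f z (1, 0)) z (0, 1) =
    fderiv ℝ (fun z => fderiv ℝ f z (0, 1)) z (1, 0)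
  rw [h, h, this]

lemma pdy_iterate_pdx_comm (n : ℕ) {f : ℝ × ℝ → ℝ} (hf : ContDiff ℝ (n + 1 : ℕ) f) :
    pdy^[n] (pdx f) = pdx (pdy^[n] f) := by
  induction n generalizing f with
  | zero => rfl
  | succ n ih =>
    rw [Function.iterate_succ_apply, Function.iterate_succ_apply,
      pdy_pdx_comm (hf.of_le (by norm_cast; omega)), ih (contDiff_pdy hf)]

/-- The tensor-product polynomial with nodal values `V` on the reference cell. -/
noncomputable def interpXY (r : ℕ) (L : ℕ → ℝ) (V : ℕ → ℕ → ℝ) (ξ η : ℝ) : ℝ :=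
  ∑ a ∈ Finset.range (r + 1), ∑ b ∈ Finset.range (r + 1),
    V a b * (lobB r L a).eval ξ * (lobB r L b).eval η

lemma eval_aff_eq_sum {r : ℕ} {L : ℕ → ℝ} (hL : IsLobattoPoints r L) {p : ℝ[X]}
    (hp : p.natDegree ≤ r) (lo hi ξ : ℝ) : p.eval (aff lo hi ξ) =
      ∑ a ∈ Finset.range (r + 1), p.eval (aff lo hi (L a)) * (lobB r L a).eval ξ := by
  obtain ⟨q, hqn, hq, -⟩ := exists_polynomial_aff lo hi p
  have := congrArg (eval ξ) (eq_sum_lobB hL (hqn.trans hp))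
  rw [eval_finsetSum] at this
  simpa [hq] using this

/-- The nodal values on the cell `[x₀, x₁] × [y₀, y₁]`. -/
noncomputable def nodal (L : ℕ → ℝ) (x₀ x₁ y₀ y₁ : ℝ) (f : ℝ × ℝ → ℝ) (a b : ℕ) : ℝ :=
  f (aff x₀ x₁ (L a), aff y₀ y₁ (L b))

lemma evalXY_eq_sum (p : ℝ[X][X]) (x y : ℝ) :
    evalXY p x y = p.sum fun k c => c.eval y * x ^ k := by
  rw [evalXY, eval_map, eval₂_eq_sum]
  rfl

lemma IsBiPoly.eq_interpXY {r : ℕ} {L : ℕ → ℝ} (hL : IsLobattoPoints r L) {f : ℝ × ℝ → ℝ}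
    (hf : IsBiPoly r f) (x₀ x₁ y₀ y₁ ξ η : ℝ) :
    f (aff x₀ x₁ ξ, aff y₀ y₁ η) = interpXY r L (nodal L x₀ x₁ y₀ y₁ f) ξ η := by
  obtain ⟨p, hp, hpc, hfp⟩ := hf
  have hX : ∀ ξ y, f (aff x₀ x₁ ξ, y) =
      ∑ a ∈ Finset.range (r + 1), f (aff x₀ x₁ (L a), y) * (lobB r L a).eval ξ := fun ξ y => by
    simp only [hfp, evalXY]
    exact eval_aff_eq_sum hL (natDegree_map_le.trans hp) _ _ _
  have hY : ∀ x η, f (x, aff y₀ y₁ η) =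
      ∑ b ∈ Finset.range (r + 1), f (x, aff y₀ y₁ (L b)) * (lobB r L b).eval η := fun x η => by
    have hq : ∀ y, f (x, y) = (p.sum fun k c => C (x ^ k) * c).eval y := fun y => by
      rw [hfp, evalXY_eq_sum, Polynomial.sum, Polynomial.sum, eval_finsetSum]
      exact Finset.sum_congr rfl fun k _ => by rw [eval_mul, eval_C, mul_comm]
    simp only [hq]
    refine eval_aff_eq_sum hL ?_ _ _ _
    exact natDegree_sum_le_of_forall_le _ _ fun k _ => (natDegree_C_mul_le _ _).trans (hpc k)
  rw [hX, interpXY]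
  refine Finset.sum_congr rfl fun a _ => ?_
  rw [hY, Finset.sum_mul]
  exact Finset.sum_congr rfl fun b _ => by rw [nodal]; ring

lemma IsBiPoly.contDiff {r : ℕ} {f : ℝ × ℝ → ℝ} (hf : IsBiPoly r f) (n : ℕ) : ContDiff ℝ n f := by
  obtain ⟨p, -, -, hfp⟩ := hf
  have : f = fun z => ∑ k ∈ p.support, (p.coeff k).eval z.2 * z.1 ^ k := by
    funext z
    rw [← Prod.mk.eta (p := z), hfp, evalXY_eq_sum, Polynomial.sum]
  rw [this]
  refine ContDiff.sum fun k _ => ContDiff.mul ?_ (contDiff_fst.pow k)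
  have h := (p.coeff k).contDiff_aeval (𝕜 := ℝ) n
  simp only [coe_aeval_eq_eval] at h
  exact h.comp contDiff_snd

lemma hasDerivAt_aff (lo hi ξ : ℝ) : HasDerivAt (aff lo hi) ((hi - lo) / 2) ξ := by
  have := ((hasDerivAt_id ξ).const_mul ((hi - lo) / 2)).const_add ((lo + hi) / 2)
  rw [mul_one] at this
  exact this

lemma pdx_of_eq_interpXY {r : ℕ} {L : ℕ → ℝ} {f : ℝ × ℝ → ℝ} (hf : Differentiable ℝ f)
    {V : ℕ → ℕ → ℝ} {x₀ x₁ y₀ y₁ : ℝ}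
    (h : ∀ ξ η, f (aff x₀ x₁ ξ, aff y₀ y₁ η) = interpXY r L V ξ η) (ξ η : ℝ) :
    (x₁ - x₀) / 2 * pdx f (aff x₀ x₁ ξ, aff y₀ y₁ η) = interpDx r L V ξ η := by
  have h1 := (hasDerivAt_pdx hf (aff x₀ x₁ ξ) (aff y₀ y₁ η)).comp ξ (hasDerivAt_aff x₀ x₁ ξ)
  have h2 : HasDerivAt (fun ξ => interpXY r L V ξ η) (interpDx r L V ξ η) ξ := by
    unfold interpXY interpDx
    exact HasDerivAt.fun_sum fun a _ => HasDerivAt.fun_sum fun b _ =>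
      (((lobB r L a).hasDerivAt ξ).const_mul _).mul_const _
  have h3 : (fun ξ => interpXY r L V ξ η) =
      (fun s => f (s, aff y₀ y₁ η)) ∘ aff x₀ x₁ := by
    funext ξ
    exact (h ξ η).symm
  rw [h3] at h2
  rw [mul_comm]
  exact h1.unique h2

lemma pdy_of_eq_interpXY {r : ℕ} {L : ℕ → ℝ} {f : ℝ × ℝ → ℝ} (hf : Differentiable ℝ f)
    {V : ℕ → ℕ → ℝ} {x₀ x₁ y₀ y₁ : ℝ}
    (h : ∀ ξ η, f (aff x₀ x₁ ξ, aff y₀ y₁ η) = interpXY r L V ξ η) (η ξ : ℝ) :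
    (y₁ - y₀) / 2 * pdy f (aff x₀ x₁ ξ, aff y₀ y₁ η) = interpDx r L (fun b a => V a b) η ξ := by
  have h1 := (hasDerivAt_pdy hf (aff x₀ x₁ ξ) (aff y₀ y₁ η)).comp η (hasDerivAt_aff y₀ y₁ η)
  have h2 : HasDerivAt (fun η => interpXY r L V ξ η) (interpDx r L (fun b a => V a b) η ξ) η := by
    unfold interpXY interpDx
    rw [Finset.sum_comm]
    refine (HasDerivAt.fun_sum fun a _ => HasDerivAt.fun_sum fun b _ =>
      ((lobB r L b).hasDerivAt η).const_mul _).congr_deriv ?_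
    exact Finset.sum_congr rfl fun b _ => Finset.sum_congr rfl fun a _ => by ring
  have h3 : (fun η => interpXY r L V ξ η) =
      (fun t => f (aff x₀ x₁ ξ, t)) ∘ aff y₀ y₁ := by
    funext η
    exact (h ξ η).symm
  rw [h3] at h2
  rw [mul_comm]
  exact h1.unique h2

/-- The part of the finite volume bilinear form living on one cell. -/
noncomputable def cellForm (r : ℕ) (G : ℕ → ℝ) (x₀ x₁ y₀ y₁ : ℝ) (Jx Jy : ℕ → ℕ → ℝ)
    (Dx Dy : ℝ × ℝ → ℝ) : ℝ :=
  (∑ k ∈ Finset.Icc 1 r, ∑ l ∈ Finset.range (r + 1), Jx k l *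
    ∫ t in aff y₀ y₁ (gaussExt r G l)..aff y₀ y₁ (gaussExt r G (l + 1)),
      Dx (aff x₀ x₁ (G k), t)) +
  ∑ k ∈ Finset.range (r + 1), ∑ l ∈ Finset.Icc 1 r, Jy k l *
    ∫ s in aff x₀ x₁ (gaussExt r G k)..aff x₀ x₁ (gaussExt r G (k + 1)),
      Dy (s, aff y₀ y₁ (G l))

/-- The jumps across the horizontal Gauss lines of the dual function with nodal values `V`. -/
noncomputable def dualJumpY (r : ℕ) (G L : ℕ → ℝ) (V : ℕ → ℕ → ℝ) (k l : ℕ) : ℝ :=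
  dualJump r G L (fun b a => V a b) l k

lemma setIntegral_prod_eq_swap {f : ℝ × ℝ → ℝ} (hf : Continuous f) {x₀ x₁ y₀ y₁ : ℝ}
    (hx : x₀ ≤ x₁) (hy : y₀ ≤ y₁) : ∫ z in Set.Icc x₀ x₁ ×ˢ Set.Icc y₀ y₁, f z =
      ∫ t in y₀..y₁, ∫ s in x₀..x₁, f (s, t) := by
  rw [setIntegral_prod_eq hf hx hy]
  exact integral_swap_of_continuous (f := fun s t => f (s, t)) hf _ _ _ _

lemma integrableOn_rect {f : ℝ × ℝ → ℝ} (hf : Continuous f) (x₀ x₁ y₀ y₁ : ℝ) :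
    IntegrableOn f (Set.Icc x₀ x₁ ×ˢ Set.Icc y₀ y₁) :=
  hf.continuousOn.integrableOn_compact (isCompact_Icc.prod isCompact_Icc)

lemma continuous_pdx {f : ℝ × ℝ → ℝ} (hf : ContDiff ℝ 1 f) : Continuous (pdx f) :=
  (contDiff_pdx (n := 0) hf).continuous

lemma continuous_pdy {f : ℝ × ℝ → ℝ} (hf : ContDiff ℝ 1 f) : Continuous (pdy f) :=
  (contDiff_pdy (n := 0) hf).continuous

lemma setIntegral_grad_sq_le_cellForm {r : ℕ} {G L : ℕ → ℝ} (hr : 1 ≤ r)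
    (hG : IsGaussPoints r G) (hL : IsLobattoPoints r L) {f : ℝ × ℝ → ℝ} (hf : ContDiff ℝ 1 f)
    {V : ℕ → ℕ → ℝ} {x₀ x₁ y₀ y₁ : ℝ} (hx : x₀ < x₁) (hy : y₀ < y₁)
    (h : ∀ ξ η, f (aff x₀ x₁ ξ, aff y₀ y₁ η) = interpXY r L V ξ η) :
    ∫ z in Set.Icc x₀ x₁ ×ˢ Set.Icc y₀ y₁, (pdx f z ^ 2 + pdy f z ^ 2) ≤
      cellForm r G x₀ x₁ y₀ y₁ (dualJump r G L V) (dualJumpY r G L V) (pdx f) (pdy f) := by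
  have hd : Differentiable ℝ f := hf.differentiable (by simp)
  have hcx : Continuous fun z => pdx f z ^ 2 := (continuous_pdx hf).pow 2
  have hcy : Continuous fun z => pdy f z ^ 2 := (continuous_pdy hf).pow 2
  rw [integral_add (integrableOn_rect hcx _ _ _ _) (integrableOn_rect hcy _ _ _ _),
    setIntegral_prod_eq_swap hcx hx.le hy.le, setIntegral_prod_eq hcy hx.le hy.le]
  refine add_le_add ?_ ?_
  · exact integral_sq_le_sum_dualJump hr hG hL (D := fun s t => pdx f (s, t)) hx hy
      (pdx_of_eq_interpXY hd h)
  · rw [Finset.sum_comm]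
    exact integral_sq_le_sum_dualJump hr hG hL (D := fun s t => pdy f (t, s)) hy hx
      (pdy_of_eq_interpXY hd h)

lemma add_le_sum_of_mem {s : Finset ℕ} {g : ℕ → ℝ} (hg : ∀ i ∈ s, 0 ≤ g i) {i j : ℕ} (hi : i ∈ s)
    (hj : j ∈ s) (hij : i ≠ j) : g i + g j ≤ ∑ i ∈ s, g i := by
  rw [← Finset.sum_pair hij]
  refine Finset.sum_le_sum_of_subset_of_nonneg ?_ fun i hi _ => hg i hi
  intro a ha
  rcases Finset.mem_insert.mp ha with rfl | h
  · exact hi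
  · rwa [Finset.mem_singleton.mp h]

/-- The cellwise consistency error of Lobatto interpolation in the bilinear form. -/
lemma exists_abs_cellForm_sub_le {r : ℕ} {G L : ℕ → ℝ} (hr : 1 ≤ r)
    (hG : IsGaussPoints r G) (hL : IsLobattoPoints r L) :
    ∃ C : ℝ, 0 < C ∧ ∀ (u p f : ℝ × ℝ → ℝ) (V : ℕ → ℕ → ℝ) (x₀ x₁ y₀ y₁ h : ℝ),
      ContDiff ℝ (r + 2 : ℕ) u → ContDiff ℝ 1 p → ContDiff ℝ 1 f →
      x₀ < x₁ → y₀ < y₁ → x₁ - x₀ ≤ h → y₁ - y₀ ≤ h →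
      (∀ ξ η, p (aff x₀ x₁ ξ, aff y₀ y₁ η) = interpXY r L (nodal L x₀ x₁ y₀ y₁ u) ξ η) →
      (∀ ξ η, f (aff x₀ x₁ ξ, aff y₀ y₁ η) = interpXY r L V ξ η) →
      |cellForm r G x₀ x₁ y₀ y₁ (dualJump r G L V) (dualJumpY r G L V)
        (fun z => pdx p z - pdx u z) (fun z => pdy p z - pdy u z)| ≤
        C * h ^ (r + 1) * (Real.sqrt (∑ t ∈ Finset.range (r + 2 + 1),
          ∫ z in Set.Icc x₀ x₁ ×ˢ Set.Icc y₀ y₁, (pdx^[t] (pdy^[r + 2 - t] u) z) ^ 2) *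
          Real.sqrt (∫ z in Set.Icc x₀ x₁ ×ˢ Set.Icc y₀ y₁, (pdx f z ^ 2 + pdy f z ^ 2))) := by
  obtain ⟨K, hK0, hK⟩ := exists_abs_sum_dualJump_sub_le hr hG hL
  refine ⟨2 * K + 1, by positivity, ?_⟩
  intro u p f V x₀ x₁ y₀ y₁ h hu hp hf hx hy hxh hyh hpV hfV
  have hh : 0 ≤ h := (sub_pos.mpr hx).le.trans hxh
  have hdp : Differentiable ℝ p := hp.differentiable (by simp)
  have hdf : Differentiable ℝ f := hf.differentiable (by simp)
  have hcx : Continuous fun z => pdx f z ^ 2 := (continuous_pdx hf).pow 2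
  have hcy : Continuous fun z => pdy f z ^ 2 := (continuous_pdy hf).pow 2
  have hnn : ∀ g : ℝ × ℝ → ℝ, 0 ≤ ∫ z in Set.Icc x₀ x₁ ×ˢ Set.Icc y₀ y₁, g z ^ 2 := fun g =>
    integral_nonneg fun _ => sq_nonneg _
  set B := ∑ t ∈ Finset.range (r + 2 + 1),
    ∫ z in Set.Icc x₀ x₁ ×ˢ Set.Icc y₀ y₁, (pdx^[t] (pdy^[r + 2 - t] u) z) ^ 2 with hB
  have hpick := fun {i j : ℕ} => add_le_sum_of_mem (s := Finset.range (r + 2 + 1))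
    (g := fun t => ∫ z in Set.Icc x₀ x₁ ×ˢ Set.Icc y₀ y₁, (pdx^[t] (pdy^[r + 2 - t] u) z) ^ 2)
    (fun t _ => hnn _) (i := i) (j := j)
  set E := ∫ z in Set.Icc x₀ x₁ ×ˢ Set.Icc y₀ y₁, (pdx f z ^ 2 + pdy f z ^ 2) with hE
  have hEeq : E = (∫ z in Set.Icc x₀ x₁ ×ˢ Set.Icc y₀ y₁, pdx f z ^ 2) +
      ∫ z in Set.Icc x₀ x₁ ×ˢ Set.Icc y₀ y₁, pdy f z ^ 2 :=
    integral_add (integrableOn_rect hcx _ _ _ _) (integrableOn_rect hcy _ _ _ _)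
  have hxF : ∀ i ≤ r + 1, Differentiable ℝ (pdx^[i] u) := fun i hi =>
    (contDiff_pdx_iterate (n := 1) i (hu.of_le (by norm_cast; omega))).differentiable (by simp)
  have hyF : ∀ i ≤ r + 1, Differentiable ℝ (pdy^[i] u) := fun i hi =>
    (contDiff_pdy_iterate (n := 1) i (hu.of_le (by norm_cast; omega))).differentiable (by simp)
  have hu' : ContDiff ℝ (r + 1 + 1 : ℕ) u := hu
  have hpx : ContDiff ℝ (r + 1 : ℕ) (pdx u) := contDiff_pdx hu'
  have hpy : ContDiff ℝ (r + 1 : ℕ) (pdy u) := contDiff_pdy hu'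
  have hxH : ∀ i ≤ r, Differentiable ℝ (pdy^[i] (pdx u)) := fun i hi =>
    (contDiff_pdy_iterate (n := 1) i (hpx.of_le (by norm_cast; omega))).differentiable (by simp)
  have hyH : ∀ i ≤ r, Differentiable ℝ (pdx^[i] (pdy u)) := fun i hi =>
    (contDiff_pdx_iterate (n := 1) i (hpy.of_le (by norm_cast; omega))).differentiable (by simp)
  have hcFx : Continuous (pdx^[r + 2] u) :=
    (contDiff_pdx_iterate (n := 0) (r + 2) (by simpa using hu)).continuous
  have hcFy : Continuous (pdy^[r + 2] u) :=
    (contDiff_pdy_iterate (n := 0) (r + 2) (by simpa using hu)).continuous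
  have hcHx : Continuous (pdy^[r + 1] (pdx u)) :=
    (contDiff_pdy_iterate (n := 0) (r + 1) (by simpa using hpx)).continuous
  have hcHy : Continuous (pdx^[r + 1] (pdy u)) :=
    (contDiff_pdx_iterate (n := 0) (r + 1) (by simpa using hpy)).continuous
  have hqFx : Continuous fun z => pdx^[r + 2] u z ^ 2 := hcFx.pow 2
  have hqFy : Continuous fun z => pdy^[r + 2] u z ^ 2 := hcFy.pow 2
  have hqHx : Continuous fun z => pdy^[r + 1] (pdx u) z ^ 2 := hcHx.pow 2
  have hqHy : Continuous fun z => pdx^[r + 1] (pdy u) z ^ 2 := hcHy.pow 2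
  have hX := hK (fun i s t => pdx^[i] u (s, t)) (fun i s t => pdy^[i] (pdx u) (s, t))
    (fun s t => pdx p (s, t)) (fun s t => pdx f (s, t)) V
    (fun i hi s t => by
      rw [Function.iterate_succ_apply']
      exact hasDerivAt_pdx (hxF i hi) s t)
    (fun i hi s t => by
      rw [Function.iterate_succ_apply']
      exact hasDerivAt_pdy (hxH i hi) s t)
    rfl hpx.continuous hcFx hcHx (continuous_pdx hp) x₀ x₁ y₀ y₁ h hx hy hxh hyh
    (pdx_of_eq_interpXY hdp hpV) (pdx_of_eq_interpXY hdf hfV)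
  have hY := hK (fun i s t => pdy^[i] u (t, s)) (fun i s t => pdx^[i] (pdy u) (t, s))
    (fun s t => pdy p (t, s)) (fun s t => pdy f (t, s)) (fun b a => V a b)
    (fun i hi s t => by
      rw [Function.iterate_succ_apply']
      exact hasDerivAt_pdy (hyF i hi) t s)
    (fun i hi s t => by
      rw [Function.iterate_succ_apply']
      exact hasDerivAt_pdx (hyH i hi) t s)
    rfl (hpy.continuous.comp continuous_swap) (hcFy.comp continuous_swap)
    (hcHy.comp continuous_swap) ((continuous_pdy hp).comp continuous_swap)
    y₀ y₁ x₀ x₁ h hy hx hyh hxh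
    (pdy_of_eq_interpXY hdp hpV) (pdy_of_eq_interpXY hdf hfV)
  have hSX : (∫ t in y₀..y₁, ∫ s in x₀..x₁, pdx^[r + 2] u (s, t) ^ 2) +
      (∫ t in y₀..y₁, ∫ s in x₀..x₁, pdy^[r + 1] (pdx u) (s, t) ^ 2) ≤ B := by
    rw [← setIntegral_prod_eq_swap hqFx hx.le hy.le,
      ← setIntegral_prod_eq_swap hqHx hx.le hy.le, pdy_iterate_pdx_comm (r + 1) hu']
    have := hpick (i := r + 2) (j := 1) (by simp) (by simp) (by omega)
    simp only [Nat.sub_self, show r + 2 - 1 = r + 1 by omega] at this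
    exact this
  have hSY : (∫ t in x₀..x₁, ∫ s in y₀..y₁, pdy^[r + 2] u (t, s) ^ 2) +
      (∫ t in x₀..x₁, ∫ s in y₀..y₁, pdx^[r + 1] (pdy u) (t, s) ^ 2) ≤ B := by
    rw [← setIntegral_prod_eq hqFy hx.le hy.le,
      ← setIntegral_prod_eq hqHy hx.le hy.le]
    have := hpick (i := 0) (j := r + 1) (by simp) (by simp) (by omega)
    simp only [show r + 2 - (r + 1) = 1 by omega] at this
    exact this
  have hEX : ∫ t in y₀..y₁, ∫ s in x₀..x₁, pdx f (s, t) ^ 2 ≤ E := by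
    rw [← setIntegral_prod_eq_swap hcx hx.le hy.le, hEeq]
    linarith [hnn (pdy f)]
  have hEY : ∫ t in x₀..x₁, ∫ s in y₀..y₁, pdy f (t, s) ^ 2 ≤ E := by
    rw [← setIntegral_prod_eq hcy hx.le hy.le, hEeq]
    linarith [hnn (pdx f)]
  have hpow : 0 ≤ K * h ^ (r + 1) := by positivity
  have hX' := hX.trans (mul_le_mul_of_nonneg_left (mul_le_mul (Real.sqrt_le_sqrt hSX)
    (Real.sqrt_le_sqrt hEX) (Real.sqrt_nonneg _) (Real.sqrt_nonneg _)) hpow)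
  have hY' := hY.trans (mul_le_mul_of_nonneg_left (mul_le_mul (Real.sqrt_le_sqrt hSY)
    (Real.sqrt_le_sqrt hEY) (Real.sqrt_nonneg _) (Real.sqrt_nonneg _)) hpow)
  rw [Finset.sum_comm] at hY'
  refine (abs_add_le _ _).trans ((add_le_add hX' hY').trans ?_)
  have : 0 ≤ h ^ (r + 1) * (Real.sqrt B * Real.sqrt E) := by positivity
  nlinarith

lemma sum_Icc_shift {n : ℕ} (hn : 0 < n) {a b : ℕ → ℝ} (hb : b 1 = 0) (ha : a n = 0)
    (hab : ∀ j ∈ Finset.Icc 1 n, j ≠ n → b (j + 1) = a j) :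
    ∑ j ∈ Finset.Icc 1 n, a j = ∑ j ∈ Finset.Icc 1 n, b j := by
  obtain ⟨n, rfl⟩ := Nat.exists_eq_succ_of_ne_zero hn.ne'
  have hIcc : Finset.Icc 1 (n + 1) = (Finset.range (n + 1)).image (· + 1) := by
    ext j
    simp only [Finset.mem_Icc, Finset.mem_image, Finset.mem_range]
    exact ⟨fun h => ⟨j - 1, by omega, by omega⟩, by rintro ⟨i, hi, rfl⟩; omega⟩
  have hinj : Set.InjOn (· + 1) (Finset.range (n + 1) : Set ℕ) := fun _ _ _ _ h => by simpa using h
  rw [Nat.succ_eq_add_one] at *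
  rw [hIcc, Finset.sum_image hinj, Finset.sum_image hinj, Finset.sum_range_succ,
    Finset.sum_range_succ' (fun j => b (j + 1)), ha, zero_add, hb]
  congr 1
  refine Finset.sum_congr rfl fun j hj => ?_
  have := Finset.mem_range.mp hj
  exact (hab (j + 1) (Finset.mem_Icc.mpr ⟨by omega, by omega⟩) (by omega)).symm

/-- The Gauss points of a one-dimensional mesh, with the conventions of `RectPartition.gx`. -/
noncomputable def gaussPt (n : ℕ) (y : ℕ → ℝ) (r : ℕ) (G : ℕ → ℝ) (j l : ℕ) : ℝ :=
  if l = r + 1 then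
    (if j = n then y n else (y (j + 1) + y j + (y (j + 1) - y j) * G 1) / 2)
  else (y j + y (j - 1) + (y j - y (j - 1)) * G l) / 2

lemma gaussPt_of_le (n : ℕ) (y : ℕ → ℝ) {r : ℕ} (G : ℕ → ℝ) (j : ℕ) {l : ℕ} (hl : l ≤ r) :
    gaussPt n y r G j l = aff (y (j - 1)) (y j) (G l) := by
  rw [gaussPt, if_neg (by omega), aff]
  ring

lemma gaussPt_last_of_ne {n : ℕ} (y : ℕ → ℝ) (r : ℕ) (G : ℕ → ℝ) {j : ℕ} (hj : j ≠ n) :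
    gaussPt n y r G j (r + 1) = aff (y j) (y (j + 1)) (G 1) := by
  rw [gaussPt, if_pos rfl, if_neg hj, aff]
  ring

lemma gaussPt_last_self (n : ℕ) (y : ℕ → ℝ) (r : ℕ) (G : ℕ → ℝ) :
    gaussPt n y r G n (r + 1) = y n := by simp [gaussPt]

/-- A sum over dual intervals, split at the cell interfaces, regrouped cell by cell. -/
lemma sum_gaussPt_eq {n r : ℕ} (hn : 0 < n) (hr : 1 ≤ r) {G : ℕ → ℝ} (hG : IsGaussPoints r G)
    {y : ℕ → ℝ} (hy : ∀ j < n, y j < y (j + 1)) {c : ℕ → ℕ → ℝ} {J : ℕ → ℝ → ℝ → ℝ}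
    (hJ : ∀ j s, J j s s = 0) (hc0 : c 1 0 = 0) (hcn : c n r = 0)
    (hcs : ∀ j ∈ Finset.Icc 1 n, j ≠ n → c (j + 1) 0 = c j r) :
    ∑ j ∈ Finset.Icc 1 n, ∑ l ∈ Finset.Icc 1 r, c j l *
      (J j (gaussPt n y r G j l) (min (gaussPt n y r G j (l + 1)) (y j)) +
        J (j + 1) (y j) (max (gaussPt n y r G j (l + 1)) (y j))) =
    ∑ j ∈ Finset.Icc 1 n, ∑ l ∈ Finset.range (r + 1), c j l *
      J j (aff (y (j - 1)) (y j) (gaussExt r G l)) (aff (y (j - 1)) (y j) (gaussExt r G (l + 1))) := by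
  have hIoo : ∀ l ∈ Finset.Icc 1 r, G l ∈ Set.Ioo (-1 : ℝ) 1 := fun l hl =>
    (hG.2 l (Finset.mem_Icc.mp hl).1 (Finset.mem_Icc.mp hl).2).1
  have h1 : (1 : ℕ) ∈ Finset.Icc 1 r := by simp [hr]
  have hrm : r ∈ Finset.Icc 1 r := by simp [hr]
  have hcell : ∀ j ∈ Finset.Icc 1 n, y (j - 1) < y j := fun j hj => by
    have := Finset.mem_Icc.mp hj
    simpa [Nat.sub_add_cancel this.1] using hy (j - 1) (by omega)
  have hterm : ∀ j ∈ Finset.Icc 1 n, ∀ l ∈ Finset.Icc 1 r, c j l *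
      (J j (gaussPt n y r G j l) (min (gaussPt n y r G j (l + 1)) (y j)) +
        J (j + 1) (y j) (max (gaussPt n y r G j (l + 1)) (y j))) =
      c j l * J j (aff (y (j - 1)) (y j) (gaussExt r G l))
        (aff (y (j - 1)) (y j) (gaussExt r G (l + 1))) +
      if l = r then c j r * J (j + 1) (y j) (gaussPt n y r G j (r + 1)) else 0 := by
    intro j hj l hl
    have hl' := Finset.mem_Icc.mp hl
    rw [gaussPt_of_le n y G j hl'.2, gaussExt_of_mem hl]
    by_cases hlr : l = r
    · subst hlr
      have hge : y j ≤ gaussPt n y l G j (l + 1) := by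
        by_cases hjn : j = n
        · rw [hjn, gaussPt_last_self]
        · rw [gaussPt_last_of_ne y l G hjn]
          refine (aff_mem (hy j ?_).le ⟨(hIoo 1 h1).1.le, (hIoo 1 h1).2.le⟩).1
          have := Finset.mem_Icc.mp hj
          omega
      rw [if_pos rfl, min_eq_right hge, max_eq_left hge, gaussExt_last, aff_one]
      ring
    · have hl1 : l + 1 ∈ Finset.Icc 1 r := Finset.mem_Icc.mpr ⟨by omega, by omega⟩
      have hle : aff (y (j - 1)) (y j) (G (l + 1)) ≤ y j :=
        (aff_mem (hcell j hj).le ⟨(hIoo _ hl1).1.le, (hIoo _ hl1).2.le⟩).2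
      rw [if_neg hlr, gaussPt_of_le n y G j (Finset.mem_Icc.mp hl1).2, min_eq_left hle,
        max_eq_right hle, hJ, gaussExt_of_mem hl1]
      ring
  rw [Finset.sum_congr rfl fun j hj => Finset.sum_congr rfl (hterm j hj)]
  simp_rw [Finset.sum_add_distrib, Finset.sum_ite_eq', if_pos hrm]
  have hrange : ∀ g : ℕ → ℝ, ∑ l ∈ Finset.range (r + 1), g l = ∑ l ∈ Finset.Icc 1 r, g l + g 0 := by
    intro g
    rw [Finset.range_eq_Ico, Finset.sum_eq_sum_Ico_succ_bot (by omega), add_comm]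
    rfl
  simp_rw [hrange, Finset.sum_add_distrib]
  congr 1
  refine sum_Icc_shift hn (b := fun j => c j 0 * J j (aff (y (j - 1)) (y j) (gaussExt r G 0))
      (aff (y (j - 1)) (y j) (gaussExt r G (0 + 1)))) (by simp [hc0]) (by simp [hcn]) ?_
  intro j hj hjn
  rw [hcs j hj hjn, gaussPt_last_of_ne y r G hjn, gaussExt_zero, gaussExt_of_mem h1, aff_neg_one]
  rfl

section DualIndexing

variable {a b c d : ℝ} {P : RectPartition a b c d} {r : ℕ} {w : ℕ → ℕ → ℕ → ℕ → ℝ}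

lemma wE_one_zero_left (r : ℕ) (w : ℕ → ℕ → ℕ → ℕ → ℝ) (j l : ℕ) : wE r w 1 0 j l = 0 := by
  simp [wE]

lemma wE_one_zero_right (r : ℕ) (w : ℕ → ℕ → ℕ → ℕ → ℝ) (i k : ℕ) : wE r w i k 1 0 = 0 := by
  simp [wE]

lemma wE_succ_zero_left (hr : 1 ≤ r) (w : ℕ → ℕ → ℕ → ℕ → ℝ) {i : ℕ} (hi : 1 ≤ i) (j l : ℕ) :
    wE r w (i + 1) 0 j l = wE r w i r j l := by
  simp [wE, show r ≠ 0 by omega, show i ≠ 0 by omega]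

lemma wE_succ_zero_right (hr : 1 ≤ r) (w : ℕ → ℕ → ℕ → ℕ → ℝ) (i k : ℕ) {j : ℕ} (hj : 1 ≤ j) :
    wE r w i k (j + 1) 0 = wE r w i k j r := by
  simp [wE, show r ≠ 0 by omega, show j ≠ 0 by omega]

lemma wE_of_pos (r : ℕ) (w : ℕ → ℕ → ℕ → ℕ → ℝ) (i : ℕ) {k : ℕ} (j : ℕ) {l : ℕ} (hk : 1 ≤ k)
    (hl : 1 ≤ l) : wE r w i k j l = w i k j l := by
  simp [wE, show k ≠ 0 by omega, show l ≠ 0 by omega]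

lemma IsTestFun.wE_last_left (hr : 1 ≤ r) (hw : IsTestFun r P w) {j l : ℕ}
    (hj : j ∈ Finset.Icc 1 P.n) (hl : l ≤ r) : wE r w P.m r j l = 0 := by
  have hj' := Finset.mem_Icc.mp hj
  have hr0 : r ≠ 0 := by omega
  by_cases h : l = 0 ∧ j = 1
  · simp [wE, h]
  · rw [wE, if_neg (by omega), if_neg hr0, if_neg hr0]
    refine hw.1 _ (Finset.mem_Icc.mpr ⟨?_, ?_⟩) _ (Finset.mem_Icc.mpr ⟨?_, ?_⟩) <;>
      split_ifs <;> omega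

lemma IsTestFun.wE_last_right (hr : 1 ≤ r) (hw : IsTestFun r P w) {i k : ℕ}
    (hi : i ∈ Finset.Icc 1 P.m) (hk : k ≤ r) : wE r w i k P.n r = 0 := by
  have hi' := Finset.mem_Icc.mp hi
  have hr0 : r ≠ 0 := by omega
  by_cases h : k = 0 ∧ i = 1
  · simp [wE, h]
  · rw [wE, if_neg (by omega), if_neg hr0, if_neg hr0]
    refine hw.2 _ (Finset.mem_Icc.mpr ⟨?_, ?_⟩) _ (Finset.mem_Icc.mpr ⟨?_, ?_⟩) <;>
      split_ifs <;> omega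

end DualIndexing

section DualForms

variable {a b c d : ℝ} {P : RectPartition a b c d} {r : ℕ} {G : ℕ → ℝ}
  {w : ℕ → ℕ → ℕ → ℕ → ℝ}

lemma integral_dual_congr (hr : 1 ≤ r) (hG : IsGaussPoints r G) {lo hi : ℝ} (h : lo < hi) {l : ℕ}
    (hl : l ≤ r) {f g : ℝ → ℝ} (hfg : ∀ t ∈ Set.Ioo lo hi, f t = g t) :
    ∫ t in aff lo hi (gaussExt r G l)..aff lo hi (gaussExt r G (l + 1)), f t =
      ∫ t in aff lo hi (gaussExt r G l)..aff lo hi (gaussExt r G (l + 1)), g t := by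
  refine intervalIntegral.integral_congr_Ioo_of_le
    (aff_lt_aff h (gaussExt_lt_succ hr hG hl)).le fun t ht => hfg t ?_
  exact ⟨(aff_mem h.le (gaussExt_mem hG (by omega))).1.trans_lt ht.1,
    ht.2.trans_le (aff_mem h.le (gaussExt_mem hG (by omega))).2⟩

lemma aff_gauss_mem_Ioo (hG : IsGaussPoints r G) {lo hi : ℝ} (h : lo < hi) {k : ℕ}
    (hk : k ∈ Finset.Icc 1 r) : aff lo hi (G k) ∈ Set.Ioo lo hi := by
  have hGk := (hG.2 k (Finset.mem_Icc.mp hk).1 (Finset.mem_Icc.mp hk).2).1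
  have h1 := aff_lt_aff h hGk.1
  have h2 := aff_lt_aff h hGk.2
  rw [aff_neg_one] at h1
  rw [aff_one] at h2
  exact ⟨h1, h2⟩

lemma RectPartition.x_lt (P : RectPartition a b c d) {i : ℕ} (hi : i ∈ Finset.Icc 1 P.m) :
    P.x (i - 1) < P.x i := by
  have := Finset.mem_Icc.mp hi
  simpa [Nat.sub_add_cancel this.1] using P.hxlt (i - 1) (by omega)

lemma RectPartition.y_lt (P : RectPartition a b c d) {j : ℕ} (hj : j ∈ Finset.Icc 1 P.n) :
    P.y (j - 1) < P.y j := by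
  have := Finset.mem_Icc.mp hj
  simpa [Nat.sub_add_cancel this.1] using P.hylt (j - 1) (by omega)

lemma RectPartition.gx_eq_gaussPt (P : RectPartition a b c d) (r : ℕ) (G : ℕ → ℝ) (i k : ℕ) :
    P.gx r G i k = gaussPt P.m P.x r G i k := rfl

lemma RectPartition.gy_eq_gaussPt (P : RectPartition a b c d) (r : ℕ) (G : ℕ → ℝ) (j l : ℕ) :
    P.gy r G j l = gaussPt P.n P.y r G j l := rfl

lemma sum_idxX_eq (hr : 1 ≤ r) (hG : IsGaussPoints r G) (hw : IsTestFun r P w)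
    {F : ℕ → ℕ → ℝ × ℝ → ℝ} :
    ∑ q ∈ idxX r P, jumpX r w q.1 q.2.1 q.2.2.1 q.2.2.2 *
      ((∫ t in (P.gy r G q.2.2.1 q.2.2.2)..(min (P.gy r G q.2.2.1 (q.2.2.2 + 1)) (P.y q.2.2.1)),
          F q.1 q.2.2.1 (P.gx r G q.1 q.2.1, t)) +
       (∫ t in (P.y q.2.2.1)..(max (P.gy r G q.2.2.1 (q.2.2.2 + 1)) (P.y q.2.2.1)),
          F q.1 (q.2.2.1 + 1) (P.gx r G q.1 q.2.1, t))) =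
    ∑ i ∈ Finset.Icc 1 P.m, ∑ j ∈ Finset.Icc 1 P.n, ∑ k ∈ Finset.Icc 1 r,
      ∑ l ∈ Finset.range (r + 1), jumpX r w i k j l *
        ∫ t in aff (P.y (j - 1)) (P.y j) (gaussExt r G l)..
            aff (P.y (j - 1)) (P.y j) (gaussExt r G (l + 1)),
          F i j (aff (P.x (i - 1)) (P.x i) (G k), t) := by
  have hlast : ∀ i ∈ Finset.Icc 1 P.m, ∀ k ∈ Finset.Icc 1 r, jumpX r w i k P.n r = 0 := by
    intro i hi k hk
    have hk' := Finset.mem_Icc.mp hk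
    rw [jumpX, hw.wE_last_right hr hi hk'.2, hw.wE_last_right hr hi (by omega), sub_zero]
  rw [idxX, Finset.sum_filter_of_ne]
  · simp_rw [Finset.sum_product]
    refine Finset.sum_congr rfl fun i hi => ?_
    rw [Finset.sum_comm (s := Finset.Icc 1 P.n)]
    refine Finset.sum_congr rfl fun k hk => ?_
    simp_rw [P.gy_eq_gaussPt]
    rw [P.gx_eq_gaussPt, gaussPt_of_le _ _ _ _ (Finset.mem_Icc.mp hk).2]
    refine sum_gaussPt_eq P.hn hr hG P.hylt (c := fun j l => jumpX r w i k j l)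
      (J := fun j s t => ∫ t in s..t, F i j (aff (P.x (i - 1)) (P.x i) (G k), t))
      (fun j s => intervalIntegral.integral_same) ?_ (hlast i hi k hk) ?_
    · simp only [jumpX, wE_one_zero_right, sub_zero]
    · intro j hj _
      have hj1 := (Finset.mem_Icc.mp hj).1
      simp only [jumpX, wE_succ_zero_right hr w _ _ hj1]
  · rintro ⟨i, k, j, l⟩ hq hne ⟨h1, h2⟩
    simp only [Finset.mem_product] at hq h1 h2
    subst h1 h2
    exact hne (by rw [hlast i hq.1 k hq.2.1, zero_mul])

lemma sum_idxY_eq (hr : 1 ≤ r) (hG : IsGaussPoints r G) (hw : IsTestFun r P w)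
    {F : ℕ → ℕ → ℝ × ℝ → ℝ} :
    ∑ q ∈ idxY r P, jumpY r w q.1 q.2.1 q.2.2.1 q.2.2.2 *
      ((∫ t in (P.gx r G q.1 q.2.1)..(min (P.gx r G q.1 (q.2.1 + 1)) (P.x q.1)),
          F q.1 q.2.2.1 (t, P.gy r G q.2.2.1 q.2.2.2)) +
       (∫ t in (P.x q.1)..(max (P.gx r G q.1 (q.2.1 + 1)) (P.x q.1)),
          F (q.1 + 1) q.2.2.1 (t, P.gy r G q.2.2.1 q.2.2.2))) =
    ∑ i ∈ Finset.Icc 1 P.m, ∑ j ∈ Finset.Icc 1 P.n, ∑ k ∈ Finset.range (r + 1),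
      ∑ l ∈ Finset.Icc 1 r, jumpY r w i k j l *
        ∫ s in aff (P.x (i - 1)) (P.x i) (gaussExt r G k)..
            aff (P.x (i - 1)) (P.x i) (gaussExt r G (k + 1)),
          F i j (s, aff (P.y (j - 1)) (P.y j) (G l)) := by
  have hlast : ∀ j ∈ Finset.Icc 1 P.n, ∀ l ∈ Finset.Icc 1 r, jumpY r w P.m r j l = 0 := by
    intro j hj l hl
    have hl' := Finset.mem_Icc.mp hl
    rw [jumpY, hw.wE_last_left hr hj hl'.2, hw.wE_last_left hr hj (by omega), sub_zero]
  rw [idxY, Finset.sum_filter_of_ne]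
  · simp_rw [Finset.sum_product]
    rw [Finset.sum_congr rfl fun i _ => Finset.sum_comm,
      Finset.sum_comm (s := Finset.Icc 1 P.m), Finset.sum_comm (s := Finset.Icc 1 P.m)]
    refine Finset.sum_congr rfl fun j hj => ?_
    rw [Finset.sum_congr rfl fun i _ => Finset.sum_comm, Finset.sum_comm (s := Finset.Icc 1 P.m)]
    rw [Finset.sum_congr rfl fun i _ => Finset.sum_comm (s := Finset.range (r + 1)),
      Finset.sum_comm (s := Finset.Icc 1 P.m)]
    refine Finset.sum_congr rfl fun l hl => ?_
    simp_rw [P.gx_eq_gaussPt]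
    rw [P.gy_eq_gaussPt, gaussPt_of_le _ _ _ _ (Finset.mem_Icc.mp hl).2]
    refine sum_gaussPt_eq P.hm hr hG P.hxlt (c := fun i k => jumpY r w i k j l)
      (J := fun i s t => ∫ t in s..t, F i j (t, aff (P.y (j - 1)) (P.y j) (G l)))
      (fun j s => intervalIntegral.integral_same) ?_ (hlast j hj l hl) ?_
    · simp only [jumpY, wE_one_zero_left, sub_zero]
    · intro i hi _
      have hi1 := (Finset.mem_Icc.mp hi).1
      simp only [jumpY, wE_succ_zero_left hr w hi1]
  · rintro ⟨i, k, j, l⟩ hq hne ⟨h1, h2⟩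
    simp only [Finset.mem_product] at hq h1 h2
    subst h1 h2
    exact hne (by rw [hlast j hq.2.2.1 l hq.2.2.2, zero_mul])

/-- The finite volume bilinear form as a sum of cellwise forms. -/
lemma aP_eq_sum_cellForm (hr : 1 ≤ r) (hG : IsGaussPoints r G) (hw : IsTestFun r P w)
    {α : ℝ × ℝ → ℝ} {κ : ℕ → ℕ → ℝ}
    (hκ : ∀ i ∈ Finset.Icc 1 P.m, ∀ j ∈ Finset.Icc 1 P.n, ∀ z ∈ P.openCell i j, α z = κ i j)
    (Dx Dy : ℕ → ℕ → ℝ × ℝ → ℝ) :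
    aP r G P α Dx Dy w = ∑ i ∈ Finset.Icc 1 P.m, ∑ j ∈ Finset.Icc 1 P.n, κ i j *
      cellForm r G (P.x (i - 1)) (P.x i) (P.y (j - 1)) (P.y j)
        (fun k l => jumpX r w i k j l) (fun k l => jumpY r w i k j l) (Dx i j) (Dy i j) := by
  have hX := sum_idxX_eq hr hG hw (F := fun i j z => α z * Dx i j z)
  have hY := sum_idxY_eq hr hG hw (F := fun i j z => α z * Dy i j z)
  rw [aP, hX, hY]
  simp_rw [← Finset.sum_add_distrib]
  refine Finset.sum_congr rfl fun i hi => Finset.sum_congr rfl fun j hj => ?_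
  rw [cellForm, mul_add, Finset.mul_sum, Finset.mul_sum]
  congr 1
  · refine Finset.sum_congr rfl fun k hk => ?_
    rw [Finset.mul_sum]
    refine Finset.sum_congr rfl fun l hl => ?_
    rw [integral_dual_congr hr hG (P.y_lt hj) (Finset.mem_range_succ_iff.mp hl)
      (g := fun t => κ i j * Dx i j (aff (P.x (i - 1)) (P.x i) (G k), t))
      fun t ht => by rw [hκ i hi j hj _ ⟨aff_gauss_mem_Ioo hG (P.x_lt hi) hk, ht⟩],
      intervalIntegral.integral_const_mul]
    ring
  · refine Finset.sum_congr rfl fun k hk => ?_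
    rw [Finset.mul_sum]
    refine Finset.sum_congr rfl fun l hl => ?_
    rw [integral_dual_congr hr hG (P.x_lt hi) (Finset.mem_range_succ_iff.mp hk)
      (g := fun s => κ i j * Dy i j (s, aff (P.y (j - 1)) (P.y j) (G l)))
      fun t ht => by rw [hκ i hi j hj _ ⟨ht, aff_gauss_mem_Ioo hG (P.y_lt hj) hl⟩],
      intervalIntegral.integral_const_mul]
    ring

/-- The load functional regrouped cell by cell. -/
lemma sum_idxZ_eq (hr : 1 ≤ r) (hG : IsGaussPoints r G) (hw : IsTestFun r P w)
    (F : ℕ → ℕ → ℝ × ℝ → ℝ) :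
    ∑ q ∈ idxZ r P, w q.1 q.2.1 q.2.2.1 q.2.2.2 *
      dualCellInt r G P F q.1 q.2.1 q.2.2.1 q.2.2.2 =
    ∑ i ∈ Finset.Icc 1 P.m, ∑ j ∈ Finset.Icc 1 P.n, ∑ k ∈ Finset.range (r + 1),
      ∑ l ∈ Finset.range (r + 1), wE r w i k j l * rectInt (F i j)
        (aff (P.x (i - 1)) (P.x i) (gaussExt r G k))
        (aff (P.x (i - 1)) (P.x i) (gaussExt r G (k + 1)))
        (aff (P.y (j - 1)) (P.y j) (gaussExt r G l))
        (aff (P.y (j - 1)) (P.y j) (gaussExt r G (l + 1))) := by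
  rw [idxZ, Finset.sum_filter_of_ne]
  · simp_rw [Finset.sum_product]
    trans ∑ j ∈ Finset.Icc 1 P.n, ∑ l ∈ Finset.Icc 1 r, ∑ i ∈ Finset.Icc 1 P.m,
      ∑ k ∈ Finset.range (r + 1), wE r w i k j l *
        (rectInt (F i j) (aff (P.x (i - 1)) (P.x i) (gaussExt r G k))
          (aff (P.x (i - 1)) (P.x i) (gaussExt r G (k + 1)))
          (gaussPt P.n P.y r G j l) (min (gaussPt P.n P.y r G j (l + 1)) (P.y j)) +
        rectInt (F i (j + 1)) (aff (P.x (i - 1)) (P.x i) (gaussExt r G k))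
          (aff (P.x (i - 1)) (P.x i) (gaussExt r G (k + 1)))
          (P.y j) (max (gaussPt P.n P.y r G j (l + 1)) (P.y j)))
    · rw [Finset.sum_congr rfl fun i _ => Finset.sum_comm, Finset.sum_comm]
      refine Finset.sum_congr rfl fun j hj => ?_
      rw [Finset.sum_congr rfl fun i _ => Finset.sum_comm, Finset.sum_comm]
      refine Finset.sum_congr rfl fun l hl => ?_
      have hl' := Finset.mem_Icc.mp hl
      rw [← sum_gaussPt_eq P.hm hr hG P.hxlt (c := fun i k => wE r w i k j l)
        (J := fun i s t => rectInt (F i j) s t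
            (gaussPt P.n P.y r G j l) (min (gaussPt P.n P.y r G j (l + 1)) (P.y j)) +
          rectInt (F i (j + 1)) s t
            (P.y j) (max (gaussPt P.n P.y r G j (l + 1)) (P.y j)))
        (fun i s => by simp [rectInt]) (wE_one_zero_left _ _ _ _) (hw.wE_last_left hr hj hl'.2)
        (fun i hi _ => wE_succ_zero_left hr w (Finset.mem_Icc.mp hi).1 _ _)]
      refine Finset.sum_congr rfl fun i hi => Finset.sum_congr rfl fun k hk => ?_
      simp only [wE_of_pos r w i j (Finset.mem_Icc.mp hk).1 hl'.1, dualCellInt,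
        P.gx_eq_gaussPt, P.gy_eq_gaussPt]
      ring
    · rw [Finset.sum_congr rfl fun j _ => Finset.sum_comm, Finset.sum_comm]
      refine Finset.sum_congr rfl fun i hi => ?_
      rw [Finset.sum_congr rfl fun j _ => Finset.sum_comm, Finset.sum_comm,
        Finset.sum_comm (s := Finset.Icc 1 P.n)]
      refine Finset.sum_congr rfl fun k hk => ?_
      exact sum_gaussPt_eq P.hn hr hG P.hylt (c := fun j l => wE r w i k j l)
        (J := fun j s t => rectInt (F i j) (aff (P.x (i - 1)) (P.x i) (gaussExt r G k))
          (aff (P.x (i - 1)) (P.x i) (gaussExt r G (k + 1))) s t)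
        (fun j s => by simp [rectInt]) (wE_one_zero_right _ _ _ _)
        (hw.wE_last_right hr hi (Finset.mem_range_succ_iff.mp hk))
        (fun j hj _ => wE_succ_zero_right hr w _ _ (Finset.mem_Icc.mp hj).1)
  · rintro ⟨i, k, j, l⟩ hq hne
    simp only [Finset.mem_product] at hq
    refine ⟨?_, ?_⟩
    · rintro ⟨h1, h2⟩
      simp only at h1 h2
      subst h1 h2
      exact hne (by simp only [hw.1 j hq.2.2.1 l hq.2.2.2, zero_mul])
    · rintro ⟨h1, h2⟩
      simp only at h1 h2
      subst h1 h2
      exact hne (by simp only [hw.2 i hq.1 k hq.2.1, zero_mul])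

end DualForms

lemma rectInt_laplacian {U : ℝ × ℝ → ℝ} (hU : ContDiff ℝ 2 U) (κ x₀ x₁ y₀ y₁ : ℝ) :
    rectInt (fun z => -(κ * (pdx (pdx U) z + pdy (pdy U) z))) x₀ x₁ y₀ y₁ =
      -(κ * (((∫ t in y₀..y₁, pdx U (x₁, t)) - ∫ t in y₀..y₁, pdx U (x₀, t)) +
        ((∫ s in x₀..x₁, pdy U (s, y₁)) - ∫ s in x₀..x₁, pdy U (s, y₀)))) := by
  have hx : ContDiff ℝ 1 (pdx U) := contDiff_pdx (n := 1) hU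
  have hy : ContDiff ℝ 1 (pdy U) := contDiff_pdy (n := 1) hU
  have hxx := continuous_pdx hx
  have hyy := continuous_pdy hy
  have hsec : ∀ s : ℝ, Continuous fun t : ℝ => ((s, t) : ℝ × ℝ) := fun s => by fun_prop
  have hsec' : ∀ t : ℝ, Continuous fun s : ℝ => ((s, t) : ℝ × ℝ) := fun t => by fun_prop
  have hix : ∀ s, IntervalIntegrable (fun t => pdx U (s, t)) volume y₀ y₁ := fun s =>
    (hx.continuous.comp (hsec s)).intervalIntegrable _ _
  have hiy : ∀ t, IntervalIntegrable (fun s => pdy U (s, t)) volume x₀ x₁ := fun t =>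
    (hy.continuous.comp (hsec' t)).intervalIntegrable _ _
  have e1 : ∫ s in x₀..x₁, ∫ t in y₀..y₁, pdx (pdx U) (s, t) =
      (∫ t in y₀..y₁, pdx U (x₁, t)) - ∫ t in y₀..y₁, pdx U (x₀, t) := by
    rw [integral_swap_of_continuous (f := fun s t => pdx (pdx U) (s, t)) hxx,
      ← intervalIntegral.integral_sub (hix x₁) (hix x₀)]
    refine intervalIntegral.integral_congr fun t _ => ?_
    exact intervalIntegral.integral_eq_sub_of_hasDerivAt
      (f := fun s => pdx U (s, t))
      (fun s _ => hasDerivAt_pdx (hx.differentiable (by simp)) s t)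
      ((hxx.comp (hsec' t)).intervalIntegrable _ _)
  have e2 : ∫ s in x₀..x₁, ∫ t in y₀..y₁, pdy (pdy U) (s, t) =
      (∫ s in x₀..x₁, pdy U (s, y₁)) - ∫ s in x₀..x₁, pdy U (s, y₀) := by
    rw [← intervalIntegral.integral_sub (hiy y₁) (hiy y₀)]
    refine intervalIntegral.integral_congr fun s _ => ?_
    exact intervalIntegral.integral_eq_sub_of_hasDerivAt
      (f := fun t => pdy U (s, t))
      (fun t _ => hasDerivAt_pdy (hy.differentiable (by simp)) s t)
      ((hyy.comp (hsec s)).intervalIntegrable _ _)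
  have hadd : ∀ s, ∫ t in y₀..y₁, (pdx (pdx U) (s, t) + pdy (pdy U) (s, t)) =
      (∫ t in y₀..y₁, pdx (pdx U) (s, t)) + ∫ t in y₀..y₁, pdy (pdy U) (s, t) := fun s =>
    intervalIntegral.integral_add ((hxx.comp (hsec s)).intervalIntegrable _ _)
      ((hyy.comp (hsec s)).intervalIntegrable _ _)
  have hpar : ∀ {g : ℝ × ℝ → ℝ}, Continuous g → Continuous fun s => ∫ t in y₀..y₁, g (s, t) :=
    fun {g} hg => intervalIntegral.continuous_parametric_intervalIntegral_of_continuous'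
      (f := fun s t => g (s, t)) hg _ _
  simp_rw [rectInt, intervalIntegral.integral_neg, intervalIntegral.integral_const_mul, hadd]
  rw [intervalIntegral.integral_add ((hpar hxx).intervalIntegrable _ _)
    ((hpar hyy).intervalIntegrable _ _), e1, e2]

/-- Discrete Green formula on a single cell. -/
lemma sum_rectInt_laplacian (r : ℕ) (G : ℕ → ℝ) {U : ℝ × ℝ → ℝ} (hU : ContDiff ℝ 2 U)
    (κ x₀ x₁ y₀ y₁ : ℝ) (W : ℕ → ℕ → ℝ) :
    ∑ k ∈ Finset.range (r + 1), ∑ l ∈ Finset.range (r + 1), W k l *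
      rectInt (fun z => -(κ * (pdx (pdx U) z + pdy (pdy U) z)))
        (aff x₀ x₁ (gaussExt r G k)) (aff x₀ x₁ (gaussExt r G (k + 1)))
        (aff y₀ y₁ (gaussExt r G l)) (aff y₀ y₁ (gaussExt r G (l + 1))) =
    κ * cellForm r G x₀ x₁ y₀ y₁ (fun k l => W k l - W (k - 1) l)
      (fun k l => W k l - W k (l - 1)) (pdx U) (pdy U) -
    ((∑ l ∈ Finset.range (r + 1), W r l *
        ∫ t in aff y₀ y₁ (gaussExt r G l)..aff y₀ y₁ (gaussExt r G (l + 1)), κ * pdx U (x₁, t)) -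
      ∑ l ∈ Finset.range (r + 1), W 0 l *
        ∫ t in aff y₀ y₁ (gaussExt r G l)..aff y₀ y₁ (gaussExt r G (l + 1)), κ * pdx U (x₀, t)) -
    ((∑ k ∈ Finset.range (r + 1), W k r *
        ∫ s in aff x₀ x₁ (gaussExt r G k)..aff x₀ x₁ (gaussExt r G (k + 1)), κ * pdy U (s, y₁)) -
      ∑ k ∈ Finset.range (r + 1), W k 0 *
        ∫ s in aff x₀ x₁ (gaussExt r G k)..aff x₀ x₁ (gaussExt r G (k + 1)),
          κ * pdy U (s, y₀)) := by
  simp_rw [rectInt_laplacian hU, intervalIntegral.integral_const_mul]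
  set T : ℕ → ℕ → ℝ := fun k l => ∫ t in aff y₀ y₁ (gaussExt r G l)..
    aff y₀ y₁ (gaussExt r G (l + 1)), pdx U (aff x₀ x₁ (gaussExt r G k), t) with hT
  set S : ℕ → ℕ → ℝ := fun k l => ∫ s in aff x₀ x₁ (gaussExt r G k)..
    aff x₀ x₁ (gaussExt r G (k + 1)), pdy U (s, aff y₀ y₁ (gaussExt r G l)) with hS
  have hcf : cellForm r G x₀ x₁ y₀ y₁ (fun k l => W k l - W (k - 1) l)
      (fun k l => W k l - W k (l - 1)) (pdx U) (pdy U) =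
      (∑ l ∈ Finset.range (r + 1), ∑ k ∈ Finset.Icc 1 r, (W k l - W (k - 1) l) * T k l) +
      ∑ k ∈ Finset.range (r + 1), ∑ l ∈ Finset.Icc 1 r, (W k l - W k (l - 1)) * S k l := by
    rw [cellForm, Finset.sum_comm]
    congr 1
    · exact Finset.sum_congr rfl fun l _ => Finset.sum_congr rfl fun k hk => by
        rw [hT]
        simp only [gaussExt_of_mem hk]
    · exact Finset.sum_congr rfl fun k _ => Finset.sum_congr rfl fun l hl => by
        rw [hS]
        simp only [gaussExt_of_mem hl]
  have hx := fun l => sum_range_mul_sub r (fun k => W k l) (fun k => T k l)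
  have hy := fun k => sum_range_mul_sub r (fun l => W k l) (fun l => S k l)
  have hsplit : ∀ k l, W k l * -(κ * ((T (k + 1) l - T k l) + (S k (l + 1) - S k l))) =
      -(κ * (W k l * (T (k + 1) l - T k l))) - κ * (W k l * (S k (l + 1) - S k l)) := by
    intro k l
    ring
  have hb1 : ∀ l, T (r + 1) l = ∫ t in aff y₀ y₁ (gaussExt r G l)..
      aff y₀ y₁ (gaussExt r G (l + 1)), pdx U (x₁, t) := fun l => by
    rw [hT]
    simp only [gaussExt_last, aff_one]
  have hb0 : ∀ l, T 0 l = ∫ t in aff y₀ y₁ (gaussExt r G l)..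
      aff y₀ y₁ (gaussExt r G (l + 1)), pdx U (x₀, t) := fun l => by
    rw [hT]
    simp only [gaussExt_zero, aff_neg_one]
  have hc1 : ∀ k, S k (r + 1) = ∫ s in aff x₀ x₁ (gaussExt r G k)..
      aff x₀ x₁ (gaussExt r G (k + 1)), pdy U (s, y₁) := fun l => by
    rw [hS]
    simp only [gaussExt_last, aff_one]
  have hc0 : ∀ k, S k 0 = ∫ s in aff x₀ x₁ (gaussExt r G k)..
      aff x₀ x₁ (gaussExt r G (k + 1)), pdy U (s, y₀) := fun l => by
    rw [hS]
    simp only [gaussExt_zero, aff_neg_one]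
  rw [hcf]
  simp_rw [← hb1, ← hb0, ← hc1, ← hc0, mul_left_comm (W _ _) κ, ← Finset.mul_sum]
  trans -(κ * ∑ l ∈ Finset.range (r + 1), ∑ k ∈ Finset.range (r + 1),
      W k l * (T (k + 1) l - T k l)) -
    κ * ∑ k ∈ Finset.range (r + 1), ∑ l ∈ Finset.range (r + 1), W k l * (S k (l + 1) - S k l)
  · rw [Finset.sum_comm (f := fun l k => W k l * (T (k + 1) l - T k l))]
    simp_rw [Finset.mul_sum, ← Finset.sum_neg_distrib, ← Finset.sum_sub_distrib]
    exact Finset.sum_congr rfl fun k _ => Finset.sum_congr rfl fun l _ => hsplit k l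
  · simp_rw [hx, hy, Finset.sum_sub_distrib]
    ring

section Consistency

variable {a b c d : ℝ} {P : RectPartition a b c d} {r : ℕ} {G : ℕ → ℝ}
  {w : ℕ → ℕ → ℕ → ℕ → ℝ}

lemma le_of_forall_lt_succ {n : ℕ} {y : ℕ → ℝ} (hy : ∀ j < n, y j < y (j + 1)) {i j : ℕ}
    (hij : i ≤ j) (hj : j ≤ n) : y i ≤ y j := by
  induction j, hij using Nat.le_induction with
  | base => exact le_rfl
  | succ k _ ih => exact (ih (by omega)).trans (hy k (by omega)).le

lemma RectPartition.cell_subset_dom (P : RectPartition a b c d) {i j : ℕ}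
    (hi : i ∈ Finset.Icc 1 P.m) (hj : j ∈ Finset.Icc 1 P.n) : P.cell i j ⊆ P.dom := by
  have hi' := Finset.mem_Icc.mp hi
  have hj' := Finset.mem_Icc.mp hj
  refine Set.prod_mono (Set.Icc_subset_Icc ?_ ?_) (Set.Icc_subset_Icc ?_ ?_)
  · exact P.hxa.symm.trans_le (le_of_forall_lt_succ P.hxlt (Nat.zero_le _) (by omega))
  · exact (le_of_forall_lt_succ P.hxlt hi'.2 le_rfl).trans_eq P.hxb
  · exact P.hyc.symm.trans_le (le_of_forall_lt_succ P.hylt (Nat.zero_le _) (by omega))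
  · exact (le_of_forall_lt_succ P.hylt hj'.2 le_rfl).trans_eq P.hyd

lemma RectPartition.openCell_subset_cell (P : RectPartition a b c d) (i j : ℕ) :
    P.openCell i j ⊆ P.cell i j :=
  Set.prod_mono Set.Ioo_subset_Icc_self Set.Ioo_subset_Icc_self

lemma RectPartition.eqOn_cell (P : RectPartition a b c d) {i j : ℕ} (hi : i ∈ Finset.Icc 1 P.m)
    (hj : j ∈ Finset.Icc 1 P.n) {f g : ℝ × ℝ → ℝ} (hf : ContinuousOn f P.dom) (hg : Continuous g)
    (h : ∀ z ∈ P.openCell i j, f z = g z) : ∀ z ∈ P.cell i j, f z = g z := by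
  refine Set.EqOn.of_subset_closure (s := P.openCell i j) h (hf.mono (P.cell_subset_dom hi hj))
    hg.continuousOn (P.openCell_subset_cell i j) ?_
  rw [RectPartition.openCell, closure_prod_eq, closure_Ioo (P.x_lt hi).ne,
    closure_Ioo (P.y_lt hj).ne]
  exact subset_rfl

lemma integral_dual_congr_Icc (hr : 1 ≤ r) (hG : IsGaussPoints r G) {lo hi : ℝ} (h : lo < hi)
    {l : ℕ} (hl : l ≤ r) {f g : ℝ → ℝ} (hfg : ∀ t ∈ Set.Icc lo hi, f t = g t) :
    ∫ t in aff lo hi (gaussExt r G l)..aff lo hi (gaussExt r G (l + 1)), f t =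
      ∫ t in aff lo hi (gaussExt r G l)..aff lo hi (gaussExt r G (l + 1)), g t :=
  integral_dual_congr hr hG h hl fun t ht => hfg t (Set.Ioo_subset_Icc_self ht)

/-- The exact solution satisfies the finite volume scheme. -/
lemma fvRHS_eq_sum_cellForm (hr : 1 ≤ r) (hG : IsGaussPoints r G) (hw : IsTestFun r P w)
    {α : ℝ × ℝ → ℝ} {κ : ℕ → ℕ → ℝ}
    (hκ : ∀ i ∈ Finset.Icc 1 P.m, ∀ j ∈ Finset.Icc 1 P.n, ∀ z ∈ P.openCell i j, α z = κ i j)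
    {u : PiecewiseFun P} (hu : CellSmooth P 2 u) (hflux : FluxContinuous P α u) :
    fvRHS r G P α u w = ∑ i ∈ Finset.Icc 1 P.m, ∑ j ∈ Finset.Icc 1 P.n, κ i j *
      cellForm r G (P.x (i - 1)) (P.x i) (P.y (j - 1)) (P.y j)
        (fun k l => jumpX r w i k j l) (fun k l => jumpY r w i k j l)
        (cellDx u i j) (cellDy u i j) := by
  obtain ⟨Fx, Fy, hFx, hFy, hF⟩ := hflux
  have hux : ∀ i ∈ Finset.Icc 1 P.m, ∀ j ∈ Finset.Icc 1 P.n, ∀ z ∈ P.cell i j,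
      Fx z = κ i j * pdx (u.cellFun i j) z := fun i hi j hj =>
    P.eqOn_cell hi hj hFx
      ((continuous_pdx ((hu i hi j hj).of_le (by norm_cast))).const_mul _)
      fun z hz => by rw [(hF i hi j hj z hz).1, hκ i hi j hj z hz, cellDx]
  have huy : ∀ i ∈ Finset.Icc 1 P.m, ∀ j ∈ Finset.Icc 1 P.n, ∀ z ∈ P.cell i j,
      Fy z = κ i j * pdy (u.cellFun i j) z := fun i hi j hj =>
    P.eqOn_cell hi hj hFy
      ((continuous_pdy ((hu i hi j hj).of_le (by norm_cast))).const_mul _)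
      fun z hz => by rw [(hF i hi j hj z hz).2, hκ i hi j hj z hz, cellDy]
  set A : ℕ → ℕ → ℕ → ℕ → ℝ := fun i' i k j => ∑ l ∈ Finset.range (r + 1), wE r w i k j l *
    ∫ t in aff (P.y (j - 1)) (P.y j) (gaussExt r G l)..
      aff (P.y (j - 1)) (P.y j) (gaussExt r G (l + 1)), Fx (P.x i', t) with hA
  set B : ℕ → ℕ → ℕ → ℕ → ℝ := fun j' j l i => ∑ k ∈ Finset.range (r + 1), wE r w i k j l *
    ∫ s in aff (P.x (i - 1)) (P.x i) (gaussExt r G k)..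
      aff (P.x (i - 1)) (P.x i) (gaussExt r G (k + 1)), Fy (s, P.y j') with hB
  have hcell : ∀ i ∈ Finset.Icc 1 P.m, ∀ j ∈ Finset.Icc 1 P.n,
      ∑ k ∈ Finset.range (r + 1), ∑ l ∈ Finset.range (r + 1), wE r w i k j l *
        rectInt (cellSource α u i j)
          (aff (P.x (i - 1)) (P.x i) (gaussExt r G k))
          (aff (P.x (i - 1)) (P.x i) (gaussExt r G (k + 1)))
          (aff (P.y (j - 1)) (P.y j) (gaussExt r G l))
          (aff (P.y (j - 1)) (P.y j) (gaussExt r G (l + 1))) =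
      κ i j * cellForm r G (P.x (i - 1)) (P.x i) (P.y (j - 1)) (P.y j)
        (fun k l => jumpX r w i k j l) (fun k l => jumpY r w i k j l)
        (cellDx u i j) (cellDy u i j) -
      (A i i r j - A (i - 1) i 0 j) - (B j j r i - B (j - 1) j 0 i) := by
    intro i hi j hj
    have hxl := P.x_lt hi
    have hyl := P.y_lt hj
    have hgreen := sum_rectInt_laplacian r G (hu i hi j hj) (κ i j) (P.x (i - 1)) (P.x i)
      (P.y (j - 1)) (P.y j) (fun k l => wE r w i k j l)
    have hAx : ∀ x' ∈ Set.Icc (P.x (i - 1)) (P.x i), ∀ k, ∑ l ∈ Finset.range (r + 1),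
        wE r w i k j l * ∫ t in aff (P.y (j - 1)) (P.y j) (gaussExt r G l)..
          aff (P.y (j - 1)) (P.y j) (gaussExt r G (l + 1)),
            κ i j * pdx (u.cellFun i j) (x', t) =
        ∑ l ∈ Finset.range (r + 1),
        wE r w i k j l * ∫ t in aff (P.y (j - 1)) (P.y j) (gaussExt r G l)..
          aff (P.y (j - 1)) (P.y j) (gaussExt r G (l + 1)), Fx (x', t) := by
      intro x' hx' k
      refine Finset.sum_congr rfl fun l hl => ?_
      rw [integral_dual_congr_Icc hr hG hyl (Finset.mem_range_succ_iff.mp hl)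
        fun t ht => (hux i hi j hj (x', t) ⟨hx', ht⟩).symm]
    have hBy : ∀ y' ∈ Set.Icc (P.y (j - 1)) (P.y j), ∀ l, ∑ k ∈ Finset.range (r + 1),
        wE r w i k j l * ∫ s in aff (P.x (i - 1)) (P.x i) (gaussExt r G k)..
          aff (P.x (i - 1)) (P.x i) (gaussExt r G (k + 1)),
            κ i j * pdy (u.cellFun i j) (s, y') =
        ∑ k ∈ Finset.range (r + 1),
        wE r w i k j l * ∫ s in aff (P.x (i - 1)) (P.x i) (gaussExt r G k)..
          aff (P.x (i - 1)) (P.x i) (gaussExt r G (k + 1)), Fy (s, y') := by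
      intro y' hy' l
      refine Finset.sum_congr rfl fun k hk => ?_
      rw [integral_dual_congr_Icc hr hG hxl (Finset.mem_range_succ_iff.mp hk)
        fun s hs => (huy i hi j hj (s, y') ⟨hs, hy'⟩).symm]
    rw [hAx _ ⟨hxl.le, le_rfl⟩, hAx _ ⟨le_rfl, hxl.le⟩, hBy _ ⟨hyl.le, le_rfl⟩,
      hBy _ ⟨le_rfl, hyl.le⟩] at hgreen
    refine Eq.trans ?_ hgreen
    refine Finset.sum_congr rfl fun k hk => Finset.sum_congr rfl fun l hl => ?_
    congr 1
    refine integral_dual_congr hr hG hxl (Finset.mem_range_succ_iff.mp hk) fun s hs => ?_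
    refine integral_dual_congr hr hG hyl (Finset.mem_range_succ_iff.mp hl) fun t ht => ?_
    rw [cellSource, hκ i hi j hj (s, t) ⟨hs, ht⟩]
  rw [fvRHS, sum_idxZ_eq hr hG hw,
    Finset.sum_congr rfl fun i hi => Finset.sum_congr rfl (hcell i hi)]
  have hAsum : ∑ i ∈ Finset.Icc 1 P.m, ∑ j ∈ Finset.Icc 1 P.n, A i i r j =
      ∑ i ∈ Finset.Icc 1 P.m, ∑ j ∈ Finset.Icc 1 P.n, A (i - 1) i 0 j := by
    refine sum_Icc_shift P.hm
      (b := fun i => ∑ j ∈ Finset.Icc 1 P.n, A (i - 1) i 0 j) ?_ ?_ ?_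
    · simp [hA, wE_one_zero_left]
    · refine Finset.sum_eq_zero fun j hj => Finset.sum_eq_zero fun l hl => ?_
      rw [hw.wE_last_left hr hj (Finset.mem_range_succ_iff.mp hl), zero_mul]
    · intro i hi _
      simp only [hA, wE_succ_zero_left hr w (Finset.mem_Icc.mp hi).1, Nat.add_sub_cancel]
  have hBsum : ∑ i ∈ Finset.Icc 1 P.m, ∑ j ∈ Finset.Icc 1 P.n, B j j r i =
      ∑ i ∈ Finset.Icc 1 P.m, ∑ j ∈ Finset.Icc 1 P.n, B (j - 1) j 0 i := by
    refine Finset.sum_congr rfl fun i hi => ?_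
    refine sum_Icc_shift P.hn (b := fun j => B (j - 1) j 0 i) ?_ ?_ ?_
    · simp [hB, wE_one_zero_right]
    · refine Finset.sum_eq_zero fun k hk => ?_
      rw [hw.wE_last_right hr hi (Finset.mem_range_succ_iff.mp hk), zero_mul]
    · intro j hj _
      simp only [hB, wE_succ_zero_right hr w _ _ (Finset.mem_Icc.mp hj).1, Nat.add_sub_cancel]
  simp_rw [Finset.sum_sub_distrib]
  rw [hAsum, hBsum]
  ring

end Consistency

/-- The dual (piecewise constant) function attached to nodal values `V` on one cell. -/
noncomputable def dualFun (r : ℕ) (G L : ℕ → ℝ) (V : ℕ → ℕ → ℝ) (k l : ℕ) : ℝ :=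
  ∑ a ∈ Finset.range (r + 1), ∑ b ∈ Finset.range (r + 1),
    V a b * dualVal r G k (lobB r L a) * dualVal r G l (lobB r L b)

section DualFun

variable {r : ℕ} {G L : ℕ → ℝ}

lemma dualFun_swap (V : ℕ → ℕ → ℝ) (k l : ℕ) :
    dualFun r G L V k l = dualFun r G L (fun b a => V a b) l k := by
  rw [dualFun, Finset.sum_comm]
  exact Finset.sum_congr rfl fun b _ => Finset.sum_congr rfl fun a _ => by ring

lemma dualFun_zero_left (hL : IsLobattoPoints r L) (V : ℕ → ℕ → ℝ) (l : ℕ) :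
    dualFun r G L V 0 l = ∑ b ∈ Finset.range (r + 1), V 0 b * dualVal r G l (lobB r L b) := by
  have h0 : (0 : ℕ) ∈ Finset.range (r + 1) := by simp
  rw [dualFun, Finset.sum_eq_single_of_mem 0 h0]
  · simp [dualVal_zero, ← hL.1, eval_lobB hL h0 h0]
  · intro a ha hne
    simp [dualVal_zero, ← hL.1, eval_lobB hL ha h0, hne]

lemma dualFun_last_left (hr : 1 ≤ r) (hG : IsGaussPoints r G) (hL : IsLobattoPoints r L)
    (V : ℕ → ℕ → ℝ) (l : ℕ) :
    dualFun r G L V r l = ∑ b ∈ Finset.range (r + 1), V r b * dualVal r G l (lobB r L b) := by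
  have hrm : r ∈ Finset.range (r + 1) := by simp
  rw [dualFun, Finset.sum_eq_single_of_mem r hrm]
  · rw [dualVal_self hr hG (natDegree_lobB hL hrm).le, ← hL.2.1, eval_lobB hL hrm hrm]
    simp
  · intro a ha hne
    rw [dualVal_self hr hG (natDegree_lobB hL ha).le, ← hL.2.1, eval_lobB hL ha hrm]
    simp [hne]

lemma dualFun_sub_left (V : ℕ → ℕ → ℝ) {k : ℕ} (hk : 1 ≤ k) (l : ℕ) :
    dualFun r G L V k l - dualFun r G L V (k - 1) l = dualJump r G L V k l := by
  obtain ⟨k, rfl⟩ := Nat.exists_eq_add_of_le' hk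
  rw [Nat.add_sub_cancel, dualFun, dualFun, dualJump, ← Finset.sum_sub_distrib, Finset.mul_sum]
  refine Finset.sum_congr rfl fun a _ => ?_
  rw [← Finset.sum_sub_distrib, Finset.mul_sum]
  refine Finset.sum_congr rfl fun b _ => ?_
  rw [dualVal_succ]
  ring

lemma dualFun_sub_right (V : ℕ → ℕ → ℝ) (k : ℕ) {l : ℕ} (hl : 1 ≤ l) :
    dualFun r G L V k l - dualFun r G L V k (l - 1) = dualJumpY r G L V k l := by
  rw [dualFun_swap V k l, dualFun_swap V k (l - 1), dualFun_sub_left _ hl, dualJumpY]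

end DualFun

section TestFunction

variable {a b c d : ℝ} {P : RectPartition a b c d} {r : ℕ} {G L : ℕ → ℝ} {g : ℝ × ℝ → ℝ}

/-- The values of `g` at the Lobatto nodes of the cell `(i, j)`. -/
noncomputable def cellNodal (P : RectPartition a b c d) (L : ℕ → ℝ) (g : ℝ × ℝ → ℝ) (i j : ℕ) :
    ℕ → ℕ → ℝ := nodal L (P.x (i - 1)) (P.x i) (P.y (j - 1)) (P.y j) g

/-- The dual test function attached to a function `g` on the domain. -/
noncomputable def dualTest (r : ℕ) (G L : ℕ → ℝ) (P : RectPartition a b c d) (g : ℝ × ℝ → ℝ)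
    (i k j l : ℕ) : ℝ := dualFun r G L (cellNodal P L g i j) k l

lemma aff_mem_cell (hL : IsLobattoPoints r L) {i j : ℕ} (hi : i ∈ Finset.Icc 1 P.m)
    (hj : j ∈ Finset.Icc 1 P.n) {p q : ℕ} (hp : p ∈ Finset.range (r + 1))
    (hq : q ∈ Finset.range (r + 1)) :
    (aff (P.x (i - 1)) (P.x i) (L p), aff (P.y (j - 1)) (P.y j) (L q)) ∈ P.cell i j :=
  ⟨aff_mem (P.x_lt hi).le (hL.mem hp), aff_mem (P.y_lt hj).le (hL.mem hq)⟩

lemma RectPartition.mem_bdry_of_fst (P : RectPartition a b c d) {z : ℝ × ℝ} (hz : z ∈ P.dom)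
    (h : z.1 = a ∨ z.1 = b) : z ∈ P.bdry :=
  ⟨hz, fun hz' => h.elim (fun e => hz'.1.1.ne' e) fun e => hz'.1.2.ne e⟩

lemma RectPartition.mem_bdry_of_snd (P : RectPartition a b c d) {z : ℝ × ℝ} (hz : z ∈ P.dom)
    (h : z.2 = c ∨ z.2 = d) : z ∈ P.bdry :=
  ⟨hz, fun hz' => h.elim (fun e => hz'.2.1.ne' e) fun e => hz'.2.2.ne e⟩

lemma dualTest_one_zero_left (hL : IsLobattoPoints r L) (hg : ∀ z ∈ P.bdry, g z = 0) {j : ℕ}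
    (hj : j ∈ Finset.Icc 1 P.n) (l : ℕ) : dualTest r G L P g 1 0 j l = 0 := by
  have h1 : 1 ∈ Finset.Icc 1 P.m := Finset.mem_Icc.mpr ⟨le_rfl, P.hm⟩
  rw [dualTest, dualFun_zero_left hL]
  refine Finset.sum_eq_zero fun q hq => ?_
  rw [cellNodal, nodal, hg _ (P.mem_bdry_of_fst (P.cell_subset_dom h1 hj
    (aff_mem_cell hL h1 hj (by simp) hq)) (Or.inl ?_)), zero_mul]
  rw [hL.1, aff_neg_one]
  exact P.hxa

lemma dualTest_one_zero_right (hL : IsLobattoPoints r L) (hg : ∀ z ∈ P.bdry, g z = 0) {i : ℕ}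
    (hi : i ∈ Finset.Icc 1 P.m) (k : ℕ) : dualTest r G L P g i k 1 0 = 0 := by
  have h1 : 1 ∈ Finset.Icc 1 P.n := Finset.mem_Icc.mpr ⟨le_rfl, P.hn⟩
  rw [dualTest, dualFun_swap, dualFun_zero_left hL]
  refine Finset.sum_eq_zero fun q hq => ?_
  rw [cellNodal, nodal, hg _ (P.mem_bdry_of_snd (P.cell_subset_dom hi h1
    (aff_mem_cell hL hi h1 hq (by simp))) (Or.inl ?_)), zero_mul]
  rw [hL.1, aff_neg_one]
  exact P.hyc

lemma isTestFun_dualTest (hr : 1 ≤ r) (hG : IsGaussPoints r G) (hL : IsLobattoPoints r L)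
    (hg : ∀ z ∈ P.bdry, g z = 0) : IsTestFun r P (dualTest r G L P g) := by
  have hm : P.m ∈ Finset.Icc 1 P.m := Finset.mem_Icc.mpr ⟨P.hm, le_rfl⟩
  have hn : P.n ∈ Finset.Icc 1 P.n := Finset.mem_Icc.mpr ⟨P.hn, le_rfl⟩
  refine ⟨fun j hj l _ => ?_, fun i hi k _ => ?_⟩
  · rw [dualTest, dualFun_last_left hr hG hL]
    refine Finset.sum_eq_zero fun q hq => ?_
    rw [cellNodal, nodal, hg _ (P.mem_bdry_of_fst (P.cell_subset_dom hm hj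
      (aff_mem_cell hL hm hj (by simp) hq)) (Or.inr ?_)), zero_mul]
    rw [hL.2.1, aff_one]
    exact P.hxb
  · rw [dualTest, dualFun_swap, dualFun_last_left hr hG hL]
    refine Finset.sum_eq_zero fun q hq => ?_
    rw [cellNodal, nodal, hg _ (P.mem_bdry_of_snd (P.cell_subset_dom hi hn
      (aff_mem_cell hL hi hn hq (by simp))) (Or.inr ?_)), zero_mul]
    rw [hL.2.1, aff_one]
    exact P.hyd

lemma dualTest_succ_zero_left (hr : 1 ≤ r) (hG : IsGaussPoints r G) (hL : IsLobattoPoints r L)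
    (i j l : ℕ) : dualTest r G L P g (i + 1) 0 j l = dualTest r G L P g i r j l := by
  rw [dualTest, dualTest, dualFun_zero_left hL, dualFun_last_left hr hG hL]
  simp only [cellNodal, nodal, hL.1, hL.2.1, aff_neg_one, aff_one, Nat.add_sub_cancel]

lemma dualTest_succ_zero_right (hr : 1 ≤ r) (hG : IsGaussPoints r G) (hL : IsLobattoPoints r L)
    (i k j : ℕ) : dualTest r G L P g i k (j + 1) 0 = dualTest r G L P g i k j r := by
  rw [dualTest, dualTest, dualFun_swap, dualFun_zero_left hL, dualFun_swap,
    dualFun_last_left hr hG hL]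
  simp only [cellNodal, nodal, hL.1, hL.2.1, aff_neg_one, aff_one, Nat.add_sub_cancel]

lemma wE_dualTest (hr : 1 ≤ r) (hG : IsGaussPoints r G) (hL : IsLobattoPoints r L)
    (hg : ∀ z ∈ P.bdry, g z = 0) {i j : ℕ} (hi : i ∈ Finset.Icc 1 P.m)
    (hj : j ∈ Finset.Icc 1 P.n) (k l : ℕ) :
    wE r (dualTest r G L P g) i k j l = dualTest r G L P g i k j l := by
  have hi' := Finset.mem_Icc.mp hi
  have hj' := Finset.mem_Icc.mp hj
  have hcol : ∀ j l, dualTest r G L P g (if k = 0 then i - 1 else i) (if k = 0 then r else k) j l =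
      dualTest r G L P g i k j l := by
    intro j l
    split_ifs with hk
    · rw [hk, ← dualTest_succ_zero_left hr hG hL, Nat.sub_add_cancel hi'.1]
    · rfl
  have hrow : dualTest r G L P g i k (if l = 0 then j - 1 else j) (if l = 0 then r else l) =
      dualTest r G L P g i k j l := by
    split_ifs with hl
    · rw [hl, ← dualTest_succ_zero_right hr hG hL, Nat.sub_add_cancel hj'.1]
    · rfl
  rw [wE, hcol, hrow]
  split_ifs with h
  · rcases h with ⟨rfl, rfl⟩ | ⟨rfl, rfl⟩
    · exact (dualTest_one_zero_left hL hg hj l).symm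
    · exact (dualTest_one_zero_right hL hg hi k).symm
  · rfl

lemma jumpX_dualTest (hr : 1 ≤ r) (hG : IsGaussPoints r G) (hL : IsLobattoPoints r L)
    (hg : ∀ z ∈ P.bdry, g z = 0) {i j : ℕ} (hi : i ∈ Finset.Icc 1 P.m)
    (hj : j ∈ Finset.Icc 1 P.n) {k : ℕ} (hk : 1 ≤ k) (l : ℕ) :
    jumpX r (dualTest r G L P g) i k j l = dualJump r G L (cellNodal P L g i j) k l := by
  rw [jumpX, wE_dualTest hr hG hL hg hi hj, wE_dualTest hr hG hL hg hi hj, dualTest, dualTest,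
    dualFun_sub_left _ hk]

lemma jumpY_dualTest (hr : 1 ≤ r) (hG : IsGaussPoints r G) (hL : IsLobattoPoints r L)
    (hg : ∀ z ∈ P.bdry, g z = 0) {i j : ℕ} (hi : i ∈ Finset.Icc 1 P.m)
    (hj : j ∈ Finset.Icc 1 P.n) (k : ℕ) {l : ℕ} (hl : 1 ≤ l) :
    jumpY r (dualTest r G L P g) i k j l = dualJumpY r G L (cellNodal P L g i j) k l := by
  rw [jumpY, wE_dualTest hr hG hL hg hi hj, wE_dualTest hr hG hL hg hi hj, dualTest, dualTest,
    dualFun_sub_right _ _ hl]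

end TestFunction

lemma cellForm_congr (r : ℕ) (G : ℕ → ℝ) (x₀ x₁ y₀ y₁ : ℝ) {Jx Jy Jx' Jy' : ℕ → ℕ → ℝ}
    (Dx Dy : ℝ × ℝ → ℝ) (hx : ∀ k, 1 ≤ k → ∀ l, Jx k l = Jx' k l)
    (hy : ∀ k l, 1 ≤ l → Jy k l = Jy' k l) :
    cellForm r G x₀ x₁ y₀ y₁ Jx Jy Dx Dy = cellForm r G x₀ x₁ y₀ y₁ Jx' Jy' Dx Dy := by
  rw [cellForm, cellForm]
  congr 1
  · exact Finset.sum_congr rfl fun k hk => Finset.sum_congr rfl fun l _ => by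
      rw [hx k (Finset.mem_Icc.mp hk).1]
  · exact Finset.sum_congr rfl fun k _ => Finset.sum_congr rfl fun l hl => by
      rw [hy k l (Finset.mem_Icc.mp hl).1]

lemma cellForm_sub (r : ℕ) (G : ℕ → ℝ) (x₀ x₁ y₀ y₁ : ℝ) (Jx Jy : ℕ → ℕ → ℝ)
    {Dx Dy Dx' Dy' : ℝ × ℝ → ℝ} (hDx : Continuous Dx) (hDy : Continuous Dy) (hDx' : Continuous Dx')
    (hDy' : Continuous Dy') :
    cellForm r G x₀ x₁ y₀ y₁ Jx Jy (fun z => Dx z - Dx' z) (fun z => Dy z - Dy' z) =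
      cellForm r G x₀ x₁ y₀ y₁ Jx Jy Dx Dy - cellForm r G x₀ x₁ y₀ y₁ Jx Jy Dx' Dy' := by
  have hsx : ∀ {D : ℝ × ℝ → ℝ}, Continuous D → ∀ s lo hi,
      IntervalIntegrable (fun t => D (s, t)) volume lo hi := fun hD s lo hi =>
    Continuous.intervalIntegrable (by fun_prop) _ _
  have hsy : ∀ {D : ℝ × ℝ → ℝ}, Continuous D → ∀ t lo hi,
      IntervalIntegrable (fun s => D (s, t)) volume lo hi := fun hD t lo hi =>
    Continuous.intervalIntegrable (by fun_prop) _ _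
  have ex : ∀ s lo hi, ∫ t in lo..hi, (Dx (s, t) - Dx' (s, t)) =
      (∫ t in lo..hi, Dx (s, t)) - ∫ t in lo..hi, Dx' (s, t) := fun s lo hi =>
    intervalIntegral.integral_sub (hsx hDx _ _ _) (hsx hDx' _ _ _)
  have ey : ∀ t lo hi, ∫ s in lo..hi, (Dy (s, t) - Dy' (s, t)) =
      (∫ s in lo..hi, Dy (s, t)) - ∫ s in lo..hi, Dy' (s, t) := fun t lo hi =>
    intervalIntegral.integral_sub (hsy hDy _ _ _) (hsy hDy' _ _ _)
  simp_rw [cellForm, ex, ey, mul_sub, Finset.sum_sub_distrib]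
  ring

lemma interpXY_congr {r : ℕ} (L : ℕ → ℝ) {V W : ℕ → ℕ → ℝ} (h : ∀ p ∈ Finset.range (r + 1),
    ∀ q ∈ Finset.range (r + 1), V p q = W p q) (ξ η : ℝ) :
    interpXY r L V ξ η = interpXY r L W ξ η :=
  Finset.sum_congr rfl fun p hp => Finset.sum_congr rfl fun q hq => by rw [h p hp q hq]

lemma interpXY_sub (r : ℕ) (L : ℕ → ℝ) (V W : ℕ → ℕ → ℝ) (ξ η : ℝ) :
    interpXY r L V ξ η - interpXY r L W ξ η = interpXY r L (fun p q => V p q - W p q) ξ η := by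
  simp_rw [interpXY, sub_mul, Finset.sum_sub_distrib]

lemma pdx_sub {f g : ℝ × ℝ → ℝ} (hf : ContDiff ℝ 1 f) (hg : ContDiff ℝ 1 g) :
    pdx (fun z => f z - g z) = fun z => pdx f z - pdx g z := by
  funext z
  rw [pdx, fderiv_fun_sub (hf.differentiable (by simp) z) (hg.differentiable (by simp) z)]
  rfl

lemma pdy_sub {f g : ℝ × ℝ → ℝ} (hf : ContDiff ℝ 1 f) (hg : ContDiff ℝ 1 g) :
    pdy (fun z => f z - g z) = fun z => pdy f z - pdy g z := by
  funext z
  rw [pdy, fderiv_fun_sub (hf.differentiable (by simp) z) (hg.differentiable (by simp) z)]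
  rfl

lemma sum_sum_sqrt_mul_sqrt_le {s t : Finset ℕ} {f g : ℕ → ℕ → ℝ} (hf : ∀ i j, 0 ≤ f i j)
    (hg : ∀ i j, 0 ≤ g i j) :
    ∑ i ∈ s, ∑ j ∈ t, Real.sqrt (f i j) * Real.sqrt (g i j) ≤
      Real.sqrt (∑ i ∈ s, ∑ j ∈ t, f i j) * Real.sqrt (∑ i ∈ s, ∑ j ∈ t, g i j) := by
  simp_rw [← Finset.sum_product']
  exact Real.sum_sqrt_mul_sqrt_le _ (fun _ => hf _ _) fun _ => hg _ _

lemma RectPartition.hx_le_meshSize {a b c d : ℝ} (P : RectPartition a b c d) {i : ℕ}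
    (hi : i ∈ Finset.Icc 1 P.m) : P.x i - P.x (i - 1) ≤ P.meshSize :=
  Finset.le_max' _ _ (Finset.mem_union_left _ (Finset.mem_image_of_mem P.hx hi))

lemma RectPartition.hy_le_meshSize {a b c d : ℝ} (P : RectPartition a b c d) {j : ℕ}
    (hj : j ∈ Finset.Icc 1 P.n) : P.y j - P.y (j - 1) ≤ P.meshSize :=
  Finset.le_max' _ _ (Finset.mem_union_right _ (Finset.mem_image_of_mem P.hy hj))

lemma PiecewiseConstant.exists_cell_value {a b c d : ℝ} {P : RectPartition a b c d}
    {α : ℝ × ℝ → ℝ} (hα : PiecewiseConstant P α) {α₀ α₁ : ℝ}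
    (hb : ∀ z ∈ P.dom, α₀ ≤ α z ∧ α z ≤ α₁) :
    ∃ κ : ℕ → ℕ → ℝ, ∀ i ∈ Finset.Icc 1 P.m, ∀ j ∈ Finset.Icc 1 P.n,
      (∀ z ∈ P.openCell i j, α z = κ i j) ∧ α₀ ≤ κ i j ∧ κ i j ≤ α₁ := by
  refine ⟨fun i j => α ((P.x (i - 1) + P.x i) / 2, (P.y (j - 1) + P.y j) / 2),
    fun i hi j hj => ?_⟩
  have hx := P.x_lt hi
  have hy := P.y_lt hj
  have hmem : ((P.x (i - 1) + P.x i) / 2, (P.y (j - 1) + P.y j) / 2) ∈ P.openCell i j :=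
    ⟨⟨by dsimp only; linarith, by dsimp only; linarith⟩,
      ⟨by dsimp only; linarith, by dsimp only; linarith⟩⟩
  obtain ⟨κ, hκ⟩ := hα i hi j hj
  exact ⟨fun z hz => (hκ z hz).trans (hκ _ hmem).symm,
    hb _ (P.cell_subset_dom hi hj (P.openCell_subset_cell i j hmem))⟩

/-- Superconvergence of the finite volume solution to the Lobatto interpolant:
there is `C = C(r, σ) > 0` such that under the hypotheses of the `H¹` error
estimate (with cellwise `C^{r+2}` regularity),
`|u_I − u_P|₁ ≤ C (α₁/α₀) h^{r+1} |u|_{r+2,P}`. -/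
theorem fvm_superconvergence (r : ℕ) (hr : 1 ≤ r) (G : ℕ → ℝ)
    (hG : IsGaussPoints r G) (L : ℕ → ℝ) (hL : IsLobattoPoints r L)
    (σ : ℝ) (hσ : 1 ≤ σ) :
    ∃ C : ℝ, 0 < C ∧
      ∀ (a b c d : ℝ), a < b → c < d →
      ∀ P : RectPartition a b c d, P.QuasiUniform σ →
      ∀ (α : ℝ × ℝ → ℝ) (α₀ α₁ : ℝ), 0 < α₀ → PiecewiseConstant P α →
        (∀ z ∈ P.dom, α₀ ≤ α z ∧ α z ≤ α₁) →
      ∀ u : PiecewiseFun P, ContinuousOn u.toFun P.dom →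
        (∀ z ∈ P.bdry, u.toFun z = 0) → CellSmooth P (r + 2) u →
        FluxContinuous P α u →
      ∀ uI : PiecewiseFun P, IsLobattoInterp r L P u.toFun uI →
      ∀ uP : PiecewiseFun P, IsFVSolution r G P α u uP →
        semiH1 P (uI.sub uP) ≤ C * (α₁ / α₀) * P.meshSize ^ (r + 1) * brokenSemi P u (r + 2) := by
  obtain ⟨C, hC, hcons⟩ := exists_abs_cellForm_sub_le hr hG hL
  refine ⟨C, hC, ?_⟩
  intro a b c d _ _ P _ α α₀ α₁ hα₀ hα hαb u _ _ hu hflux uI hI uP hP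
  obtain ⟨κ, hκ⟩ := hα.exists_cell_value hαb
  have h1m : 1 ∈ Finset.Icc 1 P.m := Finset.mem_Icc.mpr ⟨le_rfl, P.hm⟩
  have h1n : 1 ∈ Finset.Icc 1 P.n := Finset.mem_Icc.mpr ⟨le_rfl, P.hn⟩
  have hα₁ : 0 < α₁ := hα₀.trans_le ((hκ 1 h1m 1 h1n).2.1.trans (hκ 1 h1m 1 h1n).2.2)
  have hh : 0 ≤ P.meshSize := (sub_pos.mpr (P.x_lt h1m)).le.trans (P.hx_le_meshSize h1m)
  set v := uI.sub uP with hv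
  have hv0 : ∀ z ∈ P.bdry, v.toFun z = 0 := fun z hz => by
    change uI.toFun z - uP.toFun z = 0
    rw [hI.1.2.1 z hz, hP.1.2.1 z hz, sub_zero]
  set w := dualTest r G L P v.toFun with hw
  have hwt : IsTestFun r P w := isTestFun_dualTest hr hG hL hv0
  -- the form restricted to a cell, tested with `w`
  set Q : ℕ → ℕ → (ℝ × ℝ → ℝ) → (ℝ × ℝ → ℝ) → ℝ := fun i j =>
    cellForm r G (P.x (i - 1)) (P.x i) (P.y (j - 1)) (P.y j)
      (fun k l => jumpX r w i k j l) (fun k l => jumpY r w i k j l) with hQ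
  have hsol : ∑ i ∈ Finset.Icc 1 P.m, ∑ j ∈ Finset.Icc 1 P.n,
        κ i j * Q i j (cellDx uP i j) (cellDy uP i j) =
      ∑ i ∈ Finset.Icc 1 P.m, ∑ j ∈ Finset.Icc 1 P.n,
        κ i j * Q i j (cellDx u i j) (cellDy u i j) := by
    have hκ' : ∀ i ∈ Finset.Icc 1 P.m, ∀ j ∈ Finset.Icc 1 P.n, ∀ z ∈ P.openCell i j,
        α z = κ i j := fun i hi j hj => (hκ i hi j hj).1
    have hu2 : CellSmooth P 2 u := fun i hi j hj => (hu i hi j hj).of_le (by norm_cast; omega)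
    have h := hP.2 w hwt
    rwa [aP_eq_sum_cellForm hr hG hwt hκ', fvRHS_eq_sum_cellForm hr hG hwt hκ' hu2 hflux] at h
  set E : ℕ → ℕ → ℝ := fun i j =>
    ∫ z in P.cell i j, ((cellDx v i j z) ^ 2 + (cellDy v i j z) ^ 2) with hE
  set B : ℕ → ℕ → ℝ := fun i j => ∑ t ∈ Finset.range (r + 2 + 1),
    ∫ z in P.cell i j, (pdx^[t] (pdy^[r + 2 - t] (u.cellFun i j)) z) ^ 2 with hB
  have hE0 : ∀ i j, 0 ≤ E i j := fun i j => integral_nonneg fun z => by positivity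
  have hB0 : ∀ i j, 0 ≤ B i j := fun i j =>
    Finset.sum_nonneg fun t _ => integral_nonneg fun z => by positivity
  have hcell : ∀ i ∈ Finset.Icc 1 P.m, ∀ j ∈ Finset.Icc 1 P.n,
      E i j ≤ Q i j (cellDx v i j) (cellDy v i j) ∧
      Q i j (cellDx v i j) (cellDy v i j) =
        Q i j (cellDx uI i j) (cellDy uI i j) - Q i j (cellDx uP i j) (cellDy uP i j) ∧
      |Q i j (cellDx uI i j) (cellDy uI i j) - Q i j (cellDx u i j) (cellDy u i j)| ≤
        C * P.meshSize ^ (r + 1) * (Real.sqrt (B i j) * Real.sqrt (E i j)) := by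
    intro i hi j hj
    have cI : ContDiff ℝ 1 (uI.cellFun i j) := (hI.1.2.2 i hi j hj).contDiff 1
    have cP : ContDiff ℝ 1 (uP.cellFun i j) := (hP.1.2.2 i hi j hj).contDiff 1
    have cu : ContDiff ℝ (r + 2 : ℕ) (u.cellFun i j) := hu i hi j hj
    have cu1 : ContDiff ℝ 1 (u.cellFun i j) := cu.of_le (by norm_cast; omega)
    have cv : ContDiff ℝ 1 (v.cellFun i j) := cI.sub cP
    have hQV : ∀ Dx Dy, Q i j Dx Dy = cellForm r G (P.x (i - 1)) (P.x i) (P.y (j - 1)) (P.y j)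
        (dualJump r G L (cellNodal P L v.toFun i j))
        (dualJumpY r G L (cellNodal P L v.toFun i j)) Dx Dy := fun Dx Dy =>
      cellForm_congr _ _ _ _ _ _ _ _ (fun k hk l => jumpX_dualTest hr hG hL hv0 hi hj hk l)
        fun k l hl => jumpY_dualTest hr hG hL hv0 hi hj k hl
    have hIu : ∀ ξ η, uI.cellFun i j (aff (P.x (i - 1)) (P.x i) ξ, aff (P.y (j - 1)) (P.y j) η) =
        interpXY r L (cellNodal P L (u.cellFun i j) i j) ξ η := fun ξ η => by
      rw [(hI.1.2.2 i hi j hj).eq_interpXY hL]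
      refine interpXY_congr L (fun p hp q hq => ?_) ξ η
      have hmem := aff_mem_cell hL hi hj hp hq
      have hnode : (aff (P.x (i - 1)) (P.x i) (L p), aff (P.y (j - 1)) (P.y j) (L q)) =
          lobattoNode P L i j p q := by
        simp only [lobattoNode, aff, RectPartition.hx, RectPartition.hy, Prod.mk.injEq]
        constructor <;> ring
      have hp' := Finset.mem_range.mp hp
      have hq' := Finset.mem_range.mp hq
      rw [cellNodal, nodal, nodal, uI.agree i hi j hj _ hmem, u.agree i hi j hj _ hmem, hnode,
        hI.2 i hi j hj p (Finset.mem_Icc.mpr ⟨by omega, by omega⟩) q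
          (Finset.mem_Icc.mpr ⟨by omega, by omega⟩)]
    have hvV : ∀ ξ η, v.cellFun i j (aff (P.x (i - 1)) (P.x i) ξ, aff (P.y (j - 1)) (P.y j) η) =
        interpXY r L (cellNodal P L v.toFun i j) ξ η := fun ξ η => by
      change uI.cellFun i j _ - uP.cellFun i j _ = _
      rw [(hI.1.2.2 i hi j hj).eq_interpXY hL, (hP.1.2.2 i hi j hj).eq_interpXY hL, interpXY_sub]
      refine interpXY_congr L (fun p hp q hq => ?_) ξ η
      exact v.agree i hi j hj _ (aff_mem_cell hL hi hj hp hq)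
    refine ⟨?_, ?_, ?_⟩
    · rw [hQV]
      exact setIntegral_grad_sq_le_cellForm hr hG hL cv (P.x_lt hi) (P.y_lt hj) hvV
    · have hdx : cellDx v i j = fun z => cellDx uI i j z - cellDx uP i j z := pdx_sub cI cP
      have hdy : cellDy v i j = fun z => cellDy uI i j z - cellDy uP i j z := pdy_sub cI cP
      rw [hdx, hdy]
      exact cellForm_sub _ _ _ _ _ _ _ _ (continuous_pdx cI) (continuous_pdy cI)
        (continuous_pdx cP) (continuous_pdy cP)
    · have h := hcons (u.cellFun i j) (uI.cellFun i j) (v.cellFun i j) _ _ _ _ _ P.meshSize cu cI cv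
        (P.x_lt hi) (P.y_lt hj) (P.hx_le_meshSize hi) (P.hy_le_meshSize hj) hIu hvV
      rw [← hQV] at h
      rwa [show Q i j (fun z => pdx (uI.cellFun i j) z - pdx (u.cellFun i j) z)
          (fun z => pdy (uI.cellFun i j) z - pdy (u.cellFun i j) z) =
          Q i j (cellDx uI i j) (cellDy uI i j) - Q i j (cellDx u i j) (cellDy u i j) from
        cellForm_sub _ _ _ _ _ _ _ _ (continuous_pdx cI) (continuous_pdy cI)
          (continuous_pdx cu1) (continuous_pdy cu1)] at h
  have hkey : α₀ * semiH1 P v ^ 2 ≤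
      α₁ * (C * P.meshSize ^ (r + 1)) * (brokenSemi P u (r + 2) * semiH1 P v) := by
    have hsq : semiH1 P v ^ 2 = ∑ i ∈ Finset.Icc 1 P.m, ∑ j ∈ Finset.Icc 1 P.n, E i j :=
      Real.sq_sqrt (Finset.sum_nonneg fun i _ => Finset.sum_nonneg fun j _ => hE0 i j)
    calc α₀ * semiH1 P v ^ 2
        = ∑ i ∈ Finset.Icc 1 P.m, ∑ j ∈ Finset.Icc 1 P.n, α₀ * E i j := by
          simp_rw [hsq, Finset.mul_sum]
      _ ≤ ∑ i ∈ Finset.Icc 1 P.m, ∑ j ∈ Finset.Icc 1 P.n,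
            κ i j * Q i j (cellDx v i j) (cellDy v i j) := by
          refine Finset.sum_le_sum fun i hi => Finset.sum_le_sum fun j hj => ?_
          have hk := (hκ i hi j hj).2.1
          exact mul_le_mul hk (hcell i hi j hj).1 (hE0 i j) (hα₀.le.trans hk)
      _ = ∑ i ∈ Finset.Icc 1 P.m, ∑ j ∈ Finset.Icc 1 P.n, κ i j *
            (Q i j (cellDx uI i j) (cellDy uI i j) - Q i j (cellDx u i j) (cellDy u i j)) := by
          rw [Finset.sum_congr rfl fun i hi => Finset.sum_congr rfl fun j hj => by
            rw [(hcell i hi j hj).2.1]]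
          simp_rw [mul_sub, Finset.sum_sub_distrib]
          rw [hsol]
      _ ≤ ∑ i ∈ Finset.Icc 1 P.m, ∑ j ∈ Finset.Icc 1 P.n, α₁ *
            (C * P.meshSize ^ (r + 1) * (Real.sqrt (B i j) * Real.sqrt (E i j))) := by
          refine Finset.sum_le_sum fun i hi => Finset.sum_le_sum fun j hj => ?_
          have hk := (hκ i hi j hj).2
          refine (mul_le_mul_of_nonneg_left ((le_abs_self _).trans (hcell i hi j hj).2.2)
            (hα₀.le.trans hk.1)).trans (mul_le_mul_of_nonneg_right hk.2 (by positivity))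
      _ = α₁ * (C * P.meshSize ^ (r + 1)) * ∑ i ∈ Finset.Icc 1 P.m, ∑ j ∈ Finset.Icc 1 P.n,
            Real.sqrt (B i j) * Real.sqrt (E i j) := by
          simp_rw [Finset.mul_sum, mul_assoc]
      _ ≤ α₁ * (C * P.meshSize ^ (r + 1)) * (brokenSemi P u (r + 2) * semiH1 P v) :=
          mul_le_mul_of_nonneg_left (sum_sum_sqrt_mul_sqrt_le hB0 hE0) (by positivity)
  have hS : 0 ≤ brokenSemi P u (r + 2) := Real.sqrt_nonneg _
  rcases (show 0 ≤ semiH1 P v from Real.sqrt_nonneg _).eq_or_lt with h0 | hpos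
  · rw [← h0]
    positivity
  · have h : semiH1 P v * α₀ ≤ α₁ * (C * P.meshSize ^ (r + 1)) * brokenSemi P u (r + 2) :=
      le_of_mul_le_mul_right (by linarith) hpos
    calc semiH1 P v ≤ α₁ * (C * P.meshSize ^ (r + 1)) * brokenSemi P u (r + 2) / α₀ :=
          (le_div_iff₀ hα₀).mpr h
      _ = C * (α₁ / α₀) * P.meshSize ^ (r + 1) * brokenSemi P u (r + 2) := by ring
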